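/- Let f ∈ 𝒜* be a unimodal map with recurrent critical point c. Assume that for each n = 1, 2, … there exists a nice interval T_n ∋ c together with three distinct return domains T'_n, Q_n, Q̂_n of T_n such that: (i) |T_n| → 0; (ii) c ∈ T'_n and f(Q_n) = f(Q̂_n); (iii) for each x ∈ T'_n ∩ ω(c), the first return of x to T_n lies in Q_n ∪ Q̂_n; (iv) for each x ∈ (Q_n ∪ Q̂_n) ∩ ω(c), the first return of x to T_n lies in T'_n. Then f restricted to ω(c) is topologically conjugate to an adding machine f_α : Δ_α → Δ_α for some sequence α. -/

import Mathlib

open Set Function MeasureTheory Filter Topology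
open scoped Classical

noncomputable section

/-- Length (Lebesgue measure) of a set of reals. -/
def len (S : Set ℝ) : ℝ := (volume S).toReal

/-- A bounded open interval. -/
def IsOpenInterval (S : Set ℝ) : Prop := ∃ a b : ℝ, a < b ∧ S = Set.Ioo a b

/-- The ω-limit set of a point under iteration of `f`. -/
def omegaLimitSet (f : ℝ → ℝ) (x : ℝ) : Set ℝ :=
  ⋂ N : ℕ, closure ((fun n => f^[n] x) '' {n : ℕ | N ≤ n})

/-- Unimodal maps of class 𝒜 with turning point `c`, which is non-flat of order `ℓ`:
continuous on `[0,1]`, strictly increasing on `[0,c]`, strictly decreasing on `[c,1]`,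
`C³` outside `c` with non-vanishing derivative, and `|ψ⁻¹ ∘ f ∘ φ (x)| = |x|^ℓ`
near `0` for `C³` local diffeomorphisms `φ, ψ` with `φ 0 = c`, `ψ 0 = f c`. -/
structure UnimodalA (f : ℝ → ℝ) (c ℓ : ℝ) : Prop where
  cont : ContinuousOn f (Set.Icc 0 1)
  maps : Set.MapsTo f (Set.Icc 0 1) (Set.Icc 0 1)
  c_mem : c ∈ Set.Ioo (0:ℝ) 1
  mono : StrictMonoOn f (Set.Icc 0 c)
  anti : StrictAntiOn f (Set.Icc c 1)
  smooth : ContDiffOn ℝ 3 f (Set.Icc 0 1 \ {c})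
  deriv_ne : ∀ x ∈ Set.Icc 0 1 \ {c}, deriv f x ≠ 0
  ell_gt_one : 1 < ℓ
  nonflat : ∃ φ ψ : ℝ → ℝ, φ 0 = c ∧ ψ 0 = f c ∧
    (∃ U ∈ 𝓝 (0:ℝ), ContDiffOn ℝ 3 φ U ∧ ContDiffOn ℝ 3 ψ U) ∧
    deriv φ 0 ≠ 0 ∧ deriv ψ 0 ≠ 0 ∧
    ∃ s : ℝ, |s| = 1 ∧ ∀ᶠ x in 𝓝 (0:ℝ), f (φ x) = ψ (s * |x| ^ ℓ)

/-- All periodic points of `f` in `[0,1]` are hyperbolic repelling. -/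
def AllPeriodicHyperbolicRepelling (f : ℝ → ℝ) : Prop :=
  ∀ x ∈ Set.Icc (0:ℝ) 1, ∀ p : ℕ, 0 < p → f^[p] x = x → 1 < |deriv (f^[p]) x|

/-- The class 𝒜₊ : maps in 𝒜 with all periodic points hyperbolic repelling. -/
def UnimodalAStar (f : ℝ → ℝ) (c ℓ : ℝ) : Prop :=
  UnimodalA f c ℓ ∧ AllPeriodicHyperbolicRepelling f

/-- A (minimal) metric attractor: a compact invariant set whose realm of attraction has
positive Lebesgue measure, while no proper compact invariant subset has this property. -/
def IsMetricAttractor (f : ℝ → ℝ) (X : Set ℝ) : Prop :=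
  IsCompact X ∧ X ⊆ Set.Icc 0 1 ∧ f '' X ⊆ X ∧
  0 < volume {x ∈ Set.Icc (0:ℝ) 1 | omegaLimitSet f x ⊆ X} ∧
  ∀ X' : Set ℝ, X' ⊂ X → IsCompact X' → f '' X' ⊆ X' →
    volume {x ∈ Set.Icc (0:ℝ) 1 | omegaLimitSet f x ⊆ X'} = 0

/-- A Cantor set: nonempty, compact, perfect, totally disconnected. -/
def IsCantorSet (X : Set ℝ) : Prop :=
  X.Nonempty ∧ IsCompact X ∧ Perfect X ∧ IsTotallyDisconnected X

/-- A nice interval: an open interval `T ⊆ [0,1]` such that the forward orbit of `∂T`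
never enters `T`, and `T` contains no fixed point of `f`. -/
def IsNiceInterval (f : ℝ → ℝ) (T : Set ℝ) : Prop :=
  IsOpenInterval T ∧ T ⊆ Set.Icc 0 1 ∧
  (∀ n : ℕ, ∀ x ∈ frontier T, f^[n] x ∉ T) ∧
  (∀ x ∈ T, f x ≠ x)

/-- A symmetric nice interval containing `c`: `f(∂T)` is a single point. -/
def IsSymmNice (f : ℝ → ℝ) (c : ℝ) (T : Set ℝ) : Prop :=
  IsNiceInterval f T ∧ c ∈ T ∧ ∃ y : ℝ, ∀ x ∈ frontier T, f x = y

/-- `D(T)`: the set of points entering `T` under some positive iterate. -/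
def entryDomain (f : ℝ → ℝ) (T : Set ℝ) : Set ℝ :=
  {x | ∃ k : ℕ, 1 ≤ k ∧ f^[k] x ∈ T}

/-- The return domain of `T` containing `x` (component of `D(T) ∩ T`). -/
def returnDomain (f : ℝ → ℝ) (T : Set ℝ) (x : ℝ) : Set ℝ :=
  connectedComponentIn (entryDomain f T ∩ T) x

/-- `U` is a return domain of `T`. -/
def IsReturnDomain (f : ℝ → ℝ) (T U : Set ℝ) : Prop :=
  ∃ x ∈ entryDomain f T ∩ T, U = returnDomain f T x

/-- `k` is the first return time of `x` to `T`. -/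
def IsFirstReturnTime (f : ℝ → ℝ) (T : Set ℝ) (x : ℝ) (k : ℕ) : Prop :=
  1 ≤ k ∧ f^[k] x ∈ T ∧ ∀ j : ℕ, 1 ≤ j → j < k → f^[j] x ∉ T

/-- `J` is a pull back of `V` by `f^k`, i.e. a connected component of `f^{-k}(V)`. -/
def IsPullbackBy (f : ℝ → ℝ) (V J : Set ℝ) (k : ℕ) : Prop :=
  ∃ x ∈ f^[k] ⁻¹' V, J = connectedComponentIn (f^[k] ⁻¹' V) x

/-- `J` is a child of `T` with transition time `k`: a unimodal pull back of `T`
containing `c`, i.e. `f^{k-1}` maps a neighborhood of `f(J)` diffeomorphically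
(injectively) onto `T`. -/
def IsChildWithTime (f : ℝ → ℝ) (c : ℝ) (T J : Set ℝ) (k : ℕ) : Prop :=
  1 ≤ k ∧ c ∈ J ∧ IsPullbackBy f T J k ∧
  ∃ W : Set ℝ, IsOpen W ∧ f '' J ⊆ W ∧ Set.InjOn (f^[k - 1]) W ∧ f^[k - 1] '' W = T

/-- `J` is a child of `T`. -/
def IsChild (f : ℝ → ℝ) (c : ℝ) (T J : Set ℝ) : Prop :=
  ∃ k : ℕ, IsChildWithTime f c T J k

/-- The number `ν(T)` of children of `T`. -/
def numChildren (f : ℝ → ℝ) (c : ℝ) (T : Set ℝ) : ℕ :=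
  {J : Set ℝ | IsChild f c T J}.ncard

/-- The interval `J` is `τ`-well inside the interval `I`: both components of `I ∖ J`
have length at least `τ·|J|`. -/
def WellInside (τ : ℝ) (J I : Set ℝ) : Prop :=
  ∃ a b a' b' : ℝ, a' ≤ a ∧ a < b ∧ b ≤ b' ∧ J = Set.Ioo a b ∧ I = Set.Ioo a' b' ∧
    τ * (b - a) ≤ a - a' ∧ τ * (b - a) ≤ b' - b

/-- A `τ`-nice interval: every return domain is `τ`-well inside it. -/
def IsTauNice (f : ℝ → ℝ) (τ : ℝ) (T : Set ℝ) : Prop :=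
  ∀ x ∈ entryDomain f T ∩ T, WellInside τ (returnDomain f T x) T

/-- A `τ`-non-central-nice interval: every return domain, except possibly the one
containing `c`, is `τ`-well inside it. -/
def IsNonCentralTauNice (f : ℝ → ℝ) (c : ℝ) (τ : ℝ) (T : Set ℝ) : Prop :=
  ∀ x ∈ entryDomain f T ∩ T, c ∉ returnDomain f T x →
    WellInside τ (returnDomain f T x) T

/-- `I` is a restrictive interval of period `s` for `f`. -/
def IsRenormInterval (f : ℝ → ℝ) (c : ℝ) (I : Set ℝ) (s : ℕ) : Prop :=
  (∃ a b : ℝ, a < b ∧ I = Set.Icc a b) ∧ c ∈ interior I ∧ 2 ≤ s ∧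
  (∀ i j : ℕ, i < j → j < s → interior (f^[i] '' I) ∩ interior (f^[j] '' I) = ∅) ∧
  f^[s] '' I ⊆ I ∧ f^[s] '' frontier I ⊆ frontier I

/-- `f` is renormalizable. -/
def Renormalizable (f : ℝ → ℝ) (c : ℝ) : Prop :=
  ∃ I s, IsRenormInterval f c I s

/-- `f` is infinitely renormalizable: restrictive intervals of arbitrarily large period. -/
def InfinitelyRenormalizable (f : ℝ → ℝ) (c : ℝ) : Prop :=
  ∀ N : ℕ, ∃ I s, N ≤ s ∧ IsRenormInterval f c I s

/-- `X` is a minimal set for `f`. -/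
def IsMinimalOn (f : ℝ → ℝ) (X : Set ℝ) : Prop :=
  X.Nonempty ∧ IsClosed X ∧ f '' X ⊆ X ∧
  ∀ x ∈ X, X ⊆ closure {y | ∃ n : ℕ, f^[n] x = y}

/-- The collection of connected components of `S` which intersect `ω(c)`. -/
def componentsMeeting (f : ℝ → ℝ) (c : ℝ) (S : Set ℝ) : Set (Set ℝ) :=
  {U | (∃ x ∈ S, U = connectedComponentIn S x) ∧ (U ∩ omegaLimitSet f c).Nonempty}

/-- The nice cover 𝒴 of `ω(c)` associated with a symmetric nice interval `Y`:
components of `Y ∪ D(Y)` meeting `ω(c)`. -/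
def niceCover (f : ℝ → ℝ) (c : ℝ) (Y : Set ℝ) : Set (Set ℝ) :=
  componentsMeeting f c (Y ∪ entryDomain f Y)

/-- `q(𝒴, n)`: the number of components of `f^{-n}(Y ∪ D(Y))` intersecting `ω(c)`. -/
def qCount (f : ℝ → ℝ) (c : ℝ) (Y : Set ℝ) (n : ℕ) : ℕ :=
  (componentsMeeting f c (f^[n] ⁻¹' (Y ∪ entryDomain f Y))).ncard

/-- `Y₋ₙ`: the component of `f^{-n}(Y ∪ D(Y))` containing `c`. -/
def criticalPullbackOfEntry (f : ℝ → ℝ) (c : ℝ) (Y : Set ℝ) (n : ℕ) : Set ℝ :=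
  connectedComponentIn (f^[n] ⁻¹' (Y ∪ entryDomain f Y)) c

/-- `𝒰` is an open cover of `X`. -/
def IsOpenCover (X : Set ℝ) (𝒰 : Set (Set ℝ)) : Prop :=
  (∀ U ∈ 𝒰, IsOpen U) ∧ X ⊆ ⋃₀ 𝒰

/-- The cover `⋁_{i=0}^{n-1} f^{-i} 𝒰`. -/
def coverJoin (f : ℝ → ℝ) (𝒰 : Set (Set ℝ)) (n : ℕ) : Set (Set ℝ) :=
  {V | ∃ U : Fin n → Set ℝ, (∀ i, U i ∈ 𝒰) ∧ V = ⋂ i : Fin n, f^[(i : ℕ)] ⁻¹' U i}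

/-- The topological complexity function `p(𝒰, n) = N(⋁_{i=0}^{n-1} f^{-i} 𝒰)`:
the minimal cardinality of a finite subcover of `X` from the joined cover. -/
def complexity (f : ℝ → ℝ) (X : Set ℝ) (𝒰 : Set (Set ℝ)) (n : ℕ) : ℕ :=
  sInf {m : ℕ | ∃ 𝒱 : Set (Set ℝ), 𝒱 ⊆ coverJoin f 𝒰 n ∧ 𝒱.Finite ∧
        X ⊆ ⋃₀ 𝒱 ∧ 𝒱.ncard = m}

/-- A maximal central cascade `T⁰ ⊃ T¹ ⊃ ⋯ ⊃ Tᵐ` with common first return time `s`. -/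
def IsMaximalCentralCascade (f : ℝ → ℝ) (c : ℝ) (T : ℕ → Set ℝ) (m s : ℕ) : Prop :=
  1 ≤ m ∧ 1 ≤ s ∧ (∀ i ≤ m, IsSymmNice f c (T i)) ∧
  (∀ i < m, T (i + 1) = returnDomain f (T i) c) ∧
  (∀ i < m, IsFirstReturnTime f (T i) c s) ∧ f^[s] c ∉ T m

/-- `Λ`: the union of the components of `I ∪ D(I)` which intersect `ω(c)`. -/
def LambdaSet (f : ℝ → ℝ) (c : ℝ) (I : Set ℝ) : Set ℝ :=
  {x | x ∈ I ∪ entryDomain f I ∧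
       (connectedComponentIn (I ∪ entryDomain f I) x ∩ omegaLimitSet f c).Nonempty}

/-- `Λ(T)`: points which enter `T` while staying in `Λ` before doing so. -/
def LambdaT (f : ℝ → ℝ) (c : ℝ) (I T : Set ℝ) : Set ℝ :=
  {x | ∃ k : ℕ, 1 ≤ k ∧ (∀ j < k, f^[j] x ∈ LambdaSet f c I) ∧ f^[k] x ∈ T}

/-- The fixed base interval `I`: a symmetric nice interval containing `c` such that
the associated `Λ` is compactly contained in `[f²(c), f(c)]`. -/
def GoodBase (f : ℝ → ℝ) (c : ℝ) (I : Set ℝ) : Prop :=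
  IsSymmNice f c I ∧ closure (LambdaSet f c I) ⊆ Set.Ioo (f (f c)) (f c)

/-- `λ(Y'|Y)`: the supremum over diffeomorphisms `f^s : J → Y` of
`|(f^s|J)^{-1}(Y')| / |J|`. -/
def lamRatio (f : ℝ → ℝ) (Y' Y : Set ℝ) : ℝ :=
  sSup {r : ℝ | ∃ (s : ℕ) (J : Set ℝ), IsOpenInterval J ∧
        Set.InjOn (f^[s]) J ∧ f^[s] '' J = Y ∧
        r = len (J ∩ f^[s] ⁻¹' Y') / len J}

/-- `ξ(Y'|Y) = 1 − λ(Y'|Y)`. -/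
def xiRel (f : ℝ → ℝ) (Y' Y : Set ℝ) : ℝ := 1 - lamRatio f Y' Y

/-- The empty space `ξ(T) = ξ(Λ(T) ∩ T | T)`. -/
def xiT (f : ℝ → ℝ) (c : ℝ) (I T : Set ℝ) : ℝ :=
  xiRel f (LambdaT f c I T ∩ T) T

/-- `Y_{-j}` in the chain of pull backs of `Y` along the orbit `c, f(c), …, fⁿ(c)`:
the component of `f^{-j}(Y)` containing `f^{n-j}(c)`. -/
def chainAt (f : ℝ → ℝ) (c : ℝ) (Y : Set ℝ) (n j : ℕ) : Set ℝ :=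
  connectedComponentIn (f^[j] ⁻¹' Y) (f^[n - j] c)

/-- The set of transition times `s_j` occurring in the chain from `Y_{-n}` to `Y`:
gaps between consecutive critical positions in the chain. -/
def essentialTimes (f : ℝ → ℝ) (c : ℝ) (Y : Set ℝ) (n : ℕ) : Set ℕ :=
  {s : ℕ | ∃ j j' : ℕ, j < j' ∧ j' ≤ n ∧ c ∈ chainAt f c Y n j ∧ c ∈ chainAt f c Y n j' ∧
    (∀ i : ℕ, j < i → i < j' → c ∉ chainAt f c Y n i) ∧ s = j' - j}

/-- The essential order `M_n(Y)`: the number of distinct transition times in the chain. -/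
def essentialOrder (f : ℝ → ℝ) (c : ℝ) (Y : Set ℝ) (n : ℕ) : ℕ :=
  (essentialTimes f c Y n).ncard

/-- The first (largest) child of `T`. -/
def IsFirstChild (f : ℝ → ℝ) (c : ℝ) (T J : Set ℝ) : Prop :=
  IsChild f c T J ∧ ∀ J', IsChild f c T J' → J' ⊆ J

/-- The second child of `T`: the second largest child. -/
def IsSecondChild (f : ℝ → ℝ) (c : ℝ) (T J : Set ℝ) : Prop :=
  IsChild f c T J ∧ ∃ J₁, IsFirstChild f c T J₁ ∧ J ⊂ J₁ ∧
    ∀ J', IsChild f c T J' → J' ≠ J₁ → J' ⊆ J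

/-- The principal nest `Y = Y₀ ⊃ Y₁ ⊃ ⋯` starting from `Y`. -/
def principalNest (f : ℝ → ℝ) (c : ℝ) (Y : Set ℝ) : ℕ → Set ℝ
  | 0 => Y
  | n + 1 => returnDomain f (principalNest f c Y n) c

/-- `f` has special combinatorics, witnessed by the symmetric nice interval `Y`:
`ω(c) ∋ c` is minimal and each annulus `Yₙ ∖ Yₙ₊₁` of the principal nest has
exactly one component intersecting `ω(c)`. -/
def SpecialCombinatorics (f : ℝ → ℝ) (c : ℝ) (Y : Set ℝ) : Prop :=
  c ∈ omegaLimitSet f c ∧ IsMinimalOn f (omegaLimitSet f c) ∧ IsSymmNice f c Y ∧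
  ∀ n : ℕ, ∃! U : Set ℝ,
    U ∈ componentsMeeting f c (principalNest f c Y n \ principalNest f c Y (n + 1))

/-- The adding machine map `f_α` on `Δ_α = Π i, {0, …, pᵢ − 1}`. -/
def addingMachine (p : ℕ → ℕ) (hp : ∀ i, 2 ≤ p i) (x : ∀ i, Fin (p i)) :
    ∀ i, Fin (p i) :=
  if h : ∃ l, (x l : ℕ) + 1 < p l then fun i =>
    if i < Nat.find h then ⟨0, by have := hp i; omega⟩
    else if hi : i = Nat.find h then
      ⟨(x i : ℕ) + 1, by rw [hi]; exact Nat.find_spec h⟩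
    else x i
  else fun i => ⟨0, by have := hp i; omega⟩

/-- `f` restricted to `X` is topologically conjugate to an adding machine. -/
def ConjugateToAddingMachine (f : ℝ → ℝ) (X : Set ℝ) : Prop :=
  ∃ (p : ℕ → ℕ) (hp : ∀ i, 2 ≤ p i) (φ : ℝ → ∀ i, Fin (p i)),
    ContinuousOn φ X ∧ Set.InjOn φ X ∧ φ '' X = Set.univ ∧
    ∀ x ∈ X, φ (f x) = addingMachine p hp (φ x)

/-- `f` restricted to `X` is equicontinuous (w.r.t. all iterates). -/
def EquicontinuousOnSet (f : ℝ → ℝ) (X : Set ℝ) : Prop :=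
  ∀ ε > 0, ∃ δ > 0, ∀ x ∈ X, ∀ y ∈ X, |x - y| < δ →
    ∀ n : ℕ, |f^[n] x - f^[n] y| < ε

/-- A unimodal self-map of the line, preserving `[0,1]`, under which points far from `[0,1]`
never come back. -/
structure ProperUnimodal (F : ℝ → ℝ) (c : ℝ) : Prop where
  cont : Continuous F
  mono : StrictMonoOn F (Iic c)
  anti : StrictAntiOn F (Ici c)
  c_mem : c ∈ Ioo (0:ℝ) 1
  maps : MapsTo F (Icc 0 1) (Icc 0 1)
  low : ∀ B, 1 ≤ B → ∀ x, (x ≤ -B ∨ 1 + B ≤ x) → F x ≤ -B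

/-- The first `m` images of `(a,d)` avoid the turning point. -/
def NoTurn (F : ℝ → ℝ) (c : ℝ) (m : ℕ) (a d : ℝ) : Prop :=
  ∀ v < m, ∀ x ∈ Ioo a d, F^[v] x ≠ c

/-- `g` sends the endpoints of `(a,d)` to the endpoints of `(y₁,y₂)`. -/
def EndsTo (g : ℝ → ℝ) (a d y₁ y₂ : ℝ) : Prop :=
  (g a = y₁ ∧ g d = y₂) ∨ (g a = y₂ ∧ g d = y₁)

namespace ProperUnimodal

variable {F : ℝ → ℝ} {c : ℝ}

lemma lt_top (h : ProperUnimodal F c) {x : ℝ} (hx : x ≠ c) : F x < F c := by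
  rcases lt_or_gt_of_ne hx with hx | hx
  · exact h.mono hx.le (le_refl c) hx
  · exact h.anti (le_refl c) hx.le hx

lemma le_top (h : ProperUnimodal F c) (x : ℝ) : F x ≤ F c := by
  by_cases hx : x = c
  · rw [hx]
  · exact (h.lt_top hx).le

lemma iter_cont (h : ProperUnimodal F c) (m : ℕ) : Continuous F^[m] := h.cont.iterate m

lemma exists_right (h : ProperUnimodal F c) {y : ℝ} (hy : y ≤ F c) : ∃ x, c ≤ x ∧ F x = y := by
  have h1 := h.low (max 1 (-y)) (le_max_left _ _) (1 + max 1 (-y)) (Or.inr le_rfl)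
  have hc := h.c_mem
  have h2 : -y ≤ max 1 (-y) := le_max_right _ _
  have h3 : 1 ≤ max 1 (-y) := le_max_left _ _
  have hle : c ≤ 1 + max 1 (-y) := by linarith [hc.2]
  obtain ⟨x, hx, hxy⟩ := intermediate_value_Icc' hle h.cont.continuousOn
    (show y ∈ Icc _ _ from ⟨by linarith, hy⟩)
  exact ⟨x, hx.1, hxy⟩

lemma exists_left (h : ProperUnimodal F c) {y : ℝ} (hy : y ≤ F c) : ∃ x, x ≤ c ∧ F x = y := by
  have h1 := h.low (max 1 (-y)) (le_max_left _ _) (-max 1 (-y)) (Or.inl le_rfl)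
  have hc := h.c_mem
  have h2 : -y ≤ max 1 (-y) := le_max_right _ _
  have h3 : 1 ≤ max 1 (-y) := le_max_left _ _
  have hle : -max 1 (-y) ≤ c := by linarith [hc.1]
  obtain ⟨x, hx, hxy⟩ := intermediate_value_Icc hle h.cont.continuousOn
    (show y ∈ Icc _ _ from ⟨by linarith, hy⟩)
  exact ⟨x, hx.2, hxy⟩

lemma escape (h : ProperUnimodal F c) {B x : ℝ} (hB : 1 ≤ B) (hx : x ≤ -B ∨ 1 + B ≤ x) (m : ℕ) :
    F^[m] x ≤ -B ∨ 1 + B ≤ F^[m] x := by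
  induction m with
  | zero => exact hx
  | succ m ih => rw [iterate_succ_apply']; exact Or.inl (h.low B hB _ ih)

lemma maps_iter (h : ProperUnimodal F c) {x : ℝ} (hx : x ∈ Icc (0:ℝ) 1) (m : ℕ) :
    F^[m] x ∈ Icc (0:ℝ) 1 := h.maps.iterate m hx

lemma strict_of_side (h : ProperUnimodal F c) {S : Set ℝ} (hS : S ⊆ Iic c ∨ S ⊆ Ici c) :
    StrictMonoOn F S ∨ StrictAntiOn F S := by
  rcases hS with hS | hS
  · exact Or.inl (h.mono.mono hS)
  · exact Or.inr (h.anti.mono hS)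

lemma strict_iter (h : ProperUnimodal F c) {m : ℕ} {a d : ℝ} (had : a < d)
    (hn : NoTurn F c m a d) : StrictMonoOn F^[m] (Icc a d) ∨ StrictAntiOn F^[m] (Icc a d) := by
  induction m with
  | zero => exact Or.inl (fun x _ y _ hxy => hxy)
  | succ m ih =>
    have ih := ih (fun v hv => hn v (Nat.lt_succ_of_lt hv))
    have hside : F^[m] '' Icc a d ⊆ Iic c ∨ F^[m] '' Icc a d ⊆ Ici c := by
      have hconn : IsPreconnected (F^[m] '' Ioo a d) :=
        isPreconnected_Ioo.image _ (h.iter_cont m).continuousOn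
      have hnot : c ∉ F^[m] '' Ioo a d := by
        rintro ⟨x, hx, hxc⟩; exact hn m (Nat.lt_succ_self m) x hx hxc
      have hcl : F^[m] '' Icc a d ⊆ closure (F^[m] '' Ioo a d) := by
        rw [← closure_Ioo had.ne]
        exact image_closure_subset_closure_image (h.iter_cont m)
      have : F^[m] '' Ioo a d ⊆ Iic c ∨ F^[m] '' Ioo a d ⊆ Ici c := by
        by_contra hcon
        push Not at hcon
        obtain ⟨h1, h2⟩ := hcon
        rw [not_subset] at h1 h2
        obtain ⟨x, hx, hxc⟩ := h1
        obtain ⟨y, hy, hyc⟩ := h2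
        simp only [mem_Iic, not_le, mem_Ici] at hxc hyc
        exact hnot (hconn.ordConnected.out hy hx ⟨hyc.le, hxc.le⟩)
      rcases this with h1 | h1
      · exact Or.inl (hcl.trans (closure_minimal h1 isClosed_Iic))
      · exact Or.inr (hcl.trans (closure_minimal h1 isClosed_Ici))
    rw [iterate_succ']
    rcases ih with ih | ih <;> rcases h.strict_of_side hside with hs | hs
    · exact Or.inl (fun x hx y hy hxy => hs ⟨x, hx, rfl⟩ ⟨y, hy, rfl⟩ (ih hx hy hxy))
    · exact Or.inr (fun x hx y hy hxy => hs ⟨x, hx, rfl⟩ ⟨y, hy, rfl⟩ (ih hx hy hxy))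
    · exact Or.inr (fun x hx y hy hxy => hs ⟨y, hy, rfl⟩ ⟨x, hx, rfl⟩ (ih hx hy hxy))
    · exact Or.inl (fun x hx y hy hxy => hs ⟨y, hy, rfl⟩ ⟨x, hx, rfl⟩ (ih hx hy hxy))

lemma inj_iter (h : ProperUnimodal F c) {m : ℕ} {a d : ℝ} (had : a < d)
    (hn : NoTurn F c m a d) : InjOn F^[m] (Icc a d) := by
  rcases h.strict_iter had hn with h1 | h1
  · exact h1.injOn
  · exact h1.injOn

lemma mapsTo_of_ends (h : ProperUnimodal F c) {m : ℕ} {a d y₁ y₂ : ℝ} (had : a < d)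
    (hy : y₁ < y₂) (hn : NoTurn F c m a d) (he : EndsTo F^[m] a d y₁ y₂) :
    MapsTo F^[m] (Ioo a d) (Ioo y₁ y₂) := by
  intro x hx
  have ha : a ∈ Icc a d := ⟨le_rfl, had.le⟩
  have hd : d ∈ Icc a d := ⟨had.le, le_rfl⟩
  have hx' : x ∈ Icc a d := ⟨hx.1.le, hx.2.le⟩
  rcases h.strict_iter had hn with h1 | h1
  · have h2 := h1 ha hx' hx.1
    have h3 := h1 hx' hd hx.2
    rcases he with ⟨e1, e2⟩ | ⟨e1, e2⟩ <;> constructor <;> linarith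
  · have h2 := h1 ha hx' hx.1
    have h3 := h1 hx' hd hx.2
    rcases he with ⟨e1, e2⟩ | ⟨e1, e2⟩ <;> constructor <;> linarith

lemma surjOn_of_ends (h : ProperUnimodal F c) {m : ℕ} {a d y₁ y₂ : ℝ} (had : a < d)
    (he : EndsTo F^[m] a d y₁ y₂) : Ioo y₁ y₂ ⊆ F^[m] '' Ioo a d := by
  rcases he with ⟨e1, e2⟩ | ⟨e1, e2⟩
  · rw [← e1, ← e2]; exact intermediate_value_Ioo had.le (h.iter_cont m).continuousOn
  · rw [← e1, ← e2]; exact intermediate_value_Ioo' had.le (h.iter_cont m).continuousOn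

/-- Pulling back an interval along an orbit: either all pull backs avoid the turning point,
or there is a last pull back containing it. -/
lemma pullback (h : ProperUnimodal F c) (m : ℕ) : ∀ (p : ℝ) {y₁ y₂ : ℝ}, F^[m] p ∈ Ioo y₁ y₂ →
    (∃ a d, p ∈ Ioo a d ∧ NoTurn F c m a d ∧ EndsTo F^[m] a d y₁ y₂) ∨
    (∃ u l, u + 1 + l = m ∧ ∃ a d, F^[u + 1] p ∈ Ioo a d ∧ F c ∈ Ioo a d ∧ NoTurn F c l a d ∧
      EndsTo F^[l] a d y₁ y₂) := by
  induction m with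
  | zero =>
    intro p y₁ y₂ hp
    exact Or.inl ⟨y₁, y₂, hp, fun v hv => absurd hv (Nat.not_lt_zero v), Or.inl ⟨rfl, rfl⟩⟩
  | succ m ih =>
    intro p y₁ y₂ hp
    rw [iterate_succ_apply] at hp
    rcases ih (F p) hp with ⟨a, d, hpad, hn, he⟩ | ⟨u, l, hul, a, d, h1, h2, h3, h4⟩
    · by_cases hc : F c ∈ Ioo a d
      · exact Or.inr ⟨0, m, by omega, a, d, hpad, hc, hn, he⟩
      · have hdc : d ≤ F c := by
          by_contra hcon
          exact hc ⟨hpad.1.trans_le (h.le_top p), not_le.1 hcon⟩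
        have hac : a ≤ F c := (hpad.1.trans hpad.2).le.trans hdc
        have hpc : p ≠ c := by
          rintro rfl; exact absurd hpad.2 (not_lt.2 hdc)
        have had : a < d := hpad.1.trans hpad.2
        left
        rcases lt_or_gt_of_ne hpc with hlt | hgt
        · obtain ⟨a', ha'c, ha'⟩ := h.exists_left hac
          obtain ⟨d', hd'c, hd'⟩ := h.exists_left hdc
          have hmaps : ∀ x ∈ Ioo a' d', F x ∈ Ioo a d := fun x hx =>
            ⟨ha' ▸ h.mono ha'c (hx.2.le.trans hd'c) hx.1,
              hd' ▸ h.mono (hx.2.le.trans hd'c) hd'c hx.2⟩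
          refine ⟨a', d', ⟨?_, ?_⟩, ?_, ?_⟩
          · exact (h.mono.lt_iff_lt ha'c hlt.le).1 (ha'.symm ▸ hpad.1)
          · exact (h.mono.lt_iff_lt hlt.le hd'c).1 (hd'.symm ▸ hpad.2)
          · intro v hv x hx
            cases v with
            | zero => exact (hx.2.trans_le hd'c).ne
            | succ v => rw [iterate_succ_apply]; exact hn v (by omega) _ (hmaps x hx)
          · simpa only [EndsTo, iterate_succ_apply, ha', hd'] using he
        · obtain ⟨a', ha'c, ha'⟩ := h.exists_right hdc
          obtain ⟨d', hd'c, hd'⟩ := h.exists_right hac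
          have hmaps : ∀ x ∈ Ioo a' d', F x ∈ Ioo a d := fun x hx =>
            ⟨hd' ▸ h.anti (ha'c.trans hx.1.le) hd'c hx.2,
              ha' ▸ h.anti ha'c (ha'c.trans hx.1.le) hx.1⟩
          refine ⟨a', d', ⟨?_, ?_⟩, ?_, ?_⟩
          · exact (h.anti.lt_iff_gt hgt.le ha'c).1 (ha'.symm ▸ hpad.2)
          · exact (h.anti.lt_iff_gt hd'c hgt.le).1 (hd'.symm ▸ hpad.1)
          · intro v hv x hx
            cases v with
            | zero => exact (ha'c.trans_lt hx.1).ne'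
            | succ v => rw [iterate_succ_apply]; exact hn v (by omega) _ (hmaps x hx)
          · simpa only [EndsTo, iterate_succ_apply, ha', hd', or_comm, and_comm] using he
    · refine Or.inr ⟨u + 1, l, by omega, a, d, ?_, h2, h3, h4⟩
      rwa [iterate_succ_apply]

end ProperUnimodal

/-- The forward orbits of the endpoints of `(a,b)`, an interval around the turning point, do not
enter it. -/
structure NiceEnds (F : ℝ → ℝ) (c a b : ℝ) : Prop where
  mem : c ∈ Ioo a b
  left : ∀ n, F^[n] a ∉ Ioo a b
  right : ∀ n, F^[n] b ∉ Ioo a b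

/-- `(e₁,e₂)` is a component of the set of points entering `(a,b)` for the first time at time `k`. -/
structure Entry (F : ℝ → ℝ) (a b : ℝ) (k : ℕ) (e₁ e₂ : ℝ) : Prop where
  lt : e₁ < e₂
  ends : EndsTo F^[k] e₁ e₂ a b
  into : MapsTo F^[k] (Ioo e₁ e₂) (Ioo a b)
  before : ∀ j < k, ∀ x ∈ Ioo e₁ e₂, F^[j] x ∉ Ioo a b

lemma exists_end_between {a b x y : ℝ} (hx : x ∉ Ioo a b) (hy : y ∈ Ioo a b) :
    (x ≤ a ∧ a < y) ∨ (y < b ∧ b ≤ x) := by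
  by_cases h : x ≤ a
  · exact Or.inl ⟨h, hy.1⟩
  · exact Or.inr ⟨hy.2, not_lt.1 fun hb => hx ⟨not_le.1 h, hb⟩⟩

namespace Entry

variable {F : ℝ → ℝ} {a b e₁ e₂ : ℝ} {k : ℕ}

lemma noTurn {c : ℝ} (E : Entry F a b k e₁ e₂) (hc : c ∈ Ioo a b) : NoTurn F c k e₁ e₂ :=
  fun j hj x hx h => E.before j hj x hx (h ▸ hc)

lemma end_avoid_aux {c : ℝ} (h : ProperUnimodal F c) (hN : NiceEnds F c a b)
    (E : Entry F a b k e₁ e₂) {e : ℝ} (he : e = e₁ ∨ e = e₂) (n : ℕ) : F^[n] e ∉ Ioo a b := by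
  intro hn
  have hcl : e ∈ closure (Ioo e₁ e₂) := by
    rw [closure_Ioo E.lt.ne]
    rcases he with rfl | rfl
    · exact ⟨le_rfl, E.lt.le⟩
    · exact ⟨E.lt.le, le_rfl⟩
  rcases lt_or_ge n k with hnk | hnk
  · obtain ⟨y, hy, hy'⟩ := mem_closure_iff.1 hcl _ (isOpen_Ioo.preimage (h.iter_cont n)) hn
    exact E.before n hnk y hy' hy
  · obtain ⟨m, rfl⟩ := Nat.exists_eq_add_of_le' hnk
    rw [iterate_add_apply] at hn
    have : F^[k] e = a ∨ F^[k] e = b := by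
      rcases E.ends with ⟨h1, h2⟩ | ⟨h1, h2⟩ <;> rcases he with rfl | rfl <;> simp [*]
    rcases this with h1 | h1 <;> rw [h1] at hn
    · exact hN.left m hn
    · exact hN.right m hn

lemma left_avoid {c : ℝ} (h : ProperUnimodal F c) (hN : NiceEnds F c a b)
    (E : Entry F a b k e₁ e₂) (n : ℕ) : F^[n] e₁ ∉ Ioo a b :=
  E.end_avoid_aux h hN (Or.inl rfl) n

lemma right_avoid {c : ℝ} (h : ProperUnimodal F c) (hN : NiceEnds F c a b)
    (E : Entry F a b k e₁ e₂) (n : ℕ) : F^[n] e₂ ∉ Ioo a b :=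
  E.end_avoid_aux h hN (Or.inr rfl) n

lemma time_eq {k' : ℕ} {e₁' e₂' x : ℝ} (E : Entry F a b k e₁ e₂)
    (E' : Entry F a b k' e₁' e₂') (hx : x ∈ Ioo e₁ e₂) (hx' : x ∈ Ioo e₁' e₂') : k = k' := by
  by_contra hne
  rcases lt_or_gt_of_ne hne with h | h
  · exact E'.before k h x hx' (E.into hx)
  · exact E.before k' h x hx (E'.into hx')

lemma unique {c : ℝ} (h : ProperUnimodal F c) (hN : NiceEnds F c a b) {k' : ℕ} {e₁' e₂' x : ℝ}
    (E : Entry F a b k e₁ e₂) (E' : Entry F a b k' e₁' e₂') (hx : x ∈ Ioo e₁ e₂)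
    (hx' : x ∈ Ioo e₁' e₂') : k = k' ∧ e₁ = e₁' ∧ e₂ = e₂' := by
  refine ⟨E.time_eq E' hx hx', ?_, ?_⟩
  · by_contra hne
    rcases lt_or_gt_of_ne hne with h1 | h1
    · exact E'.left_avoid h hN k (E.into ⟨h1, hx'.1.trans hx.2⟩)
    · exact E.left_avoid h hN k' (E'.into ⟨h1, hx.1.trans hx'.2⟩)
  · by_contra hne
    rcases lt_or_gt_of_ne hne with h1 | h1
    · exact E.right_avoid h hN k' (E'.into ⟨hx'.1.trans hx.2, h1⟩)
    · exact E'.right_avoid h hN k (E.into ⟨hx.1.trans hx'.2, h1⟩)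

lemma image_eq {c : ℝ} (h : ProperUnimodal F c) (E : Entry F a b k e₁ e₂) :
    F^[k] '' Ioo e₁ e₂ = Ioo a b :=
  Subset.antisymm (image_subset_iff.2 E.into) (h.surjOn_of_ends E.lt E.ends)

end Entry

namespace ProperUnimodal

variable {F : ℝ → ℝ} {c : ℝ}

/-- The image of an interval under an iterate without turning points on it. -/
lemma image_Ioo (h : ProperUnimodal F c) {m : ℕ} {a d : ℝ} (had : a < d)
    (hn : NoTurn F c m a d) : ∃ y₁ y₂, y₁ < y₂ ∧ EndsTo F^[m] a d y₁ y₂ ∧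
      F^[m] '' Ioo a d = Ioo y₁ y₂ := by
  have ha : a ∈ Icc a d := ⟨le_rfl, had.le⟩
  have hd : d ∈ Icc a d := ⟨had.le, le_rfl⟩
  rcases h.strict_iter had hn with h1 | h1
  · have hy := h1 ha hd had
    have he : EndsTo F^[m] a d (F^[m] a) (F^[m] d) := Or.inl ⟨rfl, rfl⟩
    exact ⟨_, _, hy, he, Subset.antisymm (image_subset_iff.2 (h.mapsTo_of_ends had hy hn he))
      (h.surjOn_of_ends had he)⟩
  · have hy := h1 ha hd had
    have he : EndsTo F^[m] a d (F^[m] d) (F^[m] a) := Or.inr ⟨rfl, rfl⟩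
    exact ⟨_, _, hy, he, Subset.antisymm (image_subset_iff.2 (h.mapsTo_of_ends had hy hn he))
      (h.surjOn_of_ends had he)⟩

lemma exists_entry (h : ProperUnimodal F c) {a b : ℝ} (hN : NiceEnds F c a b) {x : ℝ} {k : ℕ}
    (hk : F^[k] x ∈ Ioo a b) (hbef : ∀ j < k, F^[j] x ∉ Ioo a b) :
    ∃ e₁ e₂, x ∈ Ioo e₁ e₂ ∧ Entry F a b k e₁ e₂ := by
  have hab : a < b := hN.mem.1.trans hN.mem.2
  rcases h.pullback k x hk with ⟨e₁, e₂, hx, hn, he⟩ | ⟨u, l, hul, α, δ, h1, h2, h3, h4⟩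
  · have hlt := hx.1.trans hx.2
    have hinto := h.mapsTo_of_ends hlt hab hn he
    refine ⟨e₁, e₂, hx, hlt, he, hinto, ?_⟩
    intro j hj y hy hyT
    obtain ⟨i, rfl⟩ := Nat.exists_eq_add_of_lt hj
    obtain ⟨y₁, y₂, hy12, -, him⟩ := h.image_Ioo hlt (fun v hv => hn v (by omega) :
      NoTurn F c j e₁ e₂)
    have hX : F^[j] x ∈ Ioo y₁ y₂ := him ▸ mem_image_of_mem _ hx
    have hY : F^[j] y ∈ Ioo y₁ y₂ := him ▸ mem_image_of_mem _ hy
    have key : ∀ z ∈ Ioo y₁ y₂, F^[i + 1] z ∈ Ioo a b := by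
      intro z hz
      rw [← him] at hz
      obtain ⟨w, hw, rfl⟩ := hz
      rw [← iterate_add_apply]
      have := hinto hw
      rwa [show i + 1 + j = j + i + 1 by ring]
    rcases exists_end_between (hbef j hj) hyT with ⟨p1, p2⟩ | ⟨p1, p2⟩
    · exact hN.left _ (key a ⟨hX.1.trans_le p1, p2.trans hY.2⟩)
    · exact hN.right _ (key b ⟨hY.1.trans p1, p2.trans_lt hX.2⟩)
  · exfalso
    have hαδ := h1.1.trans h1.2
    have hmap := h.mapsTo_of_ends hαδ hab h3 h4
    rw [iterate_succ_apply'] at h1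
    have key : ∀ z, F (F^[u] x) ≤ F z → F^[l + 1] z ∈ Ioo a b := by
      intro z hz
      rw [iterate_succ_apply]
      exact hmap ⟨h1.1.trans_le hz, (h.le_top z).trans_lt h2.2⟩
    rcases exists_end_between (hbef u (by omega)) hN.mem with ⟨p1, p2⟩ | ⟨p1, p2⟩
    · exact hN.left _ (key a (h.mono.monotoneOn (p1.trans p2.le) p2.le p1))
    · exact hN.right _ (key b (h.anti.antitoneOn p1.le (p1.le.trans p2) p2))

lemma exists_first (h : ProperUnimodal F c) {a b : ℝ} (hN : NiceEnds F c a b) {x : ℝ}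
    (hx : ∃ k, F^[k] x ∈ Ioo a b) : ∃ k e₁ e₂, x ∈ Ioo e₁ e₂ ∧ Entry F a b k e₁ e₂ := by
  obtain ⟨e₁, e₂, h1⟩ := h.exists_entry hN (Nat.find_spec hx) (fun j hj => Nat.find_min hx hj)
  exact ⟨_, e₁, e₂, h1⟩

lemma entry_image (h : ProperUnimodal F c) {a b e₁ e₂ : ℝ} {k w : ℕ} (hN : NiceEnds F c a b)
    (E : Entry F a b k e₁ e₂) (hw : w ≤ k) : ∃ y₁ y₂, Entry F a b (k - w) y₁ y₂ ∧
      EndsTo F^[w] e₁ e₂ y₁ y₂ ∧ F^[w] '' Ioo e₁ e₂ = Ioo y₁ y₂ := by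
  obtain ⟨y₁, y₂, hlt, he, him⟩ := h.image_Ioo E.lt (fun v hv => E.noTurn hN.mem v (by omega) :
      NoTurn F c w e₁ e₂)
  refine ⟨y₁, y₂, ⟨hlt, ?_, ?_, ?_⟩, he, him⟩
  · have hk : ∀ z, F^[k] z = F^[k - w] (F^[w] z) := fun z => by
      rw [← iterate_add_apply]; congr 1; omega
    have h1 := E.ends
    simp only [EndsTo, hk] at h1
    rcases he with ⟨q1, q2⟩ | ⟨q1, q2⟩ <;> rw [q1, q2] at h1
    · exact h1
    · rcases h1 with h1 | h1
      · exact Or.inr ⟨h1.2, h1.1⟩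
      · exact Or.inl ⟨h1.2, h1.1⟩
  · rw [← him]
    rintro _ ⟨z, hz, rfl⟩
    rw [← iterate_add_apply, show k - w + w = k by omega]
    exact E.into hz
  · intro j hj
    rw [← him]
    rintro _ ⟨z, hz, rfl⟩
    rw [← iterate_add_apply]
    exact E.before _ (by omega) z hz

end ProperUnimodal

/-- A nice interval `(a,b)` around the turning point, its central return domain `(t₁,t₂)` with
return time `r`, and two return domains `(l₁,l₂)` and `(r₁,r₂)` on different sides, with
the same image `(v₁,v₂)` and return time `s`, such that the critical orbit returns alternately to
the central domain and to the pair of lateral ones. -/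
structure Level (F : ℝ → ℝ) (c : ℝ) where
  (a b t₁ t₂ l₁ l₂ r₁ r₂ v₁ v₂ : ℝ)
  (r s : ℕ)
  nice : NiceEnds F c a b
  a_nonneg : 0 ≤ a
  b_le : b ≤ 1
  a_le : a ≤ l₁
  l_lt : l₁ < l₂
  l_le : l₂ ≤ t₁
  t_lt : t₁ < c
  lt_t : c < t₂
  le_r : t₂ ≤ r₁
  r_lt : r₁ < r₂
  le_b : r₂ ≤ b
  F_l₁ : F l₁ = v₁
  F_l₂ : F l₂ = v₂
  F_r₁ : F r₁ = v₂
  F_r₂ : F r₂ = v₁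
  F_t : F t₁ = F t₂
  r_pos : 1 ≤ r
  s_pos : 1 ≤ s
  t_entry : ∃ w, F c < w ∧ Entry F a b (r - 1) (F t₁) w
  q_entry : Entry F a b (s - 1) v₁ v₂
  orbit_t : ∀ i : ℕ, F^[(r + s) * i] c ∈ Ioo t₁ t₂
  orbit_q : ∀ i : ℕ, F^[(r + s) * i + r] c ∈ Ioo l₁ l₂ ∪ Ioo r₁ r₂

lemma connectedComponentIn_eq_Ioo {S : Set ℝ} {u₁ u₂ x : ℝ} (hx : x ∈ Ioo u₁ u₂)
    (hS : Ioo u₁ u₂ ⊆ S) (h₁ : u₁ ∉ S) (h₂ : u₂ ∉ S) : connectedComponentIn S x = Ioo u₁ u₂ := by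
  have hx' : x ∈ connectedComponentIn S x := mem_connectedComponentIn (hS hx)
  have hc : IsPreconnected (connectedComponentIn S x) := isPreconnected_connectedComponentIn
  have hsub := connectedComponentIn_subset S x
  apply Subset.antisymm
  · intro z hz
    constructor
    · by_contra hcon
      exact h₁ (hsub (hc.ordConnected.out hz hx' ⟨not_lt.1 hcon, hx.1.le⟩))
    · by_contra hcon
      exact h₂ (hsub (hc.ordConnected.out hx' hz ⟨hx.2.le, not_lt.1 hcon⟩))
  · exact isPreconnected_Ioo.subset_connectedComponentIn hx hS

namespace ProperUnimodal

variable {F : ℝ → ℝ} {c : ℝ}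

/-- The possible positions of a return domain with respect to the turning point. -/
def ReturnShape (F : ℝ → ℝ) (c : ℝ) (v₁ v₂ u₁ u₂ : ℝ) : Prop :=
  (F c ∈ Ioo v₁ v₂ ∧ u₁ < c ∧ c < u₂ ∧ F u₁ = v₁ ∧ F u₂ = v₁) ∨
  (v₂ ≤ F c ∧ u₁ < u₂ ∧ u₂ ≤ c ∧ F u₁ = v₁ ∧ F u₂ = v₂) ∨
  (v₂ ≤ F c ∧ u₁ < u₂ ∧ c ≤ u₁ ∧ F u₁ = v₂ ∧ F u₂ = v₁)

lemma returnDomain_shape (h : ProperUnimodal F c) {a b : ℝ} (hN : NiceEnds F c a b) {U : Set ℝ}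
    (hU : IsReturnDomain F (Ioo a b) U) :
    ∃ k v₁ v₂ u₁ u₂, Entry F a b k v₁ v₂ ∧ U = Ioo u₁ u₂ ∧ ReturnShape F c v₁ v₂ u₁ u₂ ∧
      a ≤ u₁ ∧ u₂ ≤ b ∧ MapsTo F (Ioo u₁ u₂) (Ioo v₁ v₂) := by
  obtain ⟨x, ⟨⟨n, hn1, hn⟩, hxT⟩, rfl⟩ := hU
  have hFx : ∃ k, F^[k] (F x) ∈ Ioo a b :=
    ⟨n - 1, by rw [← iterate_succ_apply, Nat.succ_eq_add_one, Nat.sub_add_cancel hn1]; exact hn⟩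
  obtain ⟨k, v₁, v₂, hv, E⟩ := h.exists_first hN hFx
  have hD : ∀ z, F z ∈ Ioo v₁ v₂ → z ∈ entryDomain F (Ioo a b) := fun z hz =>
    ⟨k + 1, by omega, by rw [iterate_succ_apply]; exact E.into hz⟩
  have hnD : ∀ z, (F z = v₁ ∨ F z = v₂) → z ∉ entryDomain F (Ioo a b) := by
    rintro z hz ⟨m, hm1, hm⟩
    obtain ⟨m, rfl⟩ := Nat.exists_eq_add_of_le' hm1
    rw [iterate_succ_apply] at hm
    rcases hz with hz | hz <;> rw [hz] at hm
    · exact E.left_avoid h hN m hm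
    · exact E.right_avoid h hN m hm
  have haD : a ∉ entryDomain F (Ioo a b) := fun ⟨m, _, hm⟩ => hN.left m hm
  have hbD : b ∉ entryDomain F (Ioo a b) := fun ⟨m, _, hm⟩ => hN.right m hm
  have fin : ∀ u₁ u₂, x ∈ Ioo u₁ u₂ → MapsTo F (Ioo u₁ u₂) (Ioo v₁ v₂) →
      (F u₁ = v₁ ∨ F u₁ = v₂) → (F u₂ = v₁ ∨ F u₂ = v₂) →
      returnDomain F (Ioo a b) x = Ioo u₁ u₂ ∧ a ≤ u₁ ∧ u₂ ≤ b := by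
    intro u₁ u₂ hx hmap h1 h2
    have hau : a ≤ u₁ := by
      by_contra hcon
      exact haD (hD a (hmap ⟨not_le.1 hcon, hxT.1.trans hx.2⟩))
    have hbu : u₂ ≤ b := by
      by_contra hcon
      exact hbD (hD b (hmap ⟨hx.1.trans hxT.2, not_le.1 hcon⟩))
    refine ⟨connectedComponentIn_eq_Ioo hx ?_ ?_ ?_, hau, hbu⟩
    · exact fun z hz => ⟨hD z (hmap hz), hau.trans_lt hz.1, hz.2.trans_le hbu⟩
    · exact fun hz => hnD _ h1 hz.1
    · exact fun hz => hnD _ h2 hz.1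
  have hv1c : v₁ < F c := hv.1.trans_le (h.le_top x)
  by_cases hcv : F c < v₂
  · obtain ⟨u₁, hu₁, e₁⟩ := h.exists_left hv1c.le
    obtain ⟨u₂, hu₂, e₂⟩ := h.exists_right hv1c.le
    have hu₁' : u₁ < c := lt_of_le_of_ne hu₁ (by rintro rfl; exact hv1c.ne' e₁)
    have hu₂' : c < u₂ := lt_of_le_of_ne hu₂ (by rintro rfl; exact hv1c.ne' e₂)
    have hmem : ∀ z, z ∈ Ioo u₁ u₂ ↔ v₁ < F z := by
      intro z
      constructor
      · intro hz
        rcases le_total z c with hzc | hzc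
        · rw [← e₁]; exact h.mono hu₁ hzc hz.1
        · rw [← e₂]; exact h.anti hzc hu₂ hz.2
      · intro hz
        constructor
        · by_contra hcon
          have := h.mono.monotoneOn ((not_lt.1 hcon).trans hu₁) hu₁ (not_lt.1 hcon)
          linarith
        · by_contra hcon
          have := h.anti.antitoneOn hu₂ (hu₂.trans (not_lt.1 hcon)) (not_lt.1 hcon)
          linarith
    have hmap : MapsTo F (Ioo u₁ u₂) (Ioo v₁ v₂) := fun z hz =>
      ⟨(hmem z).1 hz, (h.le_top z).trans_lt hcv⟩
    obtain ⟨f1, f2, f3⟩ := fin u₁ u₂ ((hmem x).2 hv.1) hmap (Or.inl e₁) (Or.inl e₂)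
    exact ⟨k, v₁, v₂, u₁, u₂, E, f1, Or.inl ⟨⟨hv1c, hcv⟩, hu₁', hu₂', e₁, e₂⟩, f2, f3, hmap⟩
  · have hcv := not_lt.1 hcv
    have hxc : x ≠ c := by rintro rfl; exact absurd hv.2 (not_lt.2 hcv)
    rcases lt_or_gt_of_ne hxc with hlt | hgt
    · obtain ⟨u₁, hu₁, e₁⟩ := h.exists_left hv1c.le
      obtain ⟨u₂, hu₂, e₂⟩ := h.exists_left hcv
      have hx : x ∈ Ioo u₁ u₂ := ⟨(h.mono.lt_iff_lt hu₁ hlt.le).1 (e₁.symm ▸ hv.1),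
        (h.mono.lt_iff_lt hlt.le hu₂).1 (e₂.symm ▸ hv.2)⟩
      have hmap : MapsTo F (Ioo u₁ u₂) (Ioo v₁ v₂) := fun z hz =>
        ⟨e₁ ▸ h.mono hu₁ (hz.2.le.trans hu₂) hz.1, e₂ ▸ h.mono (hz.2.le.trans hu₂) hu₂ hz.2⟩
      obtain ⟨f1, f2, f3⟩ := fin u₁ u₂ hx hmap (Or.inl e₁) (Or.inr e₂)
      exact ⟨k, v₁, v₂, u₁, u₂, E, f1, Or.inr (Or.inl ⟨hcv, hx.1.trans hx.2, hu₂, e₁, e₂⟩), f2, f3,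
        hmap⟩
    · obtain ⟨u₁, hu₁, e₁⟩ := h.exists_right hcv
      obtain ⟨u₂, hu₂, e₂⟩ := h.exists_right hv1c.le
      have hx : x ∈ Ioo u₁ u₂ := ⟨(h.anti.lt_iff_gt hgt.le hu₁).1 (e₁.symm ▸ hv.2),
        (h.anti.lt_iff_gt hu₂ hgt.le).1 (e₂.symm ▸ hv.1)⟩
      have hmap : MapsTo F (Ioo u₁ u₂) (Ioo v₁ v₂) := fun z hz =>
        ⟨e₂ ▸ h.anti (hu₁.trans hz.1.le) hu₂ hz.2, e₁ ▸ h.anti hu₁ (hu₁.trans hz.1.le) hz.1⟩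
      obtain ⟨f1, f2, f3⟩ := fin u₁ u₂ hx hmap (Or.inr e₁) (Or.inl e₂)
      exact ⟨k, v₁, v₂, u₁, u₂, E, f1, Or.inr (Or.inr ⟨hcv, hx.1.trans hx.2, hu₁, e₁, e₂⟩), f2, f3,
        hmap⟩

lemma firstReturn_eq {a b v₁ v₂ x : ℝ} {k m : ℕ}
    (E : Entry F a b k v₁ v₂) (hx : F x ∈ Ioo v₁ v₂) (hm : IsFirstReturnTime F (Ioo a b) x m) :
    m = k + 1 := by
  obtain ⟨h1, h2, h3⟩ := hm
  by_contra hne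
  rcases lt_or_gt_of_ne hne with hlt | hgt
  · obtain ⟨m, rfl⟩ := Nat.exists_eq_add_of_le' h1
    rw [iterate_succ_apply] at h2
    exact E.before m (by omega) _ hx h2
  · refine h3 (k + 1) (by omega) hgt ?_
    rw [iterate_succ_apply]; exact E.into hx

lemma exists_level (h : ProperUnimodal F c) {a b : ℝ} (hN : NiceEnds F c a b) (ha : 0 ≤ a)
    (hb : b ≤ 1) {T' Q Qh : Set ℝ} (hT' : IsReturnDomain F (Ioo a b) T')
    (hQ : IsReturnDomain F (Ioo a b) Q) (hQh : IsReturnDomain F (Ioo a b) Qh)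
    (hne : T' ≠ Q) (hneh : T' ≠ Qh) (hneq : Q ≠ Qh) (hc : c ∈ T') (him : F '' Q = F '' Qh)
    (h3 : ∀ n, F^[n] c ∈ T' → ∃ k, IsFirstReturnTime F (Ioo a b) (F^[n] c) k ∧
      F^[k] (F^[n] c) ∈ Q ∪ Qh)
    (h4 : ∀ n, F^[n] c ∈ Q ∪ Qh → ∃ k, IsFirstReturnTime F (Ioo a b) (F^[n] c) k ∧
      F^[k] (F^[n] c) ∈ T') : ∃ L : Level F c, L.a = a ∧ L.b = b := by
  obtain ⟨k, w₁, w₂, t₁, t₂, Et, rfl, sh, hat, hbt, mt⟩ := h.returnDomain_shape hN hT'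
  obtain ⟨kq, v₁, v₂, q₁, q₂, Eq, rfl, shq, haq, hbq, mq⟩ := h.returnDomain_shape hN hQ
  obtain ⟨kp, z₁, z₂, p₁, p₂, Ep, rfl, shp, hap, hbp, mp⟩ := h.returnDomain_shape hN hQh
  have sh' : F c ∈ Ioo w₁ w₂ ∧ t₁ < c ∧ c < t₂ ∧ F t₁ = w₁ ∧ F t₂ = w₁ := by
    rcases sh with sh | ⟨_, _, s1, _⟩ | ⟨_, _, s1, _⟩
    · exact sh
    · exact absurd hc.2 (not_lt.2 s1)
    · exact absurd hc.1 (not_lt.2 s1)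
  obtain ⟨hcw, ht₁, ht₂, e₁, e₂⟩ := sh'
  have side : ∀ {k v₁ v₂ q₁ q₂}, Entry F a b k v₁ v₂ → ReturnShape F c v₁ v₂ q₁ q₂ →
      Ioo t₁ t₂ ≠ Ioo q₁ q₂ → (v₂ ≤ F c ∧ q₁ < q₂ ∧ q₂ ≤ t₁ ∧ F q₁ = v₁ ∧ F q₂ = v₂) ∨
        (v₂ ≤ F c ∧ q₁ < q₂ ∧ t₂ ≤ q₁ ∧ F q₁ = v₂ ∧ F q₂ = v₁) := by
    intro k' v₁ v₂ q₁ q₂ E sh hne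
    have hvw : v₂ ≤ w₁ ∨ F c < v₂ := by
      by_contra hcon
      push Not at hcon
      exact E.right_avoid h hN k (Et.into ⟨hcon.1, hcon.2.trans_lt hcw.2⟩)
    rcases sh with ⟨s1, s2, s3, s4, s5⟩ | ⟨s1, s2, s3, s4, s5⟩ | ⟨s1, s2, s3, s4, s5⟩
    · exfalso
      obtain ⟨-, rfl, rfl⟩ := Et.unique h hN E hcw s1
      apply hne
      rw [h.mono.injOn ht₁.le s2.le (e₁.trans s4.symm), h.anti.injOn ht₂.le s3.le (e₂.trans s5.symm)]
    · have hvw : v₂ ≤ w₁ := hvw.resolve_right (not_lt.2 s1)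
      refine Or.inl ⟨s1, s2, ?_, s4, s5⟩
      exact (h.mono.le_iff_le s3 ht₁.le).1 (by rw [s5, e₁]; exact hvw)
    · have hvw : v₂ ≤ w₁ := hvw.resolve_right (not_lt.2 s1)
      refine Or.inr ⟨s1, s2, ?_, s4, s5⟩
      exact (h.anti.le_iff_ge s3 ht₂.le).1 (by rw [s4, e₂]; exact hvw)
  have imq : ∀ {v₁ v₂ q₁ q₂}, ((v₂ ≤ F c ∧ q₁ < q₂ ∧ q₂ ≤ t₁ ∧ F q₁ = v₁ ∧ F q₂ = v₂) ∨
        (v₂ ≤ F c ∧ q₁ < q₂ ∧ t₂ ≤ q₁ ∧ F q₁ = v₂ ∧ F q₂ = v₁)) →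
        MapsTo F (Ioo q₁ q₂) (Ioo v₁ v₂) → F '' Ioo q₁ q₂ = Ioo v₁ v₂ := by
    intro v₁ v₂ q₁ q₂ hs hm
    refine Subset.antisymm (image_subset_iff.2 hm) ?_
    rcases hs with ⟨_, s2, _, rfl, rfl⟩ | ⟨_, s2, _, rfl, rfl⟩
    · exact intermediate_value_Ioo s2.le h.cont.continuousOn
    · exact intermediate_value_Ioo' s2.le h.cont.continuousOn
  have sq := side Eq shq hne
  have sp := side Ep shp hneh
  rw [imq sq mq, imq sp mp] at him
  obtain ⟨x, hx⟩ := nonempty_Ioo.2 Eq.lt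
  obtain ⟨rfl, rfl, rfl⟩ := Eq.unique h hN Ep hx (him ▸ hx)
  have hrt : ∀ n, F^[n] c ∈ Ioo t₁ t₂ → F^[n + (k + 1)] c ∈ Ioo q₁ q₂ ∪ Ioo p₁ p₂ := by
    intro n hn
    obtain ⟨m, hm, hmem⟩ := h3 n hn
    rw [firstReturn_eq Et (mt hn) hm, ← iterate_add_apply, add_comm] at hmem
    exact hmem
  have hrq : ∀ n, F^[n] c ∈ Ioo q₁ q₂ ∪ Ioo p₁ p₂ → F^[n + (kq + 1)] c ∈ Ioo t₁ t₂ := by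
    intro n hn
    obtain ⟨m, hm, hmem⟩ := h4 n hn
    have hF : F (F^[n] c) ∈ Ioo v₁ v₂ := by
      rcases hn with hn | hn
      · exact mq hn
      · exact mp hn
    rw [firstReturn_eq Eq hF hm, ← iterate_add_apply, add_comm] at hmem
    exact hmem
  have horb : ∀ i : ℕ, F^[((k + 1) + (kq + 1)) * i] c ∈ Ioo t₁ t₂ := by
    intro i
    induction i with
    | zero => exact hc
    | succ i ih =>
      have := hrq _ (hrt _ ih)
      rwa [show (k + 1 + (kq + 1)) * i + (k + 1) + (kq + 1) = (k + 1 + (kq + 1)) * (i + 1) by ring]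
        at this
  have hte : ∃ w, F c < w ∧ Entry F a b (k + 1 - 1) (F t₁) w := ⟨w₂, hcw.2, by
    rw [e₁]; exact Et⟩
  rcases sq with ⟨s1, s2, s3, s4, s5⟩ | ⟨s1, s2, s3, s4, s5⟩ <;>
    rcases sp with ⟨u1, u2, u3, u4, u5⟩ | ⟨u1, u2, u3, u4, u5⟩
  · exfalso
    apply hneq
    rw [h.mono.injOn (s2.le.trans (s3.trans ht₁.le)) (u2.le.trans (u3.trans ht₁.le))
      (s4.trans u4.symm), h.mono.injOn (s3.trans ht₁.le) (u3.trans ht₁.le) (s5.trans u5.symm)]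
  · exact ⟨⟨a, b, t₁, t₂, q₁, q₂, p₁, p₂, v₁, v₂, k + 1, kq + 1, hN, ha, hb, haq, s2, s3, ht₁, ht₂,
      u3, u2, hbp, s4, s5, u4, u5, e₁.trans e₂.symm, by omega, by omega, hte, Eq, horb,
      fun i => hrt _ (horb i)⟩, rfl, rfl⟩
  · exact ⟨⟨a, b, t₁, t₂, p₁, p₂, q₁, q₂, v₁, v₂, k + 1, kq + 1, hN, ha, hb, hap, u2, u3, ht₁, ht₂,
      s3, s2, hbq, u4, u5, s4, s5, e₁.trans e₂.symm, by omega, by omega, hte, Eq, horb,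
      fun i => (hrt _ (horb i)).symm⟩, rfl, rfl⟩
  · exfalso
    apply hneq
    rw [h.anti.injOn (ht₂.le.trans s3) (ht₂.le.trans u3) (s4.trans u4.symm),
      h.anti.injOn (ht₂.le.trans (s3.trans s2.le)) (ht₂.le.trans (u3.trans u2.le))
        (s5.trans u5.symm)]

end ProperUnimodal

/-- The closure of the orbit of a point. -/
def orbitClosure (F : ℝ → ℝ) (c : ℝ) : Set ℝ := closure (range fun n : ℕ => F^[n] c)

namespace Level

variable {F : ℝ → ℝ} {c : ℝ}

/-- The period of the cyclic decomposition of the critical orbit closure. -/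
def N (L : Level F c) : ℕ := L.r + L.s

/-- The closure of the set of points of the critical orbit with times congruent to `j`. -/
def phase (L : Level F c) (j : ℕ) : Set ℝ :=
  closure {x | ∃ M : ℕ, M % L.N = j % L.N ∧ F^[M] c = x}

/-- Every point of the critical orbit closure enters the nice interval at a positive time. -/
def Reach (L : Level F c) : Prop := ∀ x ∈ orbitClosure F c, ∃ k, 1 ≤ k ∧ F^[k] x ∈ Ioo L.a L.b

variable (L : Level F c)

lemma N_pos : 0 < L.N := by have := L.r_pos; unfold N; omega

lemma r_lt_N : L.r < L.N := by have := L.s_pos; unfold N; omega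

lemma two_le_N : 2 ≤ L.N := by have := L.s_pos; have := L.r_pos; unfold N; omega

lemma a_lt_c : L.a < c := L.nice.mem.1

lemma c_lt_b : c < L.b := L.nice.mem.2

lemma t_sub : Ioo L.t₁ L.t₂ ⊆ Ioo L.a L.b := fun _ hz =>
  ⟨(L.a_le.trans (L.l_lt.le.trans L.l_le)).trans_lt hz.1,
    hz.2.trans_le (L.le_r.trans (L.r_lt.le.trans L.le_b))⟩

lemma l_sub : Ioo L.l₁ L.l₂ ⊆ Ioo L.a L.b := fun _ hz =>
  ⟨L.a_le.trans_lt hz.1, (hz.2.trans_le L.l_le).trans (L.t_lt.trans L.c_lt_b)⟩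

lemma r_sub : Ioo L.r₁ L.r₂ ⊆ Ioo L.a L.b := fun _ hz =>
  ⟨(L.a_lt_c.trans (L.lt_t.trans_le L.le_r)).trans hz.1, hz.2.trans_le L.le_b⟩

lemma q_sub : Ioo L.l₁ L.l₂ ∪ Ioo L.r₁ L.r₂ ⊆ Ioo L.a L.b := union_subset L.l_sub L.r_sub

lemma q_disj {z : ℝ} (hz : z ∈ Ioo L.l₁ L.l₂ ∪ Ioo L.r₁ L.r₂) : z ∉ Ioo L.t₁ L.t₂ := by
  intro ht
  rcases hz with hz | hz
  · exact absurd (hz.2.trans_le L.l_le) (not_lt.2 ht.1.le)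
  · exact absurd (L.le_r.trans_lt hz.1) (not_lt.2 ht.2.le)

section
variable (h : ProperUnimodal F c)
include h

lemma F_q {z : ℝ} (hz : z ∈ Ioo L.l₁ L.l₂ ∪ Ioo L.r₁ L.r₂) : F z ∈ Ioo L.v₁ L.v₂ := by
  have := L.l_le; have := L.t_lt; have := L.lt_t; have := L.le_r; have := L.l_lt; have := L.r_lt
  rcases hz with hz | hz
  · rw [← L.F_l₁, ← L.F_l₂]
    have h1 : z ≤ c := by linarith [hz.2]
    exact ⟨h.mono (by simp only [mem_Iic]; linarith) h1 hz.1,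
      h.mono h1 (by simp only [mem_Iic]; linarith) hz.2⟩
  · rw [← L.F_r₁, ← L.F_r₂]
    have h1 : c ≤ z := by linarith [hz.1]
    rw [L.F_r₂, ← L.F_r₂]
    exact ⟨h.anti h1 (by simp only [mem_Ici]; linarith) hz.2,
      h.anti (by simp only [mem_Ici]; linarith) h1 hz.1⟩

lemma F_t_lt {z : ℝ} (hz : z ∈ Ioo L.t₁ L.t₂) : F L.t₁ < F z := by
  rcases le_total z c with hc | hc
  · exact h.mono L.t_lt.le hc hz.1
  · rw [L.F_t]; exact h.anti hc L.lt_t.le hz.2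

lemma v₂_le : L.v₂ ≤ F L.t₁ := by
  rw [← L.F_l₂]; exact h.mono.monotoneOn (L.l_le.trans L.t_lt.le) L.t_lt.le L.l_le

lemma F_le_of_notMem {z : ℝ} (hz : z ∉ Ioo L.t₁ L.t₂) : F z ≤ F L.t₁ := by
  rcases exists_end_between hz ⟨L.t_lt, L.lt_t⟩ with ⟨h1, h2⟩ | ⟨h1, h2⟩
  · exact h.mono.monotoneOn (h1.trans h2.le) h2.le h1
  · rw [L.F_t]; exact h.anti.antitoneOn h1.le (h1.le.trans h2) h2

lemma F_le_v₁ {z : ℝ} (hz : z ∉ Ioo L.a L.b) : F z ≤ L.v₁ := by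
  have h1 := L.a_le; have h2 := L.le_b; have := L.l_lt; have := L.r_lt; have := L.l_le
  have := L.le_r; have := L.t_lt; have := L.lt_t
  rcases exists_end_between hz L.nice.mem with ⟨h3, h4⟩ | ⟨h3, h4⟩
  · rw [← L.F_l₁]
    exact h.mono.monotoneOn (h3.trans h4.le) (show L.l₁ ≤ c by linarith) (h3.trans h1)
  · rw [← L.F_r₂]
    exact h.anti.antitoneOn (show c ≤ L.r₂ by linarith) (h3.le.trans h4) (h2.trans h4)

lemma avoid_t : ∀ n, 1 ≤ n → F^[n] L.t₁ ∉ Ioo L.a L.b := by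
  intro n hn
  obtain ⟨n, rfl⟩ := Nat.exists_eq_add_of_le' hn
  obtain ⟨w, -, E⟩ := L.t_entry
  rw [iterate_succ_apply]
  exact E.left_avoid h L.nice n

lemma avoid_v₁ (n : ℕ) : F^[n] L.v₁ ∉ Ioo L.a L.b := L.q_entry.left_avoid h L.nice n

lemma avoid_v₂ (n : ℕ) : F^[n] L.v₂ ∉ Ioo L.a L.b := L.q_entry.right_avoid h L.nice n

lemma avoid_end {z : ℝ} (hz : z = L.t₁ ∨ z = L.t₂ ∨ z = L.l₁ ∨ z = L.l₂ ∨ z = L.r₁ ∨ z = L.r₂) :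
    ∀ n, 1 ≤ n → F^[n] z ∉ Ioo L.a L.b := by
  intro n hn
  obtain ⟨n, rfl⟩ := Nat.exists_eq_add_of_le' hn
  have h1 := L.avoid_t h (n + 1) (by omega)
  rw [iterate_succ_apply] at h1 ⊢
  have h2 := L.avoid_v₁ h n
  have h3 := L.avoid_v₂ h n
  rcases hz with rfl | rfl | rfl | rfl | rfl | rfl
  · exact h1
  · rwa [← L.F_t]
  · rwa [L.F_l₁]
  · rwa [L.F_l₂]
  · rwa [L.F_r₁]
  · rwa [L.F_r₂]

lemma F_t_mem {z : ℝ} (hz : z ∈ Ioo L.t₁ L.t₂) :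
    ∃ w, F z ∈ Ioo (F L.t₁) w ∧ F c ∈ Ioo (F L.t₁) w ∧ Entry F L.a L.b (L.r - 1) (F L.t₁) w := by
  obtain ⟨w, hw, E⟩ := L.t_entry
  exact ⟨w, ⟨L.F_t_lt h hz, (h.le_top z).trans_lt hw⟩, ⟨L.F_t_lt h ⟨L.t_lt, L.lt_t⟩, hw⟩, E⟩

lemma return_t {z : ℝ} (hz : z ∈ Ioo L.t₁ L.t₂) :
    ∀ j, 1 ≤ j → j < L.r → F^[j] z ∉ Ioo L.a L.b := by
  intro j h1 h2
  obtain ⟨w, hw, -, E⟩ := L.F_t_mem h hz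
  obtain ⟨j, rfl⟩ := Nat.exists_eq_add_of_le' h1
  rw [iterate_succ_apply]
  exact E.before j (by omega) _ hw

lemma return_q {z : ℝ} (hz : z ∈ Ioo L.l₁ L.l₂ ∪ Ioo L.r₁ L.r₂) :
    ∀ j, 1 ≤ j → j < L.s → F^[j] z ∉ Ioo L.a L.b := by
  intro j h1 h2
  obtain ⟨j, rfl⟩ := Nat.exists_eq_add_of_le' h1
  rw [iterate_succ_apply]
  exact L.q_entry.before j (by omega) _ (L.F_q h hz)

omit h in
lemma orbit_zero {M : ℕ} (hM : M % L.N = 0) : F^[M] c ∈ Ioo L.t₁ L.t₂ := by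
  have := L.orbit_t (M / L.N)
  rwa [show (L.r + L.s) * (M / L.N) = M from Nat.mul_div_cancel' (Nat.dvd_of_mod_eq_zero hM)]
    at this

omit h in
lemma orbit_r {M : ℕ} (hM : M % L.N = L.r) : F^[M] c ∈ Ioo L.l₁ L.l₂ ∪ Ioo L.r₁ L.r₂ := by
  have := L.orbit_q (M / L.N)
  rwa [show (L.r + L.s) * (M / L.N) + L.r = M by
    have := Nat.div_add_mod M L.N; rw [hM] at this; exact this] at this

lemma orbit_other {M : ℕ} (h0 : M % L.N ≠ 0) (hr : M % L.N ≠ L.r) : F^[M] c ∉ Ioo L.a L.b := by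
  have hlt := Nat.mod_lt M L.N_pos
  have hNr : L.N = L.r + L.s := rfl
  have hdiv := Nat.div_add_mod M L.N
  have hz : F^[L.N * (M / L.N)] c ∈ Ioo L.t₁ L.t₂ := L.orbit_t _
  have hq : F^[L.N * (M / L.N) + L.r] c ∈ Ioo L.l₁ L.l₂ ∪ Ioo L.r₁ L.r₂ := L.orbit_q _
  rcases lt_or_ge (M % L.N) L.r with h1 | h1
  · have := L.return_t h hz (M % L.N) (by omega) h1
    rwa [← iterate_add_apply, add_comm, hdiv] at this
  · have := L.return_q h hq (M % L.N - L.r) (by omega) (by omega)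
    rwa [← iterate_add_apply, show M % L.N - L.r + (L.N * (M / L.N) + L.r) = M by omega] at this

lemma phase_map {j : ℕ} {x : ℝ} (hx : x ∈ L.phase j) (n : ℕ) : F^[n] x ∈ L.phase (j + n) := by
  have : MapsTo F^[n] {x | ∃ M : ℕ, M % L.N = j % L.N ∧ F^[M] c = x}
      {x | ∃ M : ℕ, M % L.N = (j + n) % L.N ∧ F^[M] c = x} := by
    rintro _ ⟨M, hM, rfl⟩
    refine ⟨M + n, ?_, ?_⟩
    · rw [Nat.add_mod, hM, ← Nat.add_mod]
    · rw [add_comm, iterate_add_apply]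
  exact this.closure (h.iter_cont n) hx

end

lemma phase_congr {i j : ℕ} (hij : i % L.N = j % L.N) : L.phase i = L.phase j := by
  unfold phase; rw [hij]

lemma phase_sub (j : ℕ) : L.phase j ⊆ orbitClosure F c := by
  apply closure_mono
  rintro _ ⟨M, -, rfl⟩
  exact ⟨M, rfl⟩

lemma exists_phase {x : ℝ} (hx : x ∈ orbitClosure F c) : ∃ j < L.N, x ∈ L.phase j := by
  have hcl : IsClosed (⋃ j ∈ Iio L.N, L.phase j) :=
    (finite_Iio L.N).isClosed_biUnion fun j _ => isClosed_closure
  have hsub : range (fun n : ℕ => F^[n] c) ⊆ ⋃ j ∈ Iio L.N, L.phase j := by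
    rintro _ ⟨n, rfl⟩
    simp only [mem_iUnion]
    exact ⟨n % L.N, Nat.mod_lt _ L.N_pos, subset_closure ⟨n, (Nat.mod_mod _ _).symm, rfl⟩⟩
  have := closure_minimal hsub hcl hx
  simp only [mem_iUnion] at this
  obtain ⟨j, hj, hxj⟩ := this
  exact ⟨j, hj, hxj⟩

lemma orbit_mem_phase (n : ℕ) : F^[n] c ∈ L.phase n := subset_closure ⟨n, rfl, rfl⟩

section
variable (h : ProperUnimodal F c)
include h

lemma map_orbitClosure {x : ℝ} (hx : x ∈ orbitClosure F c) (n : ℕ) : F^[n] x ∈ orbitClosure F c := by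
  have : MapsTo F^[n] (range fun n : ℕ => F^[n] c) (range fun n : ℕ => F^[n] c) := by
    rintro _ ⟨M, rfl⟩
    exact ⟨n + M, iterate_add_apply _ _ _ _⟩
  exact this.closure (h.iter_cont n) hx

omit h in
lemma phase_zero_aux : L.phase 0 ⊆ Icc L.t₁ L.t₂ := by
  apply closure_minimal _ isClosed_Icc
  rintro _ ⟨M, hM, rfl⟩
  exact Ioo_subset_Icc_self (L.orbit_zero (hM.trans (Nat.zero_mod _)))

variable (hR : L.Reach)
include hR

omit h in
lemma notMem_of_avoid {z : ℝ} (hz : ∀ n, 1 ≤ n → F^[n] z ∉ Ioo L.a L.b) : z ∉ orbitClosure F c :=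
  fun hx => by obtain ⟨k, hk, hkT⟩ := hR z hx; exact hz k hk hkT

lemma phase_zero {j : ℕ} (hj : j % L.N = 0) : L.phase j ⊆ Ioo L.t₁ L.t₂ := by
  rw [L.phase_congr (hj.trans (Nat.zero_mod _).symm)]
  intro x hx
  have h1 := L.phase_zero_aux hx
  have hX := L.phase_sub 0 hx
  refine ⟨lt_of_le_of_ne h1.1 ?_, lt_of_le_of_ne h1.2 ?_⟩
  · rintro rfl; exact L.notMem_of_avoid hR (L.avoid_end h (by simp)) hX
  · rintro rfl; exact L.notMem_of_avoid hR (L.avoid_end h (by simp)) hX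

lemma phase_r {j : ℕ} (hj : j % L.N = L.r) : L.phase j ⊆ Ioo L.l₁ L.l₂ ∪ Ioo L.r₁ L.r₂ := by
  have h1 : L.phase j ⊆ Icc L.l₁ L.l₂ ∪ Icc L.r₁ L.r₂ := by
    apply closure_minimal _ (isClosed_Icc.union isClosed_Icc)
    rintro _ ⟨M, hM, rfl⟩
    exact union_subset_union Ioo_subset_Icc_self Ioo_subset_Icc_self (L.orbit_r (hM.trans hj))
  intro x hx
  have hX := L.phase_sub j hx
  rcases h1 hx with h1 | h1
  · refine Or.inl ⟨lt_of_le_of_ne h1.1 ?_, lt_of_le_of_ne h1.2 ?_⟩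
    · rintro rfl; exact L.notMem_of_avoid hR (L.avoid_end h (by simp)) hX
    · rintro rfl; exact L.notMem_of_avoid hR (L.avoid_end h (by simp)) hX
  · refine Or.inr ⟨lt_of_le_of_ne h1.1 ?_, lt_of_le_of_ne h1.2 ?_⟩
    · rintro rfl; exact L.notMem_of_avoid hR (L.avoid_end h (by simp)) hX
    · rintro rfl; exact L.notMem_of_avoid hR (L.avoid_end h (by simp)) hX

omit hR in
lemma phase_other {j : ℕ} (h0 : j % L.N ≠ 0) (hr : j % L.N ≠ L.r) {x : ℝ} (hx : x ∈ L.phase j) :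
    x ∉ Ioo L.a L.b := by
  have : L.phase j ⊆ (Ioo L.a L.b)ᶜ := by
    apply closure_minimal _ isOpen_Ioo.isClosed_compl
    rintro _ ⟨M, hM, rfl⟩
    exact L.orbit_other h (hM ▸ h0) (hM ▸ hr)
  exact this hx

lemma phase_t_iff {j : ℕ} {x : ℝ} (hx : x ∈ L.phase j) : x ∈ Ioo L.t₁ L.t₂ ↔ j % L.N = 0 := by
  refine ⟨fun ht => ?_, fun hj => L.phase_zero h hR hj hx⟩
  by_contra h0
  by_cases hr : j % L.N = L.r
  · exact L.q_disj (L.phase_r h hR hr hx) ht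
  · exact L.phase_other h h0 hr hx (L.t_sub ht)

lemma phase_q_iff {j : ℕ} {x : ℝ} (hx : x ∈ L.phase j) :
    x ∈ Ioo L.l₁ L.l₂ ∪ Ioo L.r₁ L.r₂ ↔ j % L.N = L.r := by
  refine ⟨fun ht => ?_, fun hj => L.phase_r h hR hj hx⟩
  by_contra hr
  by_cases h0 : j % L.N = 0
  · exact L.q_disj ht (L.phase_zero h hR h0 hx)
  · exact L.phase_other h h0 hr hx (L.q_sub ht)

lemma phase_T_iff {j : ℕ} {x : ℝ} (hx : x ∈ L.phase j) :
    x ∈ Ioo L.a L.b ↔ (j % L.N = 0 ∨ j % L.N = L.r) := by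
  constructor
  · intro hT
    by_contra hcon
    push Not at hcon
    exact L.phase_other h hcon.1 hcon.2 hx hT
  · rintro (hj | hj)
    · exact L.t_sub (L.phase_zero h hR hj hx)
    · exact L.q_sub (L.phase_r h hR hj hx)

lemma phase_unique {i j : ℕ} {x : ℝ} (hi : x ∈ L.phase i) (hj : x ∈ L.phase j) :
    i % L.N = j % L.N := by
  have hN := L.N_pos
  have hlt := Nat.mod_lt i hN
  have h1 := L.phase_map h hi (L.N - i % L.N)
  have h2 := L.phase_map h hj (L.N - i % L.N)
  have h3 : (i + (L.N - i % L.N)) % L.N = 0 := by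
    rw [Nat.add_mod, ← Nat.mod_mod i, ← Nat.add_mod, Nat.mod_mod, Nat.add_sub_cancel' hlt.le,
      Nat.mod_self]
  have h4 := (L.phase_t_iff h hR h2).1 ((L.phase_t_iff h hR h1).2 h3)
  exact Nat.ModEq.add_right_cancel' (L.N - i % L.N) (h3.trans h4.symm)

/-- Each phase is contained in a single entry interval. -/
lemma phase_entry (j : ℕ) : ∃ k e₁ e₂, k < L.N ∧ Entry F L.a L.b k e₁ e₂ ∧
    L.phase j ⊆ Ioo e₁ e₂ := by
  have hN := L.N_pos
  have hlt := Nat.mod_lt j hN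
  have hTT : Entry F L.a L.b 0 L.a L.b := ⟨L.a_lt_c.trans L.c_lt_b, Or.inl ⟨rfl, rfl⟩,
    fun x hx => hx, fun j hj => absurd hj (Nat.not_lt_zero j)⟩
  have hs := L.s_pos
  have hrp := L.r_pos
  have hNr : L.N = L.r + L.s := rfl
  have dense : ∀ {k e₁ e₂}, Entry F L.a L.b k e₁ e₂ →
      (∀ M, M % L.N = j % L.N → F^[M] c ∈ Ioo e₁ e₂) → L.phase j ⊆ Ioo e₁ e₂ := by
    intro k e₁ e₂ E hE x hx
    have h1 : x ∈ Icc e₁ e₂ := by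
      refine closure_minimal (t := Icc e₁ e₂) ?_ isClosed_Icc hx
      rintro _ ⟨M, hM, rfl⟩
      exact Ioo_subset_Icc_self (hE M hM)
    have hX := L.phase_sub j hx
    refine ⟨lt_of_le_of_ne h1.1 ?_, lt_of_le_of_ne h1.2 ?_⟩
    · rintro rfl; exact L.notMem_of_avoid hR (fun n _ => E.left_avoid h L.nice n) hX
    · rintro rfl; exact L.notMem_of_avoid hR (fun n _ => E.right_avoid h L.nice n) hX
  by_cases h0 : j % L.N = 0
  · exact ⟨0, _, _, hN, hTT, (L.phase_zero h hR h0).trans L.t_sub⟩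
  by_cases h1 : j % L.N = L.r
  · exact ⟨0, _, _, hN, hTT, (L.phase_r h hR h1).trans L.q_sub⟩
  rcases lt_or_ge (j % L.N) L.r with h2 | h2
  · obtain ⟨w, hw, E⟩ := L.t_entry
    obtain ⟨y₁, y₂, E', -, him⟩ := h.entry_image (w := j % L.N - 1) L.nice E (by omega)
    refine ⟨_, y₁, y₂, by omega, E', dense E' fun M hM => ?_⟩
    have hdiv := Nat.div_add_mod M L.N
    rw [← him]
    refine ⟨F (F^[L.N * (M / L.N)] c), ⟨L.F_t_lt h (L.orbit_t _), (h.le_top _).trans_lt hw⟩, ?_⟩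
    rw [← iterate_succ_apply, ← iterate_add_apply, Nat.succ_eq_add_one]
    congr 1; omega
  · obtain ⟨y₁, y₂, E', -, him⟩ := h.entry_image (w := j % L.N - L.r - 1) L.nice L.q_entry
      (by omega)
    refine ⟨_, y₁, y₂, by omega, E', dense E' fun M hM => ?_⟩
    have hdiv := Nat.div_add_mod M L.N
    rw [← him]
    refine ⟨F (F^[L.N * (M / L.N) + L.r] c), L.F_q h (L.orbit_q _), ?_⟩
    rw [← iterate_succ_apply, ← iterate_add_apply, Nat.succ_eq_add_one]
    congr 1; omega

end

end Level

lemma ProperUnimodal.between_iter {F : ℝ → ℝ} {c : ℝ} (h : ProperUnimodal F c) {m : ℕ}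
    {a d y t z : ℝ} {S : Set ℝ} (hS : S.OrdConnected) (hn : NoTurn F c m a d) (hy : y ∈ Ioo a d)
    (hz : z ∈ Ioo a d) (hyt : y ≤ t) (htz : t ≤ z) (hyS : F^[m] y ∈ S) (hzS : F^[m] z ∈ S) :
    F^[m] t ∈ S := by
  have hlt := hy.1.trans hy.2
  have ht : t ∈ Icc a d := ⟨hy.1.le.trans hyt, htz.trans hz.2.le⟩
  have hy' := Ioo_subset_Icc_self hy
  have hz' := Ioo_subset_Icc_self hz
  rcases h.strict_iter hlt hn with h1 | h1
  · exact hS.out hyS hzS ⟨h1.monotoneOn hy' ht hyt, h1.monotoneOn ht hz' htz⟩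
  · exact hS.out hzS hyS ⟨h1.antitoneOn ht hz' htz, h1.antitoneOn hy' ht hyt⟩

namespace Level

variable {F : ℝ → ℝ} {c : ℝ}

/-- `(p₁,p₂)` is a shortest entry interval meeting the critical orbit closure, and contains the
phase `q`. -/
structure Star (L : Level F c) (q : ℕ) (p₁ p₂ : ℝ) : Prop where
  entry : ∃ k, Entry F L.a L.b k p₁ p₂
  sub : L.phase q ⊆ Ioo p₁ p₂
  min : ∀ k e₁ e₂ x, Entry F L.a L.b k e₁ e₂ → x ∈ orbitClosure F c → x ∈ Ioo e₁ e₂ →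
    p₂ - p₁ ≤ e₂ - e₁

/-- The concentric interval of three times the length. -/
def hull (p₁ p₂ : ℝ) : Set ℝ := Ioo (2 * p₁ - p₂) (2 * p₂ - p₁)

variable (L : Level F c) (h : ProperUnimodal F c)
include h

omit h in
lemma reach_of_subset (M : Level F c) (h : ProperUnimodal F c)
    (hM : Icc M.a M.b ⊆ Ioo L.a L.b) : L.Reach := by
  intro x hx
  obtain ⟨j, hj, hxj⟩ := M.exists_phase hx
  refine ⟨M.N - j, by omega, hM ?_⟩
  have h1 := M.phase_map h hxj (M.N - j)
  rw [M.phase_congr (show (j + (M.N - j)) % M.N = 0 % M.N by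
    rw [Nat.add_sub_cancel' hj.le, Nat.mod_self, Nat.zero_mod])] at h1
  have h2 := M.phase_zero_aux h1
  have := M.a_le; have := M.l_lt; have := M.l_le; have := M.le_r; have := M.r_lt; have := M.le_b
  exact ⟨by linarith [h2.1], by linarith [h2.2]⟩

lemma exists_star (hR : L.Reach) : ∃ q p₁ p₂, L.Star q p₁ p₂ := by
  choose k e₁ e₂ _ hE hsub using L.phase_entry h hR
  obtain ⟨q, hq, hmin⟩ := Finset.exists_min_image (Finset.range L.N) (fun j => e₂ j - e₁ j)
    ⟨0, Finset.mem_range.2 L.N_pos⟩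
  refine ⟨q, e₁ q, e₂ q, ⟨k q, hE q⟩, hsub q, ?_⟩
  intro k' y₁ y₂ x E hx hxE
  obtain ⟨j, hj, hxj⟩ := L.exists_phase hx
  obtain ⟨-, rfl, rfl⟩ := E.unique h L.nice (hE j) hxE (hsub j hxj)
  exact hmin j (Finset.mem_range.2 hj)

lemma star_bounds {q : ℕ} {p₁ p₂ : ℝ} (S : L.Star q p₁ p₂) : p₁ < p₂ ∧ -1 ≤ p₁ ∧ p₂ ≤ 2 := by
  obtain ⟨k, E⟩ := S.entry
  have hT : Ioo L.a L.b ⊆ Icc 0 1 := fun z hz => ⟨L.a_nonneg.trans hz.1.le, hz.2.le.trans L.b_le⟩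
  have key : ∀ z ∈ Ioo p₁ p₂, ¬ (z ≤ -1 ∨ 1 + 1 ≤ z) := by
    intro z hz hcon
    have h1 := hT (E.into hz)
    rcases h.escape le_rfl hcon k with h2 | h2
    · linarith [h1.1]
    · linarith [h1.2]
  have hlt := E.lt
  refine ⟨hlt, ?_, ?_⟩
  · by_contra hcon
    refine key (min ((p₁ + p₂) / 2) (-1)) ⟨lt_min (by linarith) (by linarith), ?_⟩
      (Or.inl (min_le_right _ _))
    exact (min_le_left _ _).trans_lt (by linarith)
  · by_contra hcon
    refine key (max ((p₁ + p₂) / 2) 2) ⟨?_, max_lt (by linarith) (by linarith)⟩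
      (Or.inr (by norm_num))
    exact lt_of_lt_of_le (by linarith) (le_max_left _ _)

lemma hull_sub {q : ℕ} {p₁ p₂ : ℝ} (S : L.Star q p₁ p₂) : hull p₁ p₂ ⊆ Ioo (-4) 5 := by
  obtain ⟨h1, h2, h3⟩ := L.star_bounds h S
  intro z hz
  exact ⟨by linarith [hz.1], by linarith [hz.2]⟩

lemma star_of_hull {q k : ℕ} {p₁ p₂ e₁ e₂ x : ℝ} (S : L.Star q p₁ p₂)
    (E : Entry F L.a L.b k e₁ e₂) (hx : x ∈ orbitClosure F c) (hxE : x ∈ Ioo e₁ e₂)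
    (h₁ : e₁ ∈ hull p₁ p₂) (h₂ : e₂ ∈ hull p₁ p₂) : e₁ = p₁ ∧ e₂ = p₂ := by
  obtain ⟨k', E'⟩ := S.entry
  have hmin := S.min _ _ _ _ E hx hxE
  have h3 : e₁ < p₂ := by
    by_contra hcon; push Not at hcon; linarith [h₂.2]
  have h4 : p₁ < e₂ := by
    by_contra hcon; push Not at hcon; linarith [h₁.1]
  obtain ⟨w, hw1, hw2⟩ := exists_between
    (max_lt (lt_min E.lt h3) (lt_min h4 E'.lt) : max e₁ p₁ < min e₂ p₂)
  have := E.unique h L.nice E' ⟨(le_max_left _ _).trans_lt hw1, hw2.trans_le (min_le_left _ _)⟩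
    ⟨(le_max_right _ _).trans_lt hw1, hw2.trans_le (min_le_right _ _)⟩
  exact this.2

/-- A chain into the hull of the shortest entry interval maps an entry interval inside
onto the shortest one. -/
lemma image_of_chain {q k m : ℕ} {p₁ p₂ e₁ e₂ x a d : ℝ} (S : L.Star q p₁ p₂)
    (hn : NoTurn F c m a d) (hm : MapsTo F^[m] (Ioo a d) (hull p₁ p₂))
    (E : Entry F L.a L.b k e₁ e₂) (hx : x ∈ orbitClosure F c) (hxE : x ∈ Ioo e₁ e₂)
    (h₁ : e₁ ∈ Ioo a d) (h₂ : e₂ ∈ Ioo a d) : F^[m] '' Ioo e₁ e₂ = Ioo p₁ p₂ := by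
  have hmk : m ≤ k := by
    by_contra hcon
    have : c ∈ F^[k] '' Ioo e₁ e₂ := by rw [E.image_eq h]; exact L.nice.mem
    obtain ⟨z, hz, hzc⟩ := this
    exact hn k (not_le.1 hcon) z ⟨h₁.1.trans hz.1, hz.2.trans h₂.2⟩ hzc
  obtain ⟨y₁, y₂, E', he, him⟩ := h.entry_image L.nice E hmk
  rw [him]
  have hy : y₁ ∈ hull p₁ p₂ ∧ y₂ ∈ hull p₁ p₂ := by
    rcases he with ⟨rfl, rfl⟩ | ⟨rfl, rfl⟩
    · exact ⟨hm h₁, hm h₂⟩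
    · exact ⟨hm h₂, hm h₁⟩
  obtain ⟨rfl, rfl⟩ := L.star_of_hull h S E' (map_orbitClosure h hx m)
    (him ▸ mem_image_of_mem _ hxE) hy.1 hy.2
  rfl

/-- If a chain into the hull starts from an interval containing the critical value and some
point below `v₁`, then only points of `(v₁,v₂)` are sent into the shortest entry interval. -/
lemma mem_v_of_chain {q m : ℕ} {p₁ p₂ a d y x : ℝ} (S : L.Star q p₁ p₂)
    (hn : NoTurn F c m a d) (hm : MapsTo F^[m] (Ioo a d) (hull p₁ p₂)) (hc : F c ∈ Ioo a d)
    (hy : y ∈ Ioo a d) (hyv : y ≤ L.v₁) (hx : x ∈ Ioo a d) (hxm : F^[m] x ∈ Ioo p₁ p₂) :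
    x ∈ Ioo L.v₁ L.v₂ := by
  have hvF : L.v₂ < F c := (L.v₂_le h).trans_lt (h.lt_top L.t_lt.ne)
  have hlt := L.q_entry.lt
  have hw : F (F^[L.r] c) ∈ Ioo L.v₁ L.v₂ := L.F_q h (by simpa using L.orbit_q 0)
  have hwX : F (F^[L.r] c) ∈ orbitClosure F c := subset_closure ⟨L.r + 1, by
    simp only [iterate_succ_apply']⟩
  have him := L.image_of_chain h S hn hm L.q_entry hwX hw
    ⟨hy.1.trans_le hyv, (hlt.trans hvF).trans hc.2⟩
    ⟨hy.1.trans_le (hyv.trans hlt.le), hvF.trans hc.2⟩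
  rw [← him] at hxm
  obtain ⟨z, hz, hzx⟩ := hxm
  have := h.inj_iter (hx.1.trans hx.2) hn ⟨hy.1.le.trans (hyv.trans hz.1.le),
    hz.2.le.trans (hvF.le.trans hc.2.le)⟩ (Ioo_subset_Icc_self hx) hzx
  rwa [← this]

lemma false_of_turn {l : ℕ} {α δ z : ℝ} (hn : NoTurn F c l α δ)
    (hz : z ∈ Ioo α δ) (hc : F c ∈ Ioo α δ) (hzt : z ≤ F L.t₁) (hzT : F^[l] z ∈ Ioo L.a L.b)
    (hcT : F^[l] (F c) ∈ Ioo L.a L.b) : False := by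
  have := h.between_iter ordConnected_Ioo hn hz hc hzt (h.le_top _) hzT hcT
  rw [← iterate_succ_apply] at this
  exact L.avoid_t h _ (by omega) this

/-- The nice interval can be pulled back diffeomorphically along an orbit up to its first visit to
the central domain. -/
lemma pull_T {x : ℝ} {k : ℕ} (hk : F^[k] x ∈ Ioo L.t₁ L.t₂)
    (hb : ∀ j < k, F^[j] x ∉ Ioo L.t₁ L.t₂) :
    ∃ a d, x ∈ Ioo a d ∧ NoTurn F c k a d ∧ EndsTo F^[k] a d L.a L.b := by
  rcases h.pullback k x (L.t_sub hk) with hp | ⟨u, l, hul, α, δ, h1, h2, h3, h4⟩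
  · exact hp
  · exfalso
    have hmap := h.mapsTo_of_ends (h1.1.trans h1.2) (L.a_lt_c.trans L.c_lt_b) h3 h4
    refine L.false_of_turn h h3 h1 h2 ?_ (hmap h1) (hmap h2)
    rw [iterate_succ_apply']
    exact L.F_le_of_notMem h (hb u (by omega))

/-- A chain into the hull which contains the critical value can be prolonged beyond the
first visit to the central domain. -/
lemma pull_through {q u m : ℕ} {p₁ p₂ a d n₁ n₂ x : ℝ} (S : L.Star q p₁ p₂)
    (hn : NoTurn F c m a d) (hm : MapsTo F^[m] (Ioo a d) (hull p₁ p₂)) (hc : F c ∈ Ioo a d)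
    (hx : F^[u + 1] x ∈ Ioo a d) (hxm : F^[m] (F^[u + 1] x) ∈ Ioo p₁ p₂)
    (hu : F^[u] x ∈ Ioo L.t₁ L.t₂) (hb : ∀ j < u, F^[j] x ∉ Ioo L.t₁ L.t₂)
    (hn₁ : n₁ ≤ c) (hn₂ : c ≤ n₂) (hF₁ : F n₁ = a) (hF₂ : F n₂ = a) :
    ∃ a' d', x ∈ Ioo a' d' ∧ NoTurn F c u a' d' ∧ EndsTo F^[u] a' d' n₁ n₂ := by
  have hn12 : ∀ z, z ∈ Ioo n₁ n₂ → a < F z := by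
    intro z hz
    rcases le_total z c with hzc | hzc
    · rw [← hF₁]; exact h.mono hn₁ hzc hz.1
    · rw [← hF₂]; exact h.anti hzc hn₂ hz.2
  have hn21 : ∀ z, a < F z → z ∈ Ioo n₁ n₂ := by
    intro z hz
    constructor
    · by_contra hcon
      have := h.mono.monotoneOn ((not_lt.1 hcon).trans hn₁) hn₁ (not_lt.1 hcon)
      linarith
    · by_contra hcon
      have := h.anti.antitoneOn hn₂ (hn₂.trans (not_lt.1 hcon)) (not_lt.1 hcon)
      linarith
  have hxu : F^[u] x ∈ Ioo n₁ n₂ := hn21 _ (by rw [← iterate_succ_apply' F u x]; exact hx.1)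
  have hltn : n₁ < n₂ := hxu.1.trans hxu.2
  rcases h.pullback u x hxu with hp | ⟨u₂, l, hul, α, δ, h1, h2, h3, h4⟩
  · exact hp
  · exfalso
    have hmap := h.mapsTo_of_ends (h1.1.trans h1.2) hltn h3 h4
    have hle : F^[u₂ + 1] x ≤ F L.t₁ := by
      rw [iterate_succ_apply']; exact L.F_le_of_notMem h (hb u₂ (by omega))
    have hxl : F^[l] (F^[u₂ + 1] x) = F^[u] x := by
      rw [← iterate_add_apply]; congr 1; omega
    by_cases hcT : F^[l] (F c) ∈ Ioo L.a L.b
    · exact L.false_of_turn h h3 h1 h2 hle (by rw [hxl]; exact L.t_sub hu) hcT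
    · have hy : F (F^[l] (F c)) ∈ Ioo a d :=
        ⟨hn12 _ (hmap h2), (h.le_top _).trans_lt hc.2⟩
      have := L.mem_v_of_chain h S hn hm hc hy (L.F_le_v₁ h hcT) hx hxm
      rw [iterate_succ_apply'] at this
      have h5 := L.F_t_lt h hu
      linarith [L.v₂_le h, this.2]

end Level

/-- The cross ratio of four points. -/
def crossRatio (a b e d : ℝ) : ℝ := |e - b| * |d - a| / (|b - a| * |d - e|)

lemma crossRatio_swap (a b e d : ℝ) : crossRatio d e b a = crossRatio a b e d := by
  unfold crossRatio
  rw [abs_sub_comm b e, abs_sub_comm a d, abs_sub_comm e d, abs_sub_comm a b, mul_comm |d - e|]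

/-- Bounded contraction of cross ratios and power law behaviour near the turning point. -/
structure Distortion (F : ℝ → ℝ) (c C q A₁ A₂ : ℝ) : Prop where
  C_nonneg : 0 ≤ C
  q_pos : 0 < q
  A₁_pos : 0 < A₁
  A₂_pos : 0 < A₂
  cross : ∀ a b e d, -4 ≤ a → a < b → b < e → e < d → d ≤ 5 → c ∉ Ioo a d →
    Real.exp (-(C * (|d - a| + |F d - F a|))) * crossRatio a b e d ≤
      crossRatio (F a) (F b) (F e) (F d)
  slope : ∀ x y, x ∈ Icc (-4:ℝ) 5 → y ∈ Icc (-4:ℝ) 5 → (c ≤ x ∧ x ≤ y ∨ y ≤ x ∧ x ≤ c) →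
    A₁ * |y - c| ^ q * |y - x| ≤ F x - F y ∧ F x - F y ≤ A₂ * |y - c| ^ q * |y - x|

/-- `a` and `d` have distance at least `κ|x - y|` to `x` and `y`. -/
def Spaced (κ a d x y : ℝ) : Prop :=
  κ * |x - y| ≤ |x - a| ∧ κ * |x - y| ≤ |y - a| ∧ κ * |x - y| ≤ |d - x| ∧ κ * |x - y| ≤ |d - y|

lemma Spaced.swap {κ a d x y : ℝ} (h : Spaced κ a d x y) : Spaced κ a d y x := by
  obtain ⟨h1, h2, h3, h4⟩ := h
  rw [abs_sub_comm] at h1 h2 h3 h4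
  exact ⟨h2, h1, h4, h3⟩

lemma Spaced.swap_ends {κ a d x y : ℝ} (h : Spaced κ a d x y) : Spaced κ d a x y := by
  obtain ⟨h1, h2, h3, h4⟩ := h
  refine ⟨?_, ?_, ?_, ?_⟩
  · rwa [abs_sub_comm x d]
  · rwa [abs_sub_comm y d]
  · rwa [abs_sub_comm a x]
  · rwa [abs_sub_comm a y]

lemma crossRatio_le_of_spaced {κ a b e d : ℝ} (hκ : 0 < κ) (hab : a < b) (hbe : b < e) (hed : e < d)
    (hS : Spaced κ a d b e) : crossRatio a b e d ≤ 2 / κ + 1 / κ ^ 2 := by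
  obtain ⟨h1, -, -, h4⟩ := hS
  unfold crossRatio
  rw [abs_sub_comm, abs_of_pos (by linarith), abs_of_pos (by linarith : 0 < b - a)] at h1
  rw [abs_sub_comm, abs_of_pos (by linarith), abs_of_pos (by linarith : 0 < d - e)] at h4
  rw [abs_of_pos (by linarith : 0 < e - b), abs_of_pos (by linarith : 0 < d - a),
    abs_of_pos (by linarith : 0 < b - a), abs_of_pos (by linarith : 0 < d - e)]
  obtain ⟨p, hp⟩ : ∃ p, p = b - a := ⟨_, rfl⟩
  obtain ⟨j, hj⟩ : ∃ p, p = e - b := ⟨_, rfl⟩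
  obtain ⟨w, hw⟩ : ∃ p, p = d - e := ⟨_, rfl⟩
  have e1 : d - a = p + j + w := by rw [hp, hj, hw]; ring
  rw [← hj, ← hp] at h1
  rw [← hj, ← hw] at h4
  rw [e1, ← hp, ← hj, ← hw]
  have hp0 : 0 < p := by linarith
  have hj0 : 0 < j := by linarith
  have hw0 : 0 < w := by linarith
  rw [show j * (p + j + w) / (p * w) = j / w + j / p + (j / p) * (j / w) by field_simp; ring]
  have q1 : j / p ≤ 1 / κ := by rw [div_le_div_iff₀ hp0 hκ]; linarith
  have q2 : j / w ≤ 1 / κ := by rw [div_le_div_iff₀ hw0 hκ]; linarith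
  have q3 : (j / p) * (j / w) ≤ (1 / κ) * (1 / κ) :=
    mul_le_mul q1 q2 (by positivity) (by positivity)
  calc _ ≤ 1 / κ + 1 / κ + (1 / κ) * (1 / κ) := by linarith
    _ = _ := by field_simp; ring

lemma spaced_of_crossRatio_le {M a b e d : ℝ} (hM : 0 < M) (hab : a < b) (hbe : b < e) (hed : e < d)
    (hS : crossRatio a b e d ≤ M) : Spaced (1 / M) a d b e := by
  unfold crossRatio at hS
  rw [abs_of_pos (by linarith : 0 < e - b), abs_of_pos (by linarith : 0 < d - a),
    abs_of_pos (by linarith : 0 < b - a), abs_of_pos (by linarith : 0 < d - e),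
    div_le_iff₀ (mul_pos (by linarith) (by linarith))] at hS
  have hj : 0 < e - b := by linarith
  have hp : 0 < b - a := by linarith
  have hw : 0 < d - e := by linarith
  have h1 : (e - b) * (d - e) ≤ (M * (b - a)) * (d - e) := by nlinarith
  have h2 : (e - b) * (b - a) ≤ (M * (d - e)) * (b - a) := by nlinarith
  have h1 := le_of_mul_le_mul_right h1 hw
  have h2 := le_of_mul_le_mul_right h2 hp
  have e1 : |b - e| = e - b := by rw [abs_sub_comm, abs_of_pos hj]
  have k1 : 1 / M * (e - b) ≤ b - a := by
    rw [one_div, inv_mul_le_iff₀ hM]; exact h1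
  have k2 : 1 / M * (e - b) ≤ d - e := by
    rw [one_div, inv_mul_le_iff₀ hM]; exact h2
  refine ⟨?_, ?_, ?_, ?_⟩ <;> rw [e1]
  · rw [abs_of_pos hp]; exact k1
  · rw [abs_of_pos (by linarith)]; linarith
  · rw [abs_of_pos (by linarith)]; linarith
  · rw [abs_of_pos hw]; exact k2

/-- Intervals with marked points, each containing few of the marked points, have bounded total
length. -/
lemma sum_length_le {m K : ℕ} {lo hi p : ℕ → ℝ}
    (hI : ∀ v ≤ m, Ioo (lo v) (hi v) ⊆ Ioo (-4) 5) (hp : ∀ v ≤ m, p v ∈ Ioo (lo v) (hi v))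
    (hK : ∀ v ≤ m, ((Finset.range (m + 1)).filter fun w => p w ∈ Ioo (lo v) (hi v)).card ≤ K) :
    ∑ v ∈ Finset.range (m + 1), (hi v - lo v) ≤ 2 * K * 9 := by
  have hmult : ∀ z : ℝ, ((Finset.range (m + 1)).filter fun v => z ∈ Ioo (lo v) (hi v)).card
      ≤ 2 * K := by
    intro z
    have hsplit : ((Finset.range (m + 1)).filter fun v => z ∈ Ioo (lo v) (hi v)) ⊆
        ((Finset.range (m + 1)).filter fun v => z ∈ Ioo (lo v) (hi v) ∧ p v ≤ z) ∪
        ((Finset.range (m + 1)).filter fun v => z ∈ Ioo (lo v) (hi v) ∧ z ≤ p v) := by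
      intro v hv
      simp only [Finset.mem_union, Finset.mem_filter] at hv ⊢
      rcases le_total (p v) z with h | h
      · exact Or.inl ⟨hv.1, hv.2, h⟩
      · exact Or.inr ⟨hv.1, hv.2, h⟩
    have h1 : ((Finset.range (m + 1)).filter fun v => z ∈ Ioo (lo v) (hi v) ∧ p v ≤ z).card
        ≤ K := by
      rcases Finset.eq_empty_or_nonempty
        ((Finset.range (m + 1)).filter fun v => z ∈ Ioo (lo v) (hi v) ∧ p v ≤ z) with h | h
      · rw [h]; simp
      · obtain ⟨v₀, hv₀, hmin⟩ := Finset.exists_min_image _ p h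
        simp only [Finset.mem_filter, Finset.mem_range] at hv₀ hmin
        refine (Finset.card_le_card ?_).trans (hK v₀ (by omega))
        intro w hw
        simp only [Finset.mem_filter, Finset.mem_range] at hw ⊢
        have h2 := hmin w hw
        exact ⟨hw.1, (hp v₀ (by omega)).1.trans_le h2, hw.2.2.trans_lt hv₀.2.1.2⟩
    have h2 : ((Finset.range (m + 1)).filter fun v => z ∈ Ioo (lo v) (hi v) ∧ z ≤ p v).card
        ≤ K := by
      rcases Finset.eq_empty_or_nonempty
        ((Finset.range (m + 1)).filter fun v => z ∈ Ioo (lo v) (hi v) ∧ z ≤ p v) with h | h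
      · rw [h]; simp
      · obtain ⟨v₀, hv₀, hmax⟩ := Finset.exists_max_image _ p h
        simp only [Finset.mem_filter, Finset.mem_range] at hv₀ hmax
        refine (Finset.card_le_card ?_).trans (hK v₀ (by omega))
        intro w hw
        simp only [Finset.mem_filter, Finset.mem_range] at hw ⊢
        have h2 := hmax w hw
        exact ⟨hw.1, hv₀.2.1.1.trans_le hw.2.2, h2.trans_lt (hp v₀ (by omega)).2⟩
    calc _ ≤ _ := Finset.card_le_card hsplit
      _ ≤ _ := Finset.card_union_le _ _
      _ ≤ 2 * K := by omega
  have hlt : ∀ v ≤ m, lo v ≤ hi v := fun v hv => ((hp v hv).1.trans (hp v hv).2).le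
  have hmain : ∑ v ∈ Finset.range (m + 1), ENNReal.ofReal (hi v - lo v) ≤
      ENNReal.ofReal (2 * K * 9) := by
    calc ∑ v ∈ Finset.range (m + 1), ENNReal.ofReal (hi v - lo v)
        = ∑ v ∈ Finset.range (m + 1), ∫⁻ z, (Ioo (lo v) (hi v)).indicator 1 z := by
          refine Finset.sum_congr rfl fun v _ => ?_
          rw [lintegral_indicator_one measurableSet_Ioo, Real.volume_Ioo]
      _ = ∫⁻ z, ∑ v ∈ Finset.range (m + 1), (Ioo (lo v) (hi v)).indicator 1 z := by
          rw [lintegral_finsetSum]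
          exact fun v _ => measurable_one.indicator measurableSet_Ioo
      _ ≤ ∫⁻ z, (Ioo (-4:ℝ) 5).indicator (fun _ => (2 * K : ENNReal)) z := by
          refine lintegral_mono fun z => ?_
          by_cases hz : z ∈ Ioo (-4:ℝ) 5
          · rw [indicator_of_mem hz]
            have h3 := hmult z
            simp only [indicator_apply, Pi.one_apply, Finset.sum_boole]
            exact_mod_cast h3
          · rw [indicator_of_notMem hz]
            simp only [nonpos_iff_eq_zero, Finset.sum_eq_zero_iff, Finset.mem_range]
            intro v hv
            exact indicator_of_notMem (fun hzv => hz (hI v (by omega) hzv)) _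
      _ = ENNReal.ofReal (2 * K * 9) := by
          rw [lintegral_indicator_const measurableSet_Ioo, Real.volume_Ioo,
            ENNReal.ofReal_mul (by positivity), ENNReal.ofReal_mul (by norm_num)]
          norm_num
  rw [← ENNReal.ofReal_sum_of_nonneg] at hmain
  · exact (ENNReal.ofReal_le_ofReal_iff (by positivity)).1 hmain
  · intro v hv
    rw [Finset.mem_range] at hv
    linarith [hlt v (by omega)]

section
variable {F : ℝ → ℝ} {c C q A₁ A₂ : ℝ}

lemma ProperUnimodal.chain_strict (h : ProperUnimodal F c) {m : ℕ} {a b e d : ℝ} (hab : a < b)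
    (hbe : b < e) (hed : e < d) (hn : NoTurn F c m a d) :
    (F^[m] a < F^[m] b ∧ F^[m] b < F^[m] e ∧ F^[m] e < F^[m] d) ∨
    (F^[m] d < F^[m] e ∧ F^[m] e < F^[m] b ∧ F^[m] b < F^[m] a) := by
  have ha : a ∈ Icc a d := ⟨le_rfl, by linarith⟩
  have hb : b ∈ Icc a d := ⟨by linarith, by linarith⟩
  have he : e ∈ Icc a d := ⟨by linarith, by linarith⟩
  have hd : d ∈ Icc a d := ⟨by linarith, le_rfl⟩
  rcases h.strict_iter (hab.trans (hbe.trans hed)) hn with hs | hs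
  · exact Or.inl ⟨hs ha hb hab, hs hb he hbe, hs he hd hed⟩
  · exact Or.inr ⟨hs he hd hed, hs hb he hbe, hs ha hb hab⟩

lemma Distortion.chain_cross (h : ProperUnimodal F c) (D : Distortion F c C q A₁ A₂)
    {a b e d : ℝ} (hab : a < b) (hbe : b < e) (hed : e < d) : ∀ m, NoTurn F c m a d →
    (∀ v ≤ m, F^[v] a ∈ Icc (-4:ℝ) 5 ∧ F^[v] d ∈ Icc (-4:ℝ) 5) →
    Real.exp (-(C * ∑ v ∈ Finset.range m, (|F^[v] d - F^[v] a| + |F^[v + 1] d - F^[v + 1] a|))) *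
      crossRatio a b e d ≤ crossRatio (F^[m] a) (F^[m] b) (F^[m] e) (F^[m] d) := by
  intro m
  induction m with
  | zero => intro _ _; simp
  | succ m ih =>
    intro hn hI
    have hn' : NoTurn F c m a d := fun v hv => hn v (by omega)
    have h1 := ih hn' fun v hv => hI v (by omega)
    have had : a < d := by linarith
    have h2 : Real.exp (-(C * (|F^[m] d - F^[m] a| + |F^[m + 1] d - F^[m + 1] a|))) *
        crossRatio (F^[m] a) (F^[m] b) (F^[m] e) (F^[m] d) ≤
        crossRatio (F^[m+1] a) (F^[m+1] b) (F^[m+1] e) (F^[m+1] d) := by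
      obtain ⟨hIa, hId⟩ := hI m (by omega)
      simp only [iterate_succ_apply']
      rcases h.chain_strict hab hbe hed hn' with ⟨k1, k2, k3⟩ | ⟨k1, k2, k3⟩
      · refine D.cross _ _ _ _ hIa.1 k1 k2 k3 hId.2 fun hc => ?_
        obtain ⟨z, hz, hzc⟩ := h.surjOn_of_ends had (Or.inl ⟨rfl, rfl⟩) hc
        exact hn m (by omega) z hz hzc
      · have := D.cross _ _ _ _ hId.1 k1 k2 k3 hIa.2 fun hc => by
          obtain ⟨z, hz, hzc⟩ := h.surjOn_of_ends had (Or.inr ⟨rfl, rfl⟩) hc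
          exact hn m (by omega) z hz hzc
        rw [crossRatio_swap (F^[m] a), crossRatio_swap (F (F^[m] a)),
          abs_sub_comm (F^[m] a), abs_sub_comm (F (F^[m] a))] at this
        exact this
    refine le_trans (le_of_eq ?_) (le_trans (mul_le_mul_of_nonneg_left h1 (Real.exp_nonneg _)) h2)
    rw [← mul_assoc, ← Real.exp_add, Finset.sum_range_succ]
    congr 2; ring

/-- Definite space is preserved when pulling back along a chain with few visits to its target. -/
lemma Distortion.chain_spaced (h : ProperUnimodal F c) (D : Distortion F c C q A₁ A₂) (K : ℕ)
    {κ : ℝ} (hκ : 0 < κ) : ∃ κ' > 0, ∀ (W : Set ℝ) (x a d y y' : ℝ) (m m' n : ℕ),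
      W ⊆ Ioo (-4) 5 → NoTurn F c m a d → m ≤ m' → MapsTo F^[m'] (Ioo a d) W → x ∈ Ioo a d →
      ((Finset.range n).filter fun τ => F^[τ] x ∈ W).card ≤ K → m + m' < n →
      y ∈ Ioo a d → y' ∈ Ioo a d → y ≠ y' →
      Spaced κ (F^[m] a) (F^[m] d) (F^[m] y) (F^[m] y') → Spaced κ' a d y y' := by
  obtain ⟨M, hM⟩ : ∃ M, M = Real.exp (C * (2 * (2 * K * 9))) * (2 / κ + 1 / κ ^ 2) := ⟨_, rfl⟩
  have hM0 : 0 < M := by rw [hM]; positivity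
  refine ⟨1 / M, by positivity, ?_⟩
  intro W x a d y y' m m' n hW hn hmm hmaps hx hcard hlt hy hy' hne hsp
  have had : a < d := hx.1.trans hx.2
  wlog hyy : y < y' generalizing y y'
  · exact (this y' y hy' hy hne.symm hsp.swap
      (lt_of_le_of_ne (not_lt.1 hyy) hne.symm)).swap
  have hends : ∀ v ≤ m, Ioo (min (F^[v] a) (F^[v] d)) (max (F^[v] a) (F^[v] d)) =
      F^[v] '' Ioo a d := by
    intro v hv
    have hnv : NoTurn F c v a d := fun w hw => hn w (by omega)
    obtain ⟨y₁, y₂, hy12, hE, him⟩ := h.image_Ioo had hnv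
    rw [him]
    rcases hE with ⟨e1, e2⟩ | ⟨e1, e2⟩ <;> rw [e1, e2]
    · rw [min_eq_left hy12.le, max_eq_right hy12.le]
    · rw [min_eq_right hy12.le, max_eq_left hy12.le]
  have hI : ∀ v ≤ m, Ioo (min (F^[v] a) (F^[v] d)) (max (F^[v] a) (F^[v] d)) ⊆ Ioo (-4) 5 := by
    intro v hv
    rw [hends v hv]
    rintro _ ⟨w, hw, rfl⟩
    have h1 := hW (hmaps hw)
    by_contra hcon
    have h2 : F^[v] w ≤ -4 ∨ 1 + 4 ≤ F^[v] w := by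
      by_contra! h3
      exact hcon ⟨h3.1, by linarith [h3.2]⟩
    have h4 := h.escape (by norm_num) h2 (m' - v)
    rw [← iterate_add_apply, show m' - v + v = m' by omega] at h4
    rcases h4 with h4 | h4
    · linarith [h1.1]
    · linarith [h1.2]
  have hp : ∀ v ≤ m, F^[v] x ∈ Ioo (min (F^[v] a) (F^[v] d)) (max (F^[v] a) (F^[v] d)) := by
    intro v hv
    rw [hends v hv]
    exact ⟨x, hx, rfl⟩
  have hK : ∀ v ≤ m, ((Finset.range (m + 1)).filter fun w =>
      F^[w] x ∈ Ioo (min (F^[v] a) (F^[v] d)) (max (F^[v] a) (F^[v] d))).card ≤ K := by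
    intro v hv
    refine le_trans (Finset.card_le_card_of_injOn (fun w => w + (m' - v)) ?_ ?_) hcard
    · intro w hw
      simp only [Finset.coe_filter, Finset.mem_range, mem_ofPred_eq] at hw ⊢
      refine ⟨by omega, ?_⟩
      have h5 := hw.2
      rw [hends v hv] at h5
      obtain ⟨z, hz, hzw⟩ := h5
      rw [add_comm, iterate_add_apply, ← hzw, ← iterate_add_apply,
        show m' - v + v = m' by omega]
      exact hmaps hz
    · intro w _ w' _ hww
      simpa using hww
  have hsum := sum_length_le hI hp hK
  simp only [max_sub_min_eq_abs] at hsum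
  have hmem : ∀ v ≤ m, F^[v] a ∈ Icc (-4:ℝ) 5 ∧ F^[v] d ∈ Icc (-4:ℝ) 5 := by
    intro v hv
    have h1 := (Ioo_subset_Ioo_iff ((hp v hv).1.trans (hp v hv).2)).1 (hI v hv)
    exact ⟨⟨h1.1.trans (min_le_left _ _), (le_max_left _ _).trans h1.2⟩,
      ⟨h1.1.trans (min_le_right _ _), (le_max_right _ _).trans h1.2⟩⟩
  have hcr := D.chain_cross h hy.1 hyy hy'.2 m hn hmem
  have himg : crossRatio (F^[m] a) (F^[m] y) (F^[m] y') (F^[m] d) ≤ 2 / κ + 1 / κ ^ 2 := by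
    rcases h.chain_strict hy.1 hyy hy'.2 hn with ⟨k1, k2, k3⟩ | ⟨k1, k2, k3⟩
    · exact crossRatio_le_of_spaced hκ k1 k2 k3 hsp
    · rw [← crossRatio_swap]
      exact crossRatio_le_of_spaced hκ k1 k2 k3 hsp.swap.swap_ends
  have hS : ∑ v ∈ Finset.range m, (|F^[v] d - F^[v] a| + |F^[v + 1] d - F^[v + 1] a|) ≤
      2 * (2 * K * 9) := by
    rw [Finset.sum_add_distrib]
    have h1 := hsum
    have h2 := hsum
    rw [Finset.sum_range_succ] at h1
    rw [Finset.sum_range_succ'] at h2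
    linarith [abs_nonneg (F^[m] d - F^[m] a), abs_nonneg (F^[0] d - F^[0] a)]
  refine spaced_of_crossRatio_le hM0 hy.1 hyy hy'.2 ?_
  have hexp : Real.exp (-(C * (2 * (2 * K * 9)))) * crossRatio a y y' d ≤ 2 / κ + 1 / κ ^ 2 := by
    refine le_trans (mul_le_mul_of_nonneg_right ?_ ?_) (hcr.trans himg)
    · exact Real.exp_le_exp.2 (neg_le_neg (mul_le_mul_of_nonneg_left hS D.C_nonneg))
    · unfold crossRatio; positivity
  rw [Real.exp_neg, inv_mul_le_iff₀ (Real.exp_pos _)] at hexp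
  rwa [hM]

end

section
variable {F : ℝ → ℝ} {c C q A₁ A₂ : ℝ}

lemma Distortion.fold_gap (D : Distortion F c C q A₁ A₂) {κ : ℝ} (hκ : 0 < κ) :
    ∃ κ' > 0, ∀ x y n, x ∈ Icc (-4:ℝ) 5 → y ∈ Icc (-4:ℝ) 5 → n ∈ Icc (-4:ℝ) 5 →
      (c ≤ x ∧ x ≤ y ∧ y ≤ n ∨ n ≤ y ∧ y ≤ x ∧ x ≤ c) → κ * (F x - F y) ≤ F y - F n →
      κ' * |y - x| ≤ |n - y| := by
  have h1 := D.A₁_pos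
  have h2 := D.A₂_pos
  refine ⟨min 1 (κ * A₁ / (A₂ * 2 ^ q)), by positivity, ?_⟩
  intro x y n hx hy hn hs hF
  have s1 := (D.slope x y hx hy (hs.imp (fun h => ⟨h.1, h.2.1⟩) fun h => ⟨h.2.1, h.2.2⟩)).1
  have s2 := (D.slope y n hy hn (hs.imp (fun h => ⟨by linarith, h.2.2⟩)
    fun h => ⟨h.1, by linarith⟩)).2
  have e1 : |n - c| = |n - y| + |y - c| := by
    rcases hs with h | h
    · rw [abs_of_nonneg, abs_of_nonneg, abs_of_nonneg] <;> linarith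
    · rw [abs_of_nonpos, abs_of_nonpos, abs_of_nonpos] <;> linarith
  have e2 : |y - x| ≤ |y - c| := by
    rcases hs with h | h
    · rw [abs_of_nonneg, abs_of_nonneg] <;> linarith
    · rw [abs_of_nonpos, abs_of_nonpos] <;> linarith
  rcases le_or_gt |y - x| |n - y| with h3 | h3
  · exact (mul_le_of_le_one_left (abs_nonneg _) (min_le_left _ _)).trans h3
  have hP : 0 < |y - c| := ((abs_nonneg _).trans_lt h3).trans_le e2
  have h4 : |n - c| ^ q ≤ 2 ^ q * |y - c| ^ q := by
    rw [← Real.mul_rpow (by norm_num) (abs_nonneg _)]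
    exact Real.rpow_le_rpow (abs_nonneg _) (by linarith) D.q_pos.le
  have hPq : 0 < |y - c| ^ q := Real.rpow_pos_of_pos hP q
  have h5 : κ * A₁ * |y - x| * |y - c| ^ q ≤ A₂ * 2 ^ q * |n - y| * |y - c| ^ q := by
    calc κ * A₁ * |y - x| * |y - c| ^ q = κ * (A₁ * |y - c| ^ q * |y - x|) := by ring
      _ ≤ κ * (F x - F y) := by gcongr
      _ ≤ F y - F n := hF
      _ ≤ A₂ * |n - c| ^ q * |n - y| := s2
      _ ≤ A₂ * (2 ^ q * |y - c| ^ q) * |n - y| := by gcongr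
      _ = _ := by ring
  have h6 := le_of_mul_le_mul_right h5 hPq
  calc _ ≤ κ * A₁ / (A₂ * 2 ^ q) * |y - x| := by gcongr; exact min_le_right _ _
    _ ≤ |n - y| := by
      rw [div_mul_eq_mul_div, div_le_iff₀ (by positivity)]; linarith

lemma Distortion.fold_symm (D : Distortion F c C q A₁ A₂) (hc : c ∈ Icc (-4:ℝ) 5) :
    ∃ κ > 0, κ ≤ 1 ∧ ∀ x x' y y', x ∈ Icc (-4:ℝ) 5 → x' ∈ Icc (-4:ℝ) 5 → y ∈ Icc (-4:ℝ) 5 →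
      y' ∈ Icc (-4:ℝ) 5 → (c ≤ x' ∧ x' ≤ x ∨ x ≤ x' ∧ x' ≤ c) →
      (c ≤ y' ∧ y' ≤ y ∨ y ≤ y' ∧ y' ≤ c) → F x = F y → F x' = F y' →
      κ * |y - y'| ≤ |x - x'| := by
  have h1 := D.A₁_pos
  have h2 := D.A₂_pos
  have hq := D.q_pos
  obtain ⟨ρ, hρ⟩ : ∃ ρ, ρ = max 1 (A₂ / A₁) := ⟨_, rfl⟩
  have hρ1 : 1 ≤ ρ := hρ ▸ le_max_left _ _
  have hρ2 : A₂ ≤ ρ * A₁ := by rw [← div_le_iff₀ h1, hρ]; exact le_max_right _ _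
  have hρq : 1 ≤ ρ ^ q := Real.one_le_rpow hρ1 hq.le
  have hcI : ∀ x y, x ∈ Icc (-4:ℝ) 5 → y ∈ Icc (-4:ℝ) 5 → F x = F y →
      |x - c| ≤ ρ * |y - c| := by
    intro x y hx hy hxy
    by_contra! hlt
    have s1 := (D.slope c x hc hx ((le_total c x).imp (fun h => ⟨le_rfl, h⟩)
      fun h => ⟨h, le_rfl⟩)).1
    have s2 := (D.slope c y hc hy ((le_total c y).imp (fun h => ⟨le_rfl, h⟩)
      fun h => ⟨h, le_rfl⟩)).2
    have hy0 : 0 ≤ |y - c| := abs_nonneg _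
    have hyx : |y - c| < |x - c| := (le_mul_of_one_le_left hy0 hρ1).trans_lt hlt
    have hx0 : 0 < |x - c| := hy0.trans_lt hyx
    have h3 : |y - c| ^ q ≤ |x - c| ^ q := Real.rpow_le_rpow hy0 hyx.le hq.le
    have hxq : 0 < |x - c| ^ q := Real.rpow_pos_of_pos hx0 q
    have h4 : A₁ * |x - c| ^ q * |x - c| ≤ A₁ * |x - c| ^ q * (ρ * |y - c|) := by
      calc _ ≤ F c - F x := s1
        _ = F c - F y := by rw [hxy]
        _ ≤ A₂ * |y - c| ^ q * |y - c| := s2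
        _ ≤ ρ * A₁ * |x - c| ^ q * |y - c| := by gcongr
        _ = _ := by ring
    exact absurd (le_of_mul_le_mul_left h4 (by positivity)) (not_le.2 hlt)
  refine ⟨min 1 (A₁ / (A₂ * ρ ^ q)), by positivity, min_le_left _ _, ?_⟩
  intro x x' y y' hx hx' hy hy' hsx hsy hF hF'
  have h3 := hcI x y hx hy hF
  have s1 := (D.slope y' y hy' hy hsy).1
  have s2 := (D.slope x' x hx' hx hsx).2
  rcases (abs_nonneg (y - c)).eq_or_lt with h0 | h0
  · have h4 : y - c = 0 := abs_eq_zero.1 h0.symm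
    have h5 : y = y' := by rcases hsy with h | h <;> linarith [h.1, h.2]
    rw [h5]; simp
  have hP : 0 < |y - c| ^ q := Real.rpow_pos_of_pos h0 q
  have h4 : |x - c| ^ q ≤ ρ ^ q * |y - c| ^ q := by
    rw [← Real.mul_rpow (by linarith) (abs_nonneg _)]
    exact Real.rpow_le_rpow (abs_nonneg _) h3 hq.le
  have h5 : A₁ * |y - y'| * |y - c| ^ q ≤ A₂ * ρ ^ q * |x - x'| * |y - c| ^ q := by
    calc _ = A₁ * |y - c| ^ q * |y - y'| := by ring
      _ ≤ F y' - F y := s1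
      _ = F x' - F x := by rw [hF, hF']
      _ ≤ A₂ * |x - c| ^ q * |x - x'| := s2
      _ ≤ A₂ * (ρ ^ q * |y - c| ^ q) * |x - x'| := by gcongr
      _ = _ := by ring
  have h6 := le_of_mul_le_mul_right h5 hP
  calc _ ≤ A₁ / (A₂ * ρ ^ q) * |y - y'| := by gcongr; exact min_le_right _ _
    _ ≤ |x - x'| := by
      rw [div_mul_eq_mul_div, div_le_iff₀ (by positivity)]; linarith

lemma Distortion.fold_spaced (h : ProperUnimodal F c) (D : Distortion F c C q A₁ A₂)
    {κ : ℝ} (hκ : 0 < κ) :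
    ∃ κ' > 0, ∀ n₁ n₂ a d y y', -4 ≤ n₁ → n₁ ≤ c → c ≤ n₂ → n₂ ≤ 5 → F n₁ = a → F n₂ = a →
      (c ≤ y ∧ c ≤ y' ∨ y ≤ c ∧ y' ≤ c) → a < F y → a < F y' → Spaced κ a d (F y) (F y') →
      Spaced κ' n₁ n₂ y y' := by
  have hc : c ∈ Icc (-4:ℝ) 5 := ⟨by linarith [h.c_mem.1], by linarith [h.c_mem.2]⟩
  obtain ⟨κ₁, hκ₁, hgap⟩ := D.fold_gap hκ
  obtain ⟨κ₂, hκ₂, hκ₂1, hsym⟩ := D.fold_symm hc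
  refine ⟨min κ₁ κ₂, by positivity, ?_⟩
  intro n₁ n₂ a d y y' h4 hn₁ hn₂ h5 hF₁ hF₂ hs hay hay' hsp
  wlog hyy : F y' ≤ F y generalizing y y'
  · exact (this y' y (hs.imp And.symm And.symm) hay' hay hsp.swap (not_le.1 hyy).le).swap
  have hm1 : min κ₁ κ₂ * |y - y'| ≤ κ₁ * |y' - y| := by
    rw [abs_sub_comm]; gcongr; exact min_le_left _ _
  have hsp' : κ * (F y - F y') ≤ F y' - a := by
    have := hsp.2.1
    rwa [abs_of_nonneg (by linarith), abs_of_pos (by linarith)] at this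
  have hI₁ : n₁ ∈ Icc (-4:ℝ) 5 := ⟨h4, by linarith [hc.2]⟩
  have hI₂ : n₂ ∈ Icc (-4:ℝ) 5 := ⟨by linarith [hc.1], h5⟩
  have hF12 : F n₁ = F n₂ := by rw [hF₁, hF₂]
  rcases hs with ⟨hy, hy'⟩ | ⟨hy, hy'⟩
  · have hyle : y ≤ y' := by
      by_contra! hlt
      exact absurd (h.anti hy' hy hlt) (not_lt.2 hyy)
    have hyn : y' ≤ n₂ := by
      by_contra! hlt
      have := h.anti hn₂ hy' hlt
      linarith
    have g1 := hgap y y' n₂ ⟨by linarith [hc.1], by linarith⟩ ⟨by linarith [hc.1], by linarith⟩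
      hI₂ (Or.inl ⟨hy, hyle, hyn⟩) (by rw [hF₂]; exact hsp')
    have g2 := hsym n₁ c n₂ c hI₁ hc hI₂ hc (Or.inr ⟨hn₁, le_rfl⟩) (Or.inl ⟨le_rfl, hn₂⟩) hF12 rfl
    rw [abs_of_nonneg (by linarith : 0 ≤ n₂ - y')] at g1
    rw [abs_of_nonneg (by linarith), abs_of_nonpos (by linarith)] at g2
    have hm2 : min κ₁ κ₂ * |y - y'| ≤ c - n₁ := by
      calc _ ≤ κ₂ * (n₂ - c) := by
            rw [abs_sub_comm, abs_of_nonneg (by linarith)]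
            exact mul_le_mul (min_le_right _ _) (by linarith) (by linarith) hκ₂.le
        _ ≤ _ := by linarith
    refine ⟨hm2.trans ?_, hm2.trans ?_, (hm1.trans g1).trans ?_, hm1.trans (g1.trans ?_)⟩
    · exact le_trans (by linarith) (le_abs_self _)
    · exact le_trans (by linarith) (le_abs_self _)
    · exact le_trans (by linarith) (le_abs_self _)
    · exact le_abs_self _
  · have hyle : y' ≤ y := by
      by_contra! hlt
      exact absurd (h.mono hy hy' hlt) (not_lt.2 hyy)
    have hyn : n₁ ≤ y' := by
      by_contra! hlt
      have := h.mono hy' hn₁ hlt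
      linarith
    have g1 := hgap y y' n₁ ⟨by linarith, by linarith [hc.2]⟩ ⟨by linarith, by linarith [hc.2]⟩
      hI₁ (Or.inr ⟨hyn, hyle, hy⟩) (by rw [hF₁]; exact hsp')
    have g2 := hsym n₂ c n₁ c hI₂ hc hI₁ hc (Or.inl ⟨le_rfl, hn₂⟩) (Or.inr ⟨hn₁, le_rfl⟩)
      hF12.symm rfl
    rw [abs_of_nonpos (by linarith : n₁ - y' ≤ 0)] at g1
    rw [abs_of_nonpos (by linarith), abs_of_nonneg (by linarith)] at g2
    have hm2 : min κ₁ κ₂ * |y - y'| ≤ n₂ - c := by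
      calc _ ≤ κ₂ * (c - n₁) := by
            rw [abs_of_nonneg (by linarith)]
            exact mul_le_mul (min_le_right _ _) (by linarith) (by linarith) hκ₂.le
        _ ≤ _ := by linarith
    refine ⟨(hm1.trans g1).trans ?_, (hm1.trans g1).trans ?_, hm2.trans ?_, hm2.trans ?_⟩
    · exact le_trans (by linarith) (le_abs_self _)
    · exact le_trans (by linarith) (le_abs_self _)
    · exact le_trans (by linarith) (le_abs_self _)
    · exact le_trans (by linarith) (le_abs_self _)

/-- If a lateral domain contains an interval longer than its distance to the turning point, then
the central domain is well inside the nice interval. -/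
lemma Distortion.central_spaced (h : ProperUnimodal F c) (D : Distortion F c C q A₁ A₂) :
    ∃ κ > 0, ∀ (L : Level F c) (y y' : ℝ), y ≤ y' →
      (y ∈ Ioo L.r₁ L.r₂ ∧ y' ∈ Ioo L.r₁ L.r₂ ∧ y - c < y' - y ∨
        y ∈ Ioo L.l₁ L.l₂ ∧ y' ∈ Ioo L.l₁ L.l₂ ∧ c - y' < y' - y) →
      ∀ z ∈ Ioo L.t₁ L.t₂, ∀ z' ∈ Ioo L.t₁ L.t₂, Spaced κ L.a L.b z z' := by
  have hc : c ∈ Icc (-4:ℝ) 5 := ⟨by linarith [h.c_mem.1], by linarith [h.c_mem.2]⟩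
  obtain ⟨κ₂, hκ₂, hκ₂1, hsym⟩ := D.fold_symm hc
  refine ⟨κ₂ / (1 + 1 / κ₂), by positivity, ?_⟩
  intro L y y' hyy' hcase z hz z' hz'
  have o1 := L.a_nonneg
  have o2 := L.a_le
  have o3 := L.l_lt
  have o4 := L.l_le
  have o5 := L.t_lt
  have o6 := L.lt_t
  have o7 := L.le_r
  have o8 := L.r_lt
  have o9 := L.le_b
  have o10 := L.b_le
  have hI : ∀ w, L.a ≤ w → w ≤ L.b → w ∈ Icc (-4:ℝ) 5 := fun w h1 h2 =>
    ⟨by linarith, by linarith⟩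
  have key : ∃ J, 0 ≤ J ∧ κ₂ * J ≤ L.t₁ - L.a ∧ κ₂ * J ≤ L.b - L.t₂ ∧
      κ₂ * (L.t₂ - L.t₁) ≤ (1 + κ₂) * J := by
    refine ⟨y' - y, by linarith, ?_⟩
    rcases hcase with ⟨hy, hy', hlt⟩ | ⟨hy, hy', hlt⟩
    · have g1 := hsym L.l₁ L.l₂ L.r₂ L.r₁ (hI _ (by linarith) (by linarith))
        (hI _ (by linarith) (by linarith)) (hI _ (by linarith) (by linarith))
        (hI _ (by linarith) (by linarith)) (Or.inr ⟨by linarith, by linarith⟩)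
        (Or.inl ⟨by linarith, by linarith⟩) (by rw [L.F_l₁, L.F_r₂]) (by rw [L.F_l₂, L.F_r₁])
      have g2 := hsym L.t₂ c L.t₁ c (hI _ (by linarith) (by linarith)) hc
        (hI _ (by linarith) (by linarith)) hc (Or.inl ⟨le_rfl, by linarith⟩)
        (Or.inr ⟨by linarith, le_rfl⟩) L.F_t.symm rfl
      rw [abs_of_pos (by linarith), abs_of_neg (by linarith)] at g1
      rw [abs_of_neg (by linarith), abs_of_pos (by linarith)] at g2
      refine ⟨?_, ?_, ?_⟩
      · have : κ₂ * (y' - y) ≤ κ₂ * (L.r₂ - L.r₁) :=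
          mul_le_mul_of_nonneg_left (by linarith [hy.1, hy'.2]) hκ₂.le
        linarith
      · have : κ₂ * (y' - y) ≤ 1 * (y' - y) := by gcongr
        linarith [hy.1, hy'.2]
      · have h1 : κ₂ * (L.t₂ - c) ≤ κ₂ * (y' - y) :=
          mul_le_mul_of_nonneg_left (by linarith [hy.1]) hκ₂.le
        linarith [hy.1]
    · have g1 := hsym L.r₂ L.r₁ L.l₁ L.l₂ (hI _ (by linarith) (by linarith))
        (hI _ (by linarith) (by linarith)) (hI _ (by linarith) (by linarith))
        (hI _ (by linarith) (by linarith)) (Or.inl ⟨by linarith, by linarith⟩)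
        (Or.inr ⟨by linarith, by linarith⟩) (by rw [L.F_l₁, L.F_r₂]) (by rw [L.F_l₂, L.F_r₁])
      have g2 := hsym L.t₁ c L.t₂ c (hI _ (by linarith) (by linarith)) hc
        (hI _ (by linarith) (by linarith)) hc (Or.inr ⟨by linarith, le_rfl⟩)
        (Or.inl ⟨le_rfl, by linarith⟩) L.F_t rfl
      rw [abs_of_neg (by linarith), abs_of_pos (by linarith)] at g1
      rw [abs_of_pos (by linarith), abs_of_neg (by linarith)] at g2
      refine ⟨?_, ?_, ?_⟩
      · have : κ₂ * (y' - y) ≤ 1 * (y' - y) := by gcongr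
        linarith [hy.1, hy'.2]
      · have : κ₂ * (y' - y) ≤ κ₂ * (L.l₂ - L.l₁) :=
          mul_le_mul_of_nonneg_left (by linarith [hy.1, hy'.2]) hκ₂.le
        linarith
      · have h1 : κ₂ * (c - L.t₁) ≤ κ₂ * (y' - y) :=
          mul_le_mul_of_nonneg_left (by linarith [hy'.2]) hκ₂.le
        linarith [hy'.2]
  obtain ⟨J, hJ0, k1, k2, k3⟩ := key
  have hzz : |z - z'| ≤ L.t₂ - L.t₁ := by
    rw [abs_le]; constructor <;> linarith [hz.1, hz.2, hz'.1, hz'.2]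
  have hmain : κ₂ / (1 + 1 / κ₂) * |z - z'| ≤ κ₂ * J := by
    rw [show κ₂ / (1 + 1 / κ₂) = κ₂ * (κ₂ / (1 + κ₂)) by field_simp; ring, mul_assoc]
    gcongr
    rw [div_mul_eq_mul_div, div_le_iff₀ (by positivity)]
    calc _ ≤ κ₂ * (L.t₂ - L.t₁) := by gcongr
      _ ≤ _ := by linarith
  refine ⟨hmain.trans (k1.trans ?_), hmain.trans (k1.trans ?_), hmain.trans (k2.trans ?_),
    hmain.trans (k2.trans ?_)⟩
  · exact le_trans (by linarith [hz.1]) (le_abs_self _)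
  · exact le_trans (by linarith [hz'.1]) (le_abs_self _)
  · exact le_trans (by linarith [hz.2]) (le_abs_self _)
  · exact le_trans (by linarith [hz'.2]) (le_abs_self _)

end

namespace Level

variable {F : ℝ → ℝ} {c : ℝ} (L : Level F c)

lemma card_visits_le {W : Set ℝ} {x : ℝ} {j : ℕ} (P : Finset ℕ)
    (hW : ∀ τ, F^[τ] x ∈ W → (j + τ) % L.N ∈ P) :
    ((Finset.range (4 * L.N)).filter fun τ => F^[τ] x ∈ W).card ≤ P.card * 4 := by
  have hN := L.N_pos
  rw [show P.card * 4 = (P ×ˢ Finset.range 4).card by simp]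
  refine Finset.card_le_card_of_injOn (fun τ => ((j + τ) % L.N, τ / L.N)) ?_ ?_
  · intro τ hτ
    simp only [Finset.coe_filter, Finset.mem_range, mem_ofPred_eq] at hτ
    simp only [Finset.coe_product, mem_prod, Finset.mem_coe, Finset.mem_range]
    exact ⟨hW τ hτ.2, Nat.div_lt_of_lt_mul (by rw [mul_comm]; exact hτ.1)⟩
  · intro τ _ τ' _ heq
    simp only [Prod.mk.injEq] at heq
    have h1 : τ % L.N = τ' % L.N := Nat.ModEq.add_left_cancel' j heq.1
    rw [← Nat.div_add_mod τ L.N, ← Nat.div_add_mod τ' L.N, h1, heq.2]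

variable (h : ProperUnimodal F c) (hR : L.Reach)
include h hR

lemma card_visits_T {x : ℝ} {j : ℕ} {W : Set ℝ} (hW : W = Ioo L.a L.b) (hx : x ∈ L.phase j) :
    ((Finset.range (4 * L.N)).filter fun τ => F^[τ] x ∈ W).card ≤ 24 := by
  refine (L.card_visits_le (j := j) {0, L.r} ?_).trans ?_
  · intro τ hτ
    rw [hW] at hτ
    have := (L.phase_T_iff h hR (L.phase_map h hx τ)).1 hτ
    simpa using this
  · have : ({0, L.r} : Finset ℕ).card ≤ 2 := Finset.card_le_two
    omega

lemma card_phases_hull {q : ℕ} {p₁ p₂ : ℝ} (S : L.Star q p₁ p₂) :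
    ((Finset.range L.N).filter fun j => (L.phase j ∩ hull p₁ p₂).Nonempty).card ≤ 6 := by
  choose k e₁ e₂ hk E hsub using L.phase_entry h hR
  obtain ⟨hp, -, -⟩ := L.star_bounds h S
  have hend : ∀ j, (j + k j) % L.N = 0 ∨ (j + k j) % L.N = L.r := by
    intro j
    obtain ⟨x, hx⟩ : (L.phase j).Nonempty := ⟨_, orbit_mem_phase L j⟩
    exact (L.phase_T_iff h hR (L.phase_map h hx (k j))).1 ((E j).into (hsub j hx))
  have hinj : ∀ i j z, i < L.N → j < L.N → z ∈ Ioo (e₁ i) (e₂ i) → z ∈ Ioo (e₁ j) (e₂ j) →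
      ((i + k i) % L.N = 0 ↔ (j + k j) % L.N = 0) → i = j := by
    intro i j z hi hj hzi hzj hiff
    have hkk := ((E i).unique h L.nice (E j) hzi hzj).1
    have hmod : (i + k i) % L.N = (j + k j) % L.N := by
      rcases hend i with h1 | h1 <;> rcases hend j with h2 | h2
      · rw [h1, h2]
      · rw [h1, hiff.1 h1]
      · rw [h2, hiff.2 h2]
      · rw [h1, h2]
    rw [hkk] at hmod
    have := Nat.ModEq.add_right_cancel' (k j) hmod
    rw [Nat.ModEq, Nat.mod_eq_of_lt hi, Nat.mod_eq_of_lt hj] at this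
    exact this
  have hcard : (Finset.univ : Finset (Fin 3 × Bool)).card = 6 := by simp
  rw [← hcard]
  refine Finset.card_le_card_of_injOn (fun j => ((if e₁ j ≤ 2 * p₁ - p₂ then 0 else
    if 2 * p₂ - p₁ ≤ e₂ j then 1 else 2 : Fin 3), decide ((j + k j) % L.N = 0)))
    (fun _ _ => Finset.mem_coe.2 (Finset.mem_univ _)) ?_
  intro i hi j hj heq
  simp only [Finset.coe_filter, Finset.mem_range, mem_ofPred_eq] at hi hj
  simp only [Prod.mk.injEq, decide_eq_decide] at heq
  obtain ⟨hpos, hiff⟩ := heq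
  obtain ⟨hiN, zi, hzi, hzi'⟩ := hi
  obtain ⟨hjN, zj, hzj, hzj'⟩ := hj
  have mi := hsub i hzi
  have mj := hsub j hzj
  suffices ∃ z, z ∈ Ioo (e₁ i) (e₂ i) ∧ z ∈ Ioo (e₁ j) (e₂ j) by
    obtain ⟨z, h1, h2⟩ := this
    exact hinj i j z hiN hjN h1 h2 hiff
  have star : ∀ j z, z ∈ L.phase j → z ∈ Ioo (e₁ j) (e₂ j) → z ∈ hull p₁ p₂ →
      ¬ e₁ j ≤ 2 * p₁ - p₂ → ¬ 2 * p₂ - p₁ ≤ e₂ j → e₁ j = p₁ ∧ e₂ j = p₂ := by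
    intro j z hz hzE hzh h1 h2
    have := (E j).lt
    refine L.star_of_hull h S (E j) (L.phase_sub j hz) hzE ⟨not_le.1 h1, ?_⟩ ⟨?_, not_le.1 h2⟩
    · exact hzE.1.trans hzh.2
    · exact hzh.1.trans hzE.2
  by_cases c1 : e₁ i ≤ 2 * p₁ - p₂ <;> by_cases c2 : e₁ j ≤ 2 * p₁ - p₂
  · refine ⟨min zi zj, ⟨lt_min mi.1 ?_, (min_le_left _ _).trans_lt mi.2⟩,
      ⟨lt_min ?_ mj.1, (min_le_right _ _).trans_lt mj.2⟩⟩
    · exact c1.trans_lt hzj'.1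
    · exact c2.trans_lt hzi'.1
  · rw [if_pos c1, if_neg c2] at hpos
    split_ifs at hpos <;> simp at hpos
  · rw [if_neg c1, if_pos c2] at hpos
    split_ifs at hpos <;> simp at hpos
  · rw [if_neg c1, if_neg c2] at hpos
    by_cases d1 : 2 * p₂ - p₁ ≤ e₂ i <;> by_cases d2 : 2 * p₂ - p₁ ≤ e₂ j
    · refine ⟨max zi zj, ⟨mi.1.trans_le (le_max_left _ _), max_lt mi.2 ?_⟩,
        ⟨mj.1.trans_le (le_max_right _ _), max_lt ?_ mj.2⟩⟩
      · exact hzj'.2.trans_le d1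
      · exact hzi'.2.trans_le d2
    · rw [if_pos d1, if_neg d2] at hpos; simp at hpos
    · rw [if_neg d1, if_pos d2] at hpos; simp at hpos
    · obtain ⟨g1, g2⟩ := star i zi hzi mi hzi' c1 d1
      obtain ⟨g3, g4⟩ := star j zj hzj mj hzj' c2 d2
      exact ⟨zi, mi, by rw [g3, g4, ← g1, ← g2]; exact mi⟩

lemma card_visits_hull {q j : ℕ} {p₁ p₂ x : ℝ} (S : L.Star q p₁ p₂) (hx : x ∈ L.phase j) :
    ((Finset.range (4 * L.N)).filter fun τ => F^[τ] x ∈ hull p₁ p₂).card ≤ 24 := by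
  refine (L.card_visits_le (j := j)
    ((Finset.range L.N).filter fun j => (L.phase j ∩ hull p₁ p₂).Nonempty) ?_).trans ?_
  · intro τ hτ
    rw [Finset.mem_filter, Finset.mem_range]
    refine ⟨Nat.mod_lt _ L.N_pos, F^[τ] x, ?_, hτ⟩
    rw [L.phase_congr (Nat.mod_mod _ _)]
    exact L.phase_map h hx τ
  · have := L.card_phases_hull h hR S
    omega

end Level

lemma Spaced.of_ends {κ y₁ y₂ u v a d : ℝ} {g : ℝ → ℝ} (hS : Spaced κ y₁ y₂ u v)
    (hE : EndsTo g a d y₁ y₂) : Spaced κ (g a) (g d) u v := by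
  rcases hE with ⟨e1, e2⟩ | ⟨e1, e2⟩ <;> rw [e1, e2]
  exacts [hS, hS.swap_ends]

lemma exists_add_mod_eq {N : ℕ} (hN : 0 < N) (A q : ℕ) : ∃ t < N, (A + t) % N = q % N := by
  refine ⟨(q + (N - 1) * A) % N, Nat.mod_lt _ hN, ?_⟩
  obtain ⟨n, rfl⟩ : ∃ n, N = n + 1 := ⟨N - 1, by omega⟩
  rw [Nat.add_mod_mod, show A + (q + (n + 1 - 1) * A) = q + (n + 1) * A by
    rw [Nat.add_sub_cancel]; ring, Nat.add_mul_mod_self_left]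

lemma eq_of_add_mod_eq {N A s t : ℕ} (hst : s ≤ t) (hlt : t < s + N)
    (hmod : (A + s) % N = (A + t) % N) : s = t := by
  have h1 : s % N = t % N := Nat.ModEq.add_left_cancel' A hmod
  have h2 : N ∣ t - s := (Nat.modEq_iff_dvd' hst).1 h1
  rcases Nat.eq_zero_or_pos (t - s) with h3 | h3
  · omega
  · have := Nat.le_of_dvd h3 h2
    omega

/-- The interval `[α,β]` can be enlarged by a factor to one on which the first `m` iterates have no
turning points, for some `m ≥ k`. -/
def Expand (F : ℝ → ℝ) (c κ : ℝ) (k : ℕ) (α β : ℝ) : Prop :=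
  ∃ m a d, k ≤ m ∧ NoTurn F c m a d ∧ a ≤ α - κ * (β - α) ∧ β + κ * (β - α) ≤ d

namespace Level

variable {F : ℝ → ℝ} {c : ℝ}

/-- The orbit of the interval `[α,β]` avoids the turning point and all its points return infinitely
often to the nice interval. -/
structure Tame (L : Level F c) (α β : ℝ) : Prop where
  lt : α < β
  avoid : ∀ m, ∀ z ∈ Icc α β, F^[m] z ≠ c
  recur : ∀ z ∈ Icc α β, ∀ m, ∃ n, m ≤ n ∧ F^[n] z ∈ Ioo L.a L.b

variable {L : Level F c} {α β : ℝ}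

lemma Tame.noTurn (H : L.Tame α β) (m : ℕ) : NoTurn F c m α β :=
  fun v _ z hz => H.avoid v z (Ioo_subset_Icc_self hz)

lemma Tame.ne_of_avoid (H : L.Tame α β) {e : ℝ} (he : ∀ n, 1 ≤ n → F^[n] e ∉ Ioo L.a L.b)
    (m : ℕ) : ∀ z ∈ Icc α β, F^[m] z ≠ e := by
  rintro z hz rfl
  obtain ⟨n, hn, hnT⟩ := H.recur z hz (m + 1)
  refine he (n - m) (by omega) ?_
  rwa [← iterate_add_apply, show n - m + m = n by omega]

section
variable (h : ProperUnimodal F c)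
include h

lemma Tame.stay (H : L.Tame α β) {x e₁ e₂ : ℝ} {m : ℕ} (hx : x ∈ Icc α β)
    (hm : F^[m] x ∈ Ioo e₁ e₂) (h₁ : ∀ z ∈ Icc α β, F^[m] z ≠ e₁)
    (h₂ : ∀ z ∈ Icc α β, F^[m] z ≠ e₂) : ∀ z ∈ Icc α β, F^[m] z ∈ Ioo e₁ e₂ := by
  have _ := H.lt
  have hoc : (F^[m] '' Icc α β).OrdConnected :=
    (isPreconnected_Icc.image _ (h.iter_cont m).continuousOn).ordConnected
  intro z hz
  constructor
  · by_contra! hcon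
    obtain ⟨z', hz', he⟩ := hoc.out ⟨z, hz, rfl⟩ ⟨x, hx, rfl⟩ ⟨hcon, hm.1.le⟩
    exact h₁ z' hz' he
  · by_contra! hcon
    obtain ⟨z', hz', he⟩ := hoc.out ⟨x, hx, rfl⟩ ⟨z, hz, rfl⟩ ⟨hm.2.le, hcon⟩
    exact h₂ z' hz' he

lemma Tame.side (H : L.Tame α β) (m : ℕ) :
    (c < F^[m] α ∧ c < F^[m] β) ∨ (F^[m] α < c ∧ F^[m] β < c) := by
  have hα : α ∈ Icc α β := ⟨le_rfl, H.lt.le⟩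
  have hβ : β ∈ Icc α β := ⟨H.lt.le, le_rfl⟩
  have hoc : (F^[m] '' Icc α β).OrdConnected :=
    (isPreconnected_Icc.image _ (h.iter_cont m).continuousOn).ordConnected
  rcases lt_trichotomy (F^[m] α) c with h1 | h1 | h1
  · rcases lt_or_ge (F^[m] β) c with h2 | h2
    · exact Or.inr ⟨h1, h2⟩
    · obtain ⟨z, hz, he⟩ := hoc.out ⟨α, hα, rfl⟩ ⟨β, hβ, rfl⟩ ⟨h1.le, h2⟩
      exact absurd he (H.avoid m z hz)
  · exact absurd h1 (H.avoid m α hα)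
  · rcases lt_or_ge c (F^[m] β) with h2 | h2
    · exact Or.inl ⟨h1, h2⟩
    · obtain ⟨z, hz, he⟩ := hoc.out ⟨β, hβ, rfl⟩ ⟨α, hα, rfl⟩ ⟨h2, h1.le⟩
      exact absurd he (H.avoid m z hz)

lemma Tame.bounded (H : L.Tame α β) (m : ℕ) : ∀ z ∈ Icc α β, F^[m] z ∈ Ioo (-1:ℝ) 2 := by
  intro z hz
  obtain ⟨n, hn, hnT⟩ := H.recur z hz m
  by_contra hcon
  have h1 : F^[m] z ≤ -1 ∨ 1 + 1 ≤ F^[m] z := by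
    by_contra! h3
    exact hcon ⟨h3.1, by linarith [h3.2]⟩
  have h2 := h.escape le_rfl h1 (n - m)
  rw [← iterate_add_apply, show n - m + m = n by omega] at h2
  have := L.a_nonneg
  have := L.b_le
  rcases h2 with h2 | h2 <;> linarith [hnT.1, hnT.2]

lemma Tame.image_ne (H : L.Tame α β) (m : ℕ) : F^[m] α ≠ F^[m] β := fun he =>
  H.lt.ne (h.inj_iter H.lt (H.noTurn m) ⟨le_rfl, H.lt.le⟩ ⟨H.lt.le, le_rfl⟩ he)

end

variable {C q A₁ A₂ : ℝ}

/-- Pulling back a tame interval along a chain. -/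
lemma pull_spaced (h : ProperUnimodal F c) (D : Distortion F c C q A₁ A₂) {κ : ℝ} (hκ : 0 < κ) :
    ∃ κ' > 0, ∀ (L : Level F c), L.Reach → ∀ α β, L.Tame α β → ∀ j, ∀ x ∈ L.phase j,
      x ∈ Icc α β → ∀ p p₁ p₂, L.Star p p₁ p₂ →
      ∀ W, (W = hull p₁ p₂ ∨ W = Ioo L.a L.b) → ∀ w m m' a d y₁ y₂, m ≤ m' → m + m' < 4 * L.N →
      F^[w] x ∈ Ioo a d → NoTurn F c m a d → EndsTo F^[m] a d y₁ y₂ → MapsTo F^[m'] (Ioo a d) W →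
      (∀ z ∈ Icc α β, F^[m] (F^[w] z) ∈ Ioo y₁ y₂) →
      Spaced κ y₁ y₂ (F^[m] (F^[w] α)) (F^[m] (F^[w] β)) →
      (∀ z ∈ Icc α β, F^[w] z ∈ Ioo a d) ∧ Spaced κ' a d (F^[w] α) (F^[w] β) := by
  obtain ⟨κ', hκ', hch⟩ := D.chain_spaced h 24 hκ
  refine ⟨κ', hκ', ?_⟩
  intro L hR α β H j x hx hxJ p p₁ p₂ S W hW w m m' a d y₁ y₂ hmm hlt hw hn hE hmaps hJ hsp
  have hWsub : W ⊆ Ioo (-4) 5 := by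
    rcases hW with rfl | rfl
    · exact L.hull_sub h S
    · exact Ioo_subset_Ioo (by linarith [L.a_nonneg]) (by linarith [L.b_le])
  have hcard : ((Finset.range (4 * L.N)).filter fun τ => F^[τ] (F^[w] x) ∈ W).card ≤ 24 := by
    rcases hW with hW | hW
    · have := L.card_visits_hull h hR S (L.phase_map h hx w)
      rwa [← hW] at this
    · exact L.card_visits_T h hR hW (L.phase_map h hx w)
  have hne : ∀ e, (e = a ∨ e = d) → ∀ z ∈ Icc α β, F^[w] z ≠ e := by
    rintro e he z hz rfl
    have h1 := hJ z hz
    have h2 : F^[m] (F^[w] z) = y₁ ∨ F^[m] (F^[w] z) = y₂ := by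
      rcases hE with ⟨e1, e2⟩ | ⟨e1, e2⟩ <;> rcases he with he | he <;> rw [he]
      exacts [Or.inl e1, Or.inr e2, Or.inr e1, Or.inl e2]
    rcases h2 with h2 | h2
    · exact h1.1.ne' h2
    · exact h1.2.ne h2
  have hst := H.stay h hxJ hw (hne a (Or.inl rfl)) (hne d (Or.inr rfl))
  exact ⟨hst, hch W (F^[w] x) a d (F^[w] α) (F^[w] β) m m' (4 * L.N) hWsub hn hmm hmaps hw hcard
    hlt (hst α ⟨le_rfl, H.lt.le⟩) (hst β ⟨H.lt.le, le_rfl⟩) (H.image_ne h w) (hsp.of_ends hE)⟩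

lemma Tame.expand (H : L.Tame α β) {κ a d : ℝ} {k m : ℕ} (hk : k ≤ m) (hn : NoTurn F c m a d)
    (hJ : ∀ z ∈ Icc α β, z ∈ Ioo a d) (hS : Spaced κ a d α β) : Expand F c κ k α β := by
  have h1 := hJ α ⟨le_rfl, H.lt.le⟩
  have h2 := hJ β ⟨H.lt.le, le_rfl⟩
  obtain ⟨h3, -, -, h4⟩ := hS
  rw [abs_sub_comm, abs_of_pos (by linarith [H.lt]), abs_of_pos (by linarith [h1.1])] at h3
  rw [abs_sub_comm, abs_of_pos (by linarith [H.lt]), abs_of_pos (by linarith [h2.2])] at h4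
  exact ⟨m, a, d, hk, hn, by linarith, by linarith⟩

end Level

lemma Expand.mono {F : ℝ → ℝ} {c κ κ' α β : ℝ} {k : ℕ} (hE : Expand F c κ k α β) (hκ : κ' ≤ κ)
    (hαβ : α ≤ β) : Expand F c κ' k α β := by
  obtain ⟨m, a, d, h1, h2, h3, h4⟩ := hE
  have : κ' * (β - α) ≤ κ * (β - α) := mul_le_mul_of_nonneg_right hκ (by linarith)
  exact ⟨m, a, d, h1, h2, by linarith, by linarith⟩

namespace Level

variable {F : ℝ → ℝ} {c C q A₁ A₂ : ℝ}

/-- A chain into the hull which contains the critical value and starts right after a visit to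
the central domain can be prolonged backwards. -/
lemma expand_of_central (h : ProperUnimodal F c) (D : Distortion F c C q A₁ A₂) {κ : ℝ}
    (hκ : 0 < κ) :
    ∃ κ' > 0, ∀ (L : Level F c), L.Reach → ∀ α β, L.Tame α β → ∀ j, ∀ x ∈ L.phase j,
      x ∈ Icc α β → ∀ p p₁ p₂, L.Star p p₁ p₂ → ∀ k, (∀ t < k, F^[t] x ∉ Ioo L.a L.b) →
      ∀ u m a d, k ≤ u → u < k + L.N → u + 1 + m < 2 * L.N → (j + u) % L.N = 0 →
      NoTurn F c m a d → MapsTo F^[m] (Ioo a d) (hull p₁ p₂) → F c ∈ Ioo a d →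
      (∀ z ∈ Icc α β, F^[u + 1] z ∈ Ioo a d) → F^[m] (F^[u + 1] x) ∈ Ioo p₁ p₂ →
      Spaced κ a d (F^[u + 1] α) (F^[u + 1] β) → Expand F c κ' k α β := by
  obtain ⟨κ₁, hκ₁, hfold⟩ := D.fold_spaced h hκ
  obtain ⟨κ₂, hκ₂, hpull⟩ := pull_spaced h D hκ₁
  refine ⟨κ₂, hκ₂, ?_⟩
  intro L hR α β H j x hx hxJ p p₁ p₂ S k hb u m a d hku hukN hum hju hn hm hc hJ hxm hsp
  have hxT : F^[u] x ∈ Ioo L.t₁ L.t₂ := (L.phase_t_iff h hR (L.phase_map h hx u)).2 hju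
  have hbT : ∀ t < u, F^[t] x ∉ Ioo L.t₁ L.t₂ := by
    intro t ht htT
    have hkt : k ≤ t := by
      by_contra! hlt
      exact hb t hlt (L.t_sub htT)
    have h1 := (L.phase_t_iff h hR (L.phase_map h hx t)).1 htT
    have := eq_of_add_mod_eq (N := L.N) (A := j) (s := t) (t := u) ht.le (by omega) (by rw [h1, hju])
    omega
  obtain ⟨n₁, hn₁, hF₁⟩ := h.exists_left hc.1.le
  obtain ⟨n₂, hn₂, hF₂⟩ := h.exists_right hc.1.le
  have hn₁' : n₁ < c := lt_of_le_of_ne hn₁ fun he => hc.1.ne (by rw [← hF₁, he])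
  have hn₂' : c < n₂ := lt_of_le_of_ne hn₂ fun he => hc.1.ne (by rw [← hF₂, he])
  have hNa : ∀ z ∈ Ioo n₁ n₂, F z ∈ Ioo a d := by
    intro z hz
    refine ⟨?_, (h.le_top z).trans_lt hc.2⟩
    rcases le_total z c with hzc | hzc
    · rw [← hF₁]; exact h.mono hn₁ hzc hz.1
    · rw [← hF₂]; exact h.anti hzc hn₂ hz.2
  have hmem : ∀ z, a < F z → z ∈ Ioo n₁ n₂ := by
    intro z hz
    constructor
    · by_contra! hcon
      have := h.mono.monotoneOn (hcon.trans hn₁) hn₁ hcon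
      linarith
    · by_contra! hcon
      have := h.anti.antitoneOn hn₂ (hn₂.trans hcon) hcon
      linarith
  have hsub : Ioo n₁ n₂ ⊆ Ioo (-4:ℝ) 5 := by
    intro z hz
    have h1 := L.hull_sub h S (hm (hNa z hz))
    rw [← iterate_succ_apply] at h1
    by_contra hcon
    have h2 : z ≤ -4 ∨ 1 + 4 ≤ z := by
      by_contra! h3
      exact hcon ⟨h3.1, by linarith [h3.2]⟩
    rcases h.escape (by norm_num) h2 (m + 1) with h4 | h4
    · linarith [h1.1]
    · linarith [h1.2]
  obtain ⟨hn4, hn5⟩ := (Ioo_subset_Ioo_iff (hn₁'.trans hn₂')).1 hsub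
  obtain ⟨a', d', hxa, hn', hE⟩ := L.pull_through h S hn hm hc (hJ x hxJ) hxm hxT hbT hn₁ hn₂ hF₁ hF₂
  have hα : α ∈ Icc α β := ⟨le_rfl, H.lt.le⟩
  have hβ : β ∈ Icc α β := ⟨H.lt.le, le_rfl⟩
  have hJa : ∀ z ∈ Icc α β, a < F (F^[u] z) := by
    intro z hz
    rw [← iterate_succ_apply' F u z]
    exact (hJ z hz).1
  have hsp' : Spaced κ₁ n₁ n₂ (F^[u] α) (F^[u] β) := by
    refine hfold n₁ n₂ a d _ _ hn4 hn₁ hn₂ hn5 hF₁ hF₂ ?_ (hJa α hα) (hJa β hβ) ?_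
    · exact (H.side h u).imp (fun h => ⟨h.1.le, h.2.le⟩) fun h => ⟨h.1.le, h.2.le⟩
    · rwa [iterate_succ_apply', iterate_succ_apply'] at hsp
  have hmaps' : MapsTo F^[u] (Ioo a' d') (Ioo n₁ n₂) :=
    h.mapsTo_of_ends (hxa.1.trans hxa.2) (hn₁'.trans hn₂') hn' hE
  have := hpull L hR α β H j x hx hxJ p p₁ p₂ S _ (Or.inl rfl) 0 u (m + 1 + u) a' d' n₁ n₂
    (by omega) (by omega) hxa hn' hE (fun z hz => by
      rw [iterate_add_apply, iterate_succ_apply]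
      exact hm (hNa _ (hmaps' hz))) (fun z hz => hmem _ (hJa z hz)) hsp'
  exact H.expand hku hn' this.1 this.2

lemma exists_expand (h : ProperUnimodal F c) (D : Distortion F c C q A₁ A₂) :
    ∃ κ > 0, ∀ (L : Level F c), L.Reach → ∀ α β, L.Tame α β → ∀ x ∈ orbitClosure F c,
      x ∈ Icc α β → ∀ k, F^[k] x ∈ Ioo L.a L.b → (∀ t < k, F^[t] x ∉ Ioo L.a L.b) →
      Expand F c κ k α β := by
  obtain ⟨κ₁, hκ₁, hpull₁⟩ := pull_spaced (F := F) (c := c) h D (κ := 1) one_pos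
  obtain ⟨κ₂, hκ₂, hcen₁⟩ := expand_of_central h D hκ₁
  obtain ⟨κ₃, hκ₃, hwell⟩ := D.central_spaced h
  obtain ⟨κ₄, hκ₄, hpullT⟩ := pull_spaced h D hκ₃
  obtain ⟨κ₅, hκ₅, hgap⟩ := D.fold_gap hκ₁
  obtain ⟨κ₆, hκ₆, hpull₆⟩ := pull_spaced h D (κ := min 1 κ₅) (by positivity)
  obtain ⟨κ₇, hκ₇, hcen₇⟩ := expand_of_central h D hκ₆
  refine ⟨min κ₁ (min κ₂ (min κ₄ (min κ₆ κ₇))), by positivity, ?_⟩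
  intro L hR α β H x hxX hxJ k hkT hkb
  have hαβ := H.lt.le
  have hα : α ∈ Icc α β := ⟨le_rfl, H.lt.le⟩
  have hβ : β ∈ Icc α β := ⟨H.lt.le, le_rfl⟩
  have hN := L.N_pos
  obtain ⟨j, -, hx⟩ := L.exists_phase hxX
  have hkN : k < L.N := by
    obtain ⟨k₀, e₁, e₂, hk₀, E, hsub⟩ := L.phase_entry h hR j
    by_contra! hle
    exact hkb k₀ (by omega) (E.into (hsub hx))
  obtain ⟨p, p₁, p₂, S⟩ := L.exists_star h hR
  obtain ⟨hp12, hp1, hp2⟩ := L.star_bounds h S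
  obtain ⟨t, ht, htp⟩ := exists_add_mod_eq hN (j + k) p
  obtain ⟨i, hi⟩ : ∃ i, i = k + t := ⟨_, rfl⟩
  have hji : (j + i) % L.N = p % L.N := by rw [hi, ← htp, add_assoc]
  have hxi : F^[i] x ∈ Ioo p₁ p₂ := by
    apply S.sub
    rw [← L.phase_congr hji]
    exact L.phase_map h hx i
  obtain ⟨kp, Ep⟩ := S.entry
  have hJi : ∀ z ∈ Icc α β, F^[i] z ∈ Ioo p₁ p₂ :=
    H.stay h hxJ hxi (H.ne_of_avoid (fun n _ => Ep.left_avoid h L.nice n) i)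
      (H.ne_of_avoid (fun n _ => Ep.right_avoid h L.nice n) i)
  have hspi : ∀ y ∈ Ioo p₁ p₂, ∀ y' ∈ Ioo p₁ p₂, Spaced 1 (2 * p₁ - p₂) (2 * p₂ - p₁) y y' := by
    intro y hy y' hy'
    have h1 : 1 * |y - y'| ≤ p₂ - p₁ := by
      rw [one_mul, abs_le]; constructor <;> linarith [hy.1, hy.2, hy'.1, hy'.2]
    refine ⟨h1.trans ?_, h1.trans ?_, h1.trans ?_, h1.trans ?_⟩
    · exact le_trans (by linarith [hy.1]) (le_abs_self _)
    · exact le_trans (by linarith [hy'.1]) (le_abs_self _)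
    · exact le_trans (by linarith [hy.2]) (le_abs_self _)
    · exact le_trans (by linarith [hy'.2]) (le_abs_self _)
  have hhull : Ioo p₁ p₂ ⊆ Ioo (2 * p₁ - p₂) (2 * p₂ - p₁) :=
    Ioo_subset_Ioo (by linarith) (by linarith)
  have hhlt : 2 * p₁ - p₂ < 2 * p₂ - p₁ := by linarith
  -- a chain starting right after a time `u` and containing the critical value
  have hvisit : ∀ u m a d, F^[u + 1] x ∈ Ioo a d → F c ∈ Ioo a d → NoTurn F c m a d →
      MapsTo F^[m] (Ioo a d) (hull p₁ p₂) → F^[m] (F^[u + 1] x) ∈ Ioo p₁ p₂ →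
      F^[u] x ∈ Ioo L.a L.b ∧ k ≤ u := by
    intro u m a d hxa hca hn hm hxm
    have hT : F^[u] x ∈ Ioo L.a L.b := by
      by_contra hcon
      have h1 := L.F_le_v₁ h hcon
      rw [← iterate_succ_apply' F] at h1
      have := L.mem_v_of_chain h S hn hm hca hxa h1 hxa hxm
      linarith [this.1]
    refine ⟨hT, ?_⟩
    by_contra! hlt
    exact hkb u hlt hT
  rcases h.pullback i x (hhull hxi) with ⟨a, d, hxa, hn, hE⟩ | ⟨u, l, hul, a, d, hxa, hca, hn, hE⟩
  · have hmaps := h.mapsTo_of_ends (hxa.1.trans hxa.2) hhlt hn hE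
    have := hpull₁ L hR α β H j x hx hxJ p p₁ p₂ S _ (Or.inl rfl) 0 i i a d _ _ le_rfl
      (by omega) hxa hn hE hmaps (fun z hz => hhull (hJi z hz))
      (hspi _ (hJi α hα) _ (hJi β hβ))
    exact (H.expand (by omega) hn this.1 this.2).mono (min_le_left _ _) hαβ
  have hmaps := h.mapsTo_of_ends (hxa.1.trans hxa.2) hhlt hn hE
  have hli : ∀ z, F^[l] (F^[u + 1] z) = F^[i] z := by
    intro z
    rw [← iterate_add_apply, show l + (u + 1) = i by omega]
  obtain ⟨hJu, hspu⟩ := hpull₁ L hR α β H j x hx hxJ p p₁ p₂ S _ (Or.inl rfl) (u + 1) l l a d _ _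
    le_rfl (by omega) hxa hn hE hmaps (fun z hz => by rw [hli]; exact hhull (hJi z hz))
    (by rw [hli, hli]; exact hspi _ (hJi α hα) _ (hJi β hβ))
  obtain ⟨huT, hku⟩ := hvisit u l a d hxa hca hn hmaps (by rw [hli]; exact hxi)
  rcases (L.phase_T_iff h hR (L.phase_map h hx u)).1 huT with hju | hju
  · refine (hcen₁ L hR α β H j x hx hxJ p p₁ p₂ S k hkb u l a d hku (by omega) (by omega) hju hn
      hmaps hca hJu (by rw [hli]; exact hxi) hspu).mono ?_ hαβ
    exact (min_le_right _ _).trans (min_le_left _ _)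
  -- the interval with critical endpoint
  have hb2 : ∀ Y₁ Y₂, Y₁ < Y₂ → c ∉ Ioo Y₁ Y₂ → (∀ z ∈ Ioo Y₁ Y₂, F z ∈ Ioo a d) →
      (∀ z ∈ Icc α β, F^[u] z ∈ Ioo Y₁ Y₂) → Spaced (min 1 κ₅) Y₁ Y₂ (F^[u] α) (F^[u] β) →
      Expand F c (min κ₆ κ₇) k α β := by
    intro Y₁ Y₂ hY hcY hFY hJY hspY
    rcases h.pullback u x (hJY x hxJ) with ⟨a', d', hxa', hn', hE'⟩ |
      ⟨u', l', hul', a', d', hxa', hca', hn', hE'⟩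
    · have hmaps' := h.mapsTo_of_ends (hxa'.1.trans hxa'.2) hY hn' hE'
      have := hpull₆ L hR α β H j x hx hxJ p p₁ p₂ S _ (Or.inl rfl) 0 u (l + 1 + u) a' d' Y₁ Y₂
        (by omega) (by omega) hxa' hn' hE' (fun z hz => by
          rw [iterate_add_apply, iterate_succ_apply]
          exact hmaps (hFY _ (hmaps' hz))) hJY hspY
      exact (H.expand hku hn' this.1 this.2).mono (min_le_left _ _) hαβ
    · have hmaps' := h.mapsTo_of_ends (hxa'.1.trans hxa'.2) hY hn' hE'
      have hl' : ∀ z, F^[l'] (F^[u' + 1] z) = F^[u] z := by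
        intro z
        rw [← iterate_add_apply, show l' + (u' + 1) = u by omega]
      have hcomp : MapsTo F^[l + 1 + l'] (Ioo a' d') (hull p₁ p₂) := fun z hz => by
        rw [iterate_add_apply, iterate_succ_apply]
        exact hmaps (hFY _ (hmaps' hz))
      have hncomp : NoTurn F c (l + 1 + l') a' d' := by
        intro v hv z hz
        rcases lt_trichotomy v l' with h1 | h1 | h1
        · exact hn' v h1 z hz
        · intro he
          rw [h1] at he
          exact hcY (he ▸ hmaps' hz)
        · obtain ⟨w, rfl⟩ : ∃ w, v = w + 1 + l' := ⟨v - l' - 1, by omega⟩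
          rw [iterate_add_apply, iterate_succ_apply]
          exact hn w (by omega) _ (hFY _ (hmaps' hz))
      obtain ⟨hJu', hspu'⟩ := hpull₆ L hR α β H j x hx hxJ p p₁ p₂ S _ (Or.inl rfl) (u' + 1) l'
        (l + 1 + l') a' d' Y₁ Y₂ (by omega) (by omega) hxa' hn' hE' hcomp
        (fun z hz => by rw [hl']; exact hJY z hz) (by rw [hl', hl']; exact hspY)
      have hxm : F^[l + 1 + l'] (F^[u' + 1] x) ∈ Ioo p₁ p₂ := by
        rw [← iterate_add_apply, show l + 1 + l' + (u' + 1) = i by omega]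
        exact hxi
      obtain ⟨huT', hku'⟩ := hvisit u' _ a' d' hxa' hca' hncomp hcomp hxm
      have hju' : (j + u') % L.N = 0 := by
        refine ((L.phase_T_iff h hR (L.phase_map h hx u')).1 huT').resolve_right fun hr => ?_
        have := eq_of_add_mod_eq (N := L.N) (A := j) (s := u') (t := u) (by omega) (by omega)
          (by rw [hr, hju])
        omega
      exact (hcen₇ L hR α β H j x hx hxJ p p₁ p₂ S k hkb u' _ a' d' hku' (by omega) (by omega)
        hju' hncomp hcomp hca' hJu' hxm hspu').mono (min_le_right _ _) hαβ
  have hb1 : (∀ z ∈ Ioo L.t₁ L.t₂, ∀ z' ∈ Ioo L.t₁ L.t₂, Spaced κ₃ L.a L.b z z') →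
      Expand F c κ₄ k α β := by
    intro hTsp
    obtain ⟨t', ht', htp'⟩ := exists_add_mod_eq hN (j + k) 0
    rw [Nat.zero_mod, add_assoc] at htp'
    have hxT : F^[k + t'] x ∈ Ioo L.t₁ L.t₂ :=
      (L.phase_t_iff h hR (L.phase_map h hx _)).2 htp'
    have hbT : ∀ s < k + t', F^[s] x ∉ Ioo L.t₁ L.t₂ := by
      intro s hs hsT
      have hks : k ≤ s := by
        by_contra! hlt
        exact hkb s hlt (L.t_sub hsT)
      have h1 := (L.phase_t_iff h hR (L.phase_map h hx s)).1 hsT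
      have := eq_of_add_mod_eq (N := L.N) (A := j) (s := s) (t := k + t') hs.le (by omega) (by rw [h1, htp'])
      omega
    obtain ⟨a', d', hxa', hn', hE'⟩ := L.pull_T h hxT hbT
    have hJT := H.stay h hxJ hxT (H.ne_of_avoid (L.avoid_end h (Or.inl rfl)) _)
      (H.ne_of_avoid (L.avoid_end h (Or.inr (Or.inl rfl))) _)
    have := hpullT L hR α β H j x hx hxJ p p₁ p₂ S _ (Or.inr rfl) 0 (k + t') (k + t') a' d' _ _
      le_rfl (by omega) hxa' hn' hE'
      (h.mapsTo_of_ends (hxa'.1.trans hxa'.2) (L.a_lt_c.trans L.c_lt_b) hn' hE')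
      (fun z hz => L.t_sub (hJT z hz)) (hTsp _ (hJT α hα) _ (hJT β hβ))
    exact H.expand (Nat.le_add_right _ _) hn' this.1 this.2
  have hκ67 : min κ₁ (min κ₂ (min κ₄ (min κ₆ κ₇))) ≤ min κ₆ κ₇ :=
    (min_le_right _ _).trans ((min_le_right _ _).trans (min_le_right _ _))
  have hκ4 : min κ₁ (min κ₂ (min κ₄ (min κ₆ κ₇))) ≤ κ₄ :=
    (min_le_right _ _).trans ((min_le_right _ _).trans (min_le_left _ _))
  have hQs : (∀ z ∈ Icc α β, F^[u] z ∈ Ioo L.r₁ L.r₂) ∨ (∀ z ∈ Icc α β, F^[u] z ∈ Ioo L.l₁ L.l₂) := by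
    rcases (L.phase_q_iff h hR (L.phase_map h hx u)).2 hju with hl | hr
    · exact Or.inr (H.stay h hxJ hl (H.ne_of_avoid (L.avoid_end h (by simp)) _)
        (H.ne_of_avoid (L.avoid_end h (by simp)) _))
    · exact Or.inl (H.stay h hxJ hr (H.ne_of_avoid (L.avoid_end h (by simp)) _)
        (H.ne_of_avoid (L.avoid_end h (by simp)) _))
  obtain ⟨n₁, hn₁, hF₁⟩ := h.exists_left hca.1.le
  obtain ⟨n₂, hn₂, hF₂⟩ := h.exists_right hca.1.le
  have hn₁' : n₁ < c := lt_of_le_of_ne hn₁ fun he => hca.1.ne (by rw [← hF₁, he])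
  have hn₂' : c < n₂ := lt_of_le_of_ne hn₂ fun he => hca.1.ne (by rw [← hF₂, he])
  have hNa : ∀ z ∈ Ioo n₁ n₂, F z ∈ Ioo a d := by
    intro z hz
    refine ⟨?_, (h.le_top z).trans_lt hca.2⟩
    rcases le_total z c with hzc | hzc
    · rw [← hF₁]; exact h.mono hn₁ hzc hz.1
    · rw [← hF₂]; exact h.anti hzc hn₂ hz.2
  have hsub : Ioo n₁ n₂ ⊆ Ioo (-4:ℝ) 5 := by
    intro z hz
    have h1 := L.hull_sub h S (hmaps (hNa z hz))
    rw [← iterate_succ_apply] at h1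
    by_contra hcon
    have h2 : z ≤ -4 ∨ 1 + 4 ≤ z := by
      by_contra! h3
      exact hcon ⟨h3.1, by linarith [h3.2]⟩
    rcases h.escape (by norm_num) h2 (l + 1) with h4 | h4
    · linarith [h1.1]
    · linarith [h1.2]
  obtain ⟨hn4, hn5⟩ := (Ioo_subset_Ioo_iff (hn₁'.trans hn₂')).1 hsub
  have hmem : ∀ z ∈ Icc α β, a < F (F^[u] z) := by
    intro z hz
    rw [← iterate_succ_apply' F u z]
    exact (hJu z hz).1
  have hlt₂ : ∀ z, a < F z → z < n₂ := by
    intro z hz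
    by_contra! hcon
    have := h.anti.antitoneOn hn₂ (hn₂.trans hcon) hcon
    linarith
  have hlt₁ : ∀ z, a < F z → n₁ < z := by
    intro z hz
    by_contra! hcon
    have := h.mono.monotoneOn (hcon.trans hn₁) hn₁ hcon
    linarith
  rw [iterate_succ_apply', iterate_succ_apply'] at hspu
  have hfin : ∀ y y', y ≤ y' → y ∈ F^[u] '' Icc α β → y' ∈ F^[u] '' Icc α β →
      (∀ κ Y₁ Y₂, Spaced κ Y₁ Y₂ y y' → Spaced κ Y₁ Y₂ (F^[u] α) (F^[u] β)) →
      Spaced κ₁ a d (F y) (F y') →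
      Expand F c (min κ₁ (min κ₂ (min κ₄ (min κ₆ κ₇)))) k α β := by
    rintro y y' hyy hy hy' htrans hs
    have hya : a < F y := by obtain ⟨z, hz, rfl⟩ := hy; exact hmem z hz
    have hya' : a < F y' := by obtain ⟨z, hz, rfl⟩ := hy'; exact hmem z hz
    rcases hQs with hr | hl
    · have hyr : y ∈ Ioo L.r₁ L.r₂ := by obtain ⟨z, hz, rfl⟩ := hy; exact hr z hz
      have hyr' : y' ∈ Ioo L.r₁ L.r₂ := by obtain ⟨z, hz, rfl⟩ := hy'; exact hr z hz
      have hcr : c < L.r₁ := L.lt_t.trans_le L.le_r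
      rcases lt_or_ge (y - c) (y' - y) with hlen | hlen
      · exact (hb1 (hwell L y y' hyy (Or.inl ⟨hyr, hyr', hlen⟩))).mono hκ4 hαβ
      · refine (hb2 c n₂ hn₂' (fun hcc => hcc.1.false) (fun z hz => hNa z ⟨hn₁'.trans hz.1, hz.2⟩)
          (fun z hz => ⟨hcr.trans (hr z hz).1, hlt₂ _ (hmem z hz)⟩) (htrans _ _ _ ?_)).mono hκ67 hαβ
        have hFle : F y' ≤ F y := h.anti.antitoneOn (hcr.trans hyr.1).le (hcr.trans hyr'.1).le hyy
        have h1 := hgap y y' n₂ ⟨by linarith [hyr.1], by linarith [hlt₂ y hya]⟩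
          ⟨by linarith [hyr'.1], by linarith [hlt₂ y' hya']⟩ ⟨by linarith, hn5⟩
          (Or.inl ⟨(hcr.trans hyr.1).le, hyy, (hlt₂ y' hya').le⟩) (by
            have := hs.2.1
            rw [abs_of_nonneg (by linarith), abs_of_pos (by linarith)] at this
            rwa [hF₂])
        have h2 : min 1 κ₅ * |y - y'| ≤ n₂ - y' := by
          rw [abs_of_pos (by linarith [hlt₂ y' hya'] : 0 < n₂ - y')] at h1
          refine le_trans ?_ h1
          rw [abs_sub_comm]
          exact mul_le_mul_of_nonneg_right (min_le_right _ _) (abs_nonneg _)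
        have h3 : min 1 κ₅ * |y - y'| ≤ y - c := by
          refine le_trans ?_ hlen
          rw [abs_sub_comm, abs_of_nonneg (by linarith : 0 ≤ y' - y)]
          exact mul_le_of_le_one_left (by linarith) (min_le_left _ _)
        exact ⟨h3.trans (le_abs_self _), (h3.trans (by linarith)).trans (le_abs_self _),
          (h2.trans (by linarith)).trans (le_abs_self _), h2.trans (le_abs_self _)⟩
    · have hyl : y ∈ Ioo L.l₁ L.l₂ := by obtain ⟨z, hz, rfl⟩ := hy; exact hl z hz
      have hyl' : y' ∈ Ioo L.l₁ L.l₂ := by obtain ⟨z, hz, rfl⟩ := hy'; exact hl z hz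
      have hcl : L.l₂ < c := L.l_le.trans_lt L.t_lt
      rcases lt_or_ge (c - y') (y' - y) with hlen | hlen
      · exact (hb1 (hwell L y y' hyy (Or.inr ⟨hyl, hyl', hlen⟩))).mono hκ4 hαβ
      · refine (hb2 n₁ c hn₁' (fun hcc => hcc.2.false) (fun z hz => hNa z ⟨hz.1, hz.2.trans hn₂'⟩)
          (fun z hz => ⟨hlt₁ _ (hmem z hz), (hl z hz).2.trans hcl⟩) (htrans _ _ _ ?_)).mono hκ67 hαβ
        have hFle : F y ≤ F y' := h.mono.monotoneOn (hyl.2.trans hcl).le (hyl'.2.trans hcl).le hyy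
        have h1 := hgap y' y n₁ ⟨by linarith [hlt₁ y' hya'], by linarith [hyl'.2]⟩
          ⟨by linarith [hlt₁ y hya], by linarith [hyl.2]⟩ ⟨hn4, by linarith⟩
          (Or.inr ⟨(hlt₁ y hya).le, hyy, (hyl'.2.trans hcl).le⟩) (by
            have := hs.1
            rw [abs_sub_comm, abs_of_nonneg (by linarith), abs_of_pos (by linarith)] at this
            rwa [hF₁])
        have h2 : min 1 κ₅ * |y - y'| ≤ y - n₁ := by
          rw [abs_sub_comm n₁, abs_of_pos (by linarith [hlt₁ y hya] : 0 < y - n₁)] at h1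
          exact le_trans (mul_le_mul_of_nonneg_right (min_le_right _ _) (abs_nonneg _)) h1
        have h3 : min 1 κ₅ * |y - y'| ≤ c - y' := by
          refine le_trans ?_ hlen
          rw [abs_sub_comm, abs_of_nonneg (by linarith : 0 ≤ y' - y)]
          exact mul_le_of_le_one_left (by linarith) (min_le_left _ _)
        exact ⟨h2.trans (le_abs_self _), (h2.trans (by linarith)).trans (le_abs_self _),
          (h3.trans (by linarith)).trans (le_abs_self _), h3.trans (le_abs_self _)⟩
  rcases le_total (F^[u] α) (F^[u] β) with hle | hle
  · exact hfin _ _ hle ⟨α, hα, rfl⟩ ⟨β, hβ, rfl⟩ (fun _ _ _ => id) hspu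
  · exact hfin _ _ hle ⟨β, hβ, rfl⟩ ⟨α, hα, rfl⟩ (fun _ _ _ hh => hh.swap) hspu.swap

end Level

/-- A nested sequence of levels whose nice intervals shrink to the turning point. -/
structure Tower (F : ℝ → ℝ) (c : ℝ) (L : ℕ → Level F c) : Prop where
  nest : ∀ n, Icc (L (n + 1)).a (L (n + 1)).b ⊆ Ioo (L n).t₁ (L n).t₂
  len : Tendsto (fun n => (L n).b - (L n).a) atTop (𝓝 0)

namespace Tower

variable {F : ℝ → ℝ} {c : ℝ} {L : ℕ → Level F c}

section
variable (W : Tower F c L) (h : ProperUnimodal F c)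
include W h

lemma reach (n : ℕ) : (L n).Reach :=
  (L n).reach_of_subset (L (n + 1)) h ((W.nest n).trans (L n).t_sub)

lemma dvd_of_mem {n M : ℕ} (hM : F^[M] c ∈ Ioo (L (n + 1)).a (L (n + 1)).b) : (L n).N ∣ M :=
  Nat.dvd_of_mod_eq_zero (((L n).phase_t_iff h (W.reach h n) ((L n).orbit_mem_phase M)).1
    (W.nest n (Ioo_subset_Icc_self hM)))

lemma dvd_N (n : ℕ) : (L n).N ∣ (L (n + 1)).N :=
  W.dvd_of_mem h ((L (n + 1)).t_sub ((L (n + 1)).orbit_zero (Nat.mod_self _)))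

lemma two_mul_le (n : ℕ) : 2 * (L n).N ≤ (L (n + 1)).N := by
  obtain ⟨k, hk⟩ := W.dvd_N h n
  obtain ⟨i, hi⟩ := W.dvd_of_mem h ((L (n + 1)).q_sub ((L (n + 1)).orbit_r
    (Nat.mod_eq_of_lt (L (n + 1)).r_lt_N)))
  have h1 := (L (n + 1)).r_lt_N
  have h2 := (L (n + 1)).r_pos
  have h3 : 1 ≤ i := Nat.one_le_iff_ne_zero.2 fun h0 => by rw [h0] at hi; omega
  have h4 : i < k := by
    rw [hk, hi] at h1
    exact lt_of_mul_lt_mul_left h1 (Nat.zero_le _)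
  rw [hk, mul_comm]
  exact Nat.mul_le_mul_left _ (by omega)

lemma lt_N (n : ℕ) : n < (L n).N := by
  induction n with
  | zero => exact (L 0).N_pos
  | succ n ih => have := W.two_mul_le h n; omega

lemma phase_succ (n j : ℕ) : (L (n + 1)).phase j ⊆ (L n).phase j := by
  apply closure_mono
  rintro _ ⟨M, hM, rfl⟩
  exact ⟨M, Nat.ModEq.of_dvd (W.dvd_N h n) hM, rfl⟩

lemma entry_late {x y : ℝ} (hxy : x < y) (m : ℕ) : ∀ᶠ n in atTop, ∀ k e₁ e₂,
    Entry F (L n).a (L n).b k e₁ e₂ → x ∈ Ioo e₁ e₂ → y ∈ Ioo e₁ e₂ → m ≤ k := by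
  induction m with
  | zero => exact Eventually.of_forall fun _ _ _ _ _ _ _ => Nat.zero_le _
  | succ m ih =>
    by_cases hne : F^[m] x = F^[m] y
    · filter_upwards [ih] with n hn k e₁ e₂ E hx hy
      have h1 := hn k e₁ e₂ E hx hy
      refine absurd (h.inj_iter hxy (m := m) (fun v hv z hz => ?_) ⟨le_rfl, hxy.le⟩
        ⟨hxy.le, le_rfl⟩ hne) hxy.ne
      exact E.noTurn (L n).nice.mem v (by omega) z ⟨hx.1.trans hz.1, hz.2.trans hy.2⟩
    · have hpos : 0 < |F^[m] x - F^[m] y| := abs_pos.2 (sub_ne_zero.2 hne)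
      filter_upwards [ih, W.len.eventually (gt_mem_nhds hpos)] with n hn hlt k e₁ e₂ E hx hy
      have h1 := hn k e₁ e₂ E hx hy
      refine Nat.succ_le_of_lt (lt_of_le_of_ne h1 ?_)
      rintro rfl
      have h2 := E.into hx
      have h3 := E.into hy
      exact hlt.not_gt (abs_lt.2 ⟨by linarith [h2.1, h3.2], by linarith [h2.2, h3.1]⟩)

/-- Images of an interval whose orbit avoids the turning point are pairwise disjoint. -/
lemma disjoint_images {α β x : ℝ} (hav : ∀ m, ∀ z ∈ Icc α β, F^[m] z ≠ c)
    (hxX : x ∈ orbitClosure F c) (hx01 : x ∈ Icc (0:ℝ) 1) (hxJ : x ∈ Icc α β) (m : ℕ) {d : ℕ}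
    (hd : 1 ≤ d) : Disjoint (F^[m] '' Icc α β) (F^[m + d] '' Icc α β) := by
  by_contra hcon
  obtain ⟨_, ⟨u₀, hu₀, rfl⟩, ⟨v₀, hv₀, huv₀⟩⟩ := not_disjoint_iff.1 hcon
  set K : Set ℝ := ⋃ i : ℕ, F^[m + d * i] '' Icc α β with hK
  have hKc : K.OrdConnected := by
    refine (IsPreconnected.iUnion_of_chain (fun i => isPreconnected_Icc.image _
      (h.iter_cont _).continuousOn) fun i => ?_).ordConnected
    refine ⟨F^[d * i] (F^[m] u₀), ⟨u₀, hu₀, ?_⟩, ⟨v₀, hv₀, ?_⟩⟩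
    · rw [add_comm, iterate_add_apply]
    · rw [← huv₀, ← iterate_add_apply]; congr 1; rw [Order.succ_eq_add_one]; ring
  have hKav : ∀ n, ∀ z ∈ K, F^[n] z ≠ c := by
    intro n z hz
    obtain ⟨i, w, hw, rfl⟩ := mem_iUnion.1 hz
    rw [← iterate_add_apply]
    exact hav _ w hw
  have hKmap : ∀ z ∈ K, F^[d] z ∈ K := by
    intro z hz
    obtain ⟨i, w, hw, rfl⟩ := mem_iUnion.1 hz
    refine mem_iUnion.2 ⟨i + 1, w, hw, ?_⟩
    rw [← iterate_add_apply]; congr 1; ring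
  have hstrict : ∀ u ∈ K, ∀ v ∈ K, u < v → ∀ n, NoTurn F c n u v := fun u hu v hv _ n i _ z hz =>
    hKav i z (hKc.out hu hv (Ioo_subset_Icc_self hz))
  have hmon : StrictMonoOn F^[d] K ∨ StrictAntiOn F^[d] K := by
    by_contra! hno
    obtain ⟨h1, h2⟩ := hno
    simp only [StrictMonoOn, StrictAntiOn, not_forall, not_lt] at h1 h2
    obtain ⟨p, hp, p', hp', hpp, h1⟩ := h1
    obtain ⟨q, hq, q', hq', hqq, h2⟩ := h2
    have hlo : min p q ∈ K := by rcases min_choice p q with e | e <;> rw [e] <;> assumption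
    have hhi : max p' q' ∈ K := by rcases max_choice p' q' with e | e <;> rw [e] <;> assumption
    have hlt : min p q < max p' q' := (min_le_left _ _).trans_lt (hpp.trans_le (le_max_left _ _))
    have m1 : p ∈ Icc (min p q) (max p' q') := ⟨min_le_left _ _, hpp.le.trans (le_max_left _ _)⟩
    have m2 : p' ∈ Icc (min p q) (max p' q') := ⟨(min_le_left _ _).trans hpp.le, le_max_left _ _⟩
    have m3 : q ∈ Icc (min p q) (max p' q') := ⟨min_le_right _ _, hqq.le.trans (le_max_right _ _)⟩
    have m4 : q' ∈ Icc (min p q) (max p' q') := ⟨(min_le_right _ _).trans hqq.le, le_max_right _ _⟩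
    rcases h.strict_iter hlt (hstrict _ hlo _ hhi hlt d) with h3 | h3
    · exact h1.not_gt (h3 m1 m2 hpp)
    · exact h2.not_gt (h3 m3 m4 hqq)
  obtain ⟨G, hG⟩ : ∃ G, G = F^[d + d] := ⟨_, rfl⟩
  have hGmap : ∀ z ∈ K, G z ∈ K := by
    intro z hz
    rw [hG, iterate_add_apply]
    exact hKmap _ (hKmap z hz)
  have hGmon : MonotoneOn G K := by
    intro u hu v hv huv
    rw [hG, iterate_add_apply, iterate_add_apply]
    rcases hmon with h1 | h1
    · exact h1.monotoneOn (hKmap u hu) (hKmap v hv) (h1.monotoneOn hu hv huv)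
    · exact h1.antitoneOn (hKmap v hv) (hKmap u hu) (h1.antitoneOn hu hv huv)
  obtain ⟨w, hw⟩ : ∃ w, w = F^[m] x := ⟨_, rfl⟩
  have hwK : w ∈ K := mem_iUnion.2 ⟨0, x, hxJ, by rw [hw]; rfl⟩
  have hwi : ∀ i, G^[i] w ∈ K := by
    intro i
    induction i with
    | zero => exact hwK
    | succ i ih => rw [iterate_succ_apply']; exact hGmap _ ih
  have hGi : ∀ i, G^[i] w = F^[(d + d) * i + m] x := fun i => by
    rw [hG, hw, ← iterate_mul, ← iterate_add_apply]
  have h01 : ∀ i, G^[i] w ∈ Icc (0:ℝ) 1 := fun i => by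
    rw [hGi]; exact h.maps_iter hx01 _
  have hlim : ∃ p, Tendsto (fun i => G^[i] w) atTop (𝓝 p) := by
    rcases le_total w (G w) with hle | hle
    · have hmono : Monotone fun i => G^[i] w := by
        refine monotone_nat_of_le_succ fun i => ?_
        induction i with
        | zero => exact hle
        | succ i ih =>
          have := hGmon (hwi i) (hwi (i + 1)) ih
          rwa [← iterate_succ_apply' G, ← iterate_succ_apply' G] at this
      exact ⟨_, tendsto_atTop_ciSup hmono ⟨1, by rintro _ ⟨i, rfl⟩; exact (h01 i).2⟩⟩
    · have hmono : Antitone fun i => G^[i] w := by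
        refine antitone_nat_of_succ_le fun i => ?_
        induction i with
        | zero => exact hle
        | succ i ih =>
          have := hGmon (hwi (i + 1)) (hwi i) ih
          rwa [← iterate_succ_apply' G, ← iterate_succ_apply' G] at this
      exact ⟨_, tendsto_atTop_ciInf hmono ⟨0, by rintro _ ⟨i, rfl⟩; exact (h01 i).1⟩⟩
  obtain ⟨p, hp⟩ := hlim
  have hfix : G p = p :=
    isFixedPt_of_tendsto_iterate hp (by rw [hG]; exact (h.iter_cont _).continuousAt)
  have hpX : p ∈ orbitClosure F c := by
    refine isClosed_closure.mem_of_tendsto hp (Eventually.of_forall fun i => ?_)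
    show G^[i] w ∈ orbitClosure F c
    rw [hGi]
    exact Level.map_orbitClosure h hxX _
  obtain ⟨j, -, hj⟩ := (L (d + d)).exists_phase hpX
  have h1 := (L (d + d)).phase_map h hj (d + d)
  rw [← hG, hfix] at h1
  have h2 := (L (d + d)).phase_unique h (W.reach h _) hj h1
  have h3 := eq_of_add_mod_eq (A := j) (s := 0) (t := d + d) (Nat.zero_le _)
    (by rw [zero_add]; exact W.lt_N h _) (by rwa [add_zero])
  omega

lemma tame {α β x : ℝ} (hαβ : α < β) (hav : ∀ m, ∀ z ∈ Icc α β, F^[m] z ≠ c)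
    (hxX : x ∈ orbitClosure F c) (hx01 : x ∈ Icc (0:ℝ) 1) (hxJ : x ∈ Icc α β) (n : ℕ) :
    (L n).Tame α β := by
  refine ⟨hαβ, hav, ?_⟩
  intro z hz m₀
  by_contra! hno
  obtain ⟨j, hj, hxj⟩ := (L n).exists_phase hxX
  have ht₁ : (L n).a < (L n).t₁ := (L n).a_le.trans_lt ((L n).l_lt.trans_le (L n).l_le)
  have ht₂ : (L n).t₂ < (L n).b := (L n).le_r.trans_lt ((L n).r_lt.trans_le (L n).le_b)
  obtain ⟨δ, hδ⟩ : ∃ δ, δ = min ((L n).t₁ - (L n).a) ((L n).b - (L n).t₂) := ⟨_, rfl⟩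
  have hδ0 : 0 < δ := by rw [hδ]; exact lt_min (by linarith) (by linarith)
  have hδ1 : δ ≤ (L n).t₁ - (L n).a := by rw [hδ]; exact min_le_left _ _
  have hδ2 : δ ≤ (L n).b - (L n).t₂ := by rw [hδ]; exact min_le_right _ _
  obtain ⟨g, hg⟩ : ∃ g : ℕ → ℕ, ∀ i, g i = (L n).N * (m₀ + 1 + i) - j := ⟨_, fun _ => rfl⟩
  have hgj : ∀ i, j + g i = (L n).N * (m₀ + 1 + i) := by
    intro i
    have : (L n).N * 1 ≤ (L n).N * (m₀ + 1 + i) := Nat.mul_le_mul_left _ (by omega)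
    rw [hg]; omega
  have hgm : ∀ i, m₀ ≤ g i := by
    intro i
    have h1 := hgj i
    have h2 : (L n).N * (m₀ + 1) ≤ (L n).N * (m₀ + 1 + i) := Nat.mul_le_mul_left _ (by omega)
    have h3 : 1 * m₀ ≤ (L n).N * m₀ := Nat.mul_le_mul_right _ (L n).N_pos
    rw [mul_add, mul_one] at h2
    omega
  have hginj : Injective g := by
    intro i i' he
    have h1 := hgj i
    rw [he, hgj i'] at h1
    have := Nat.eq_of_mul_eq_mul_left (L n).N_pos h1
    omega
  have hfar : ∀ i, δ ≤ |F^[g i] z - F^[g i] x| := by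
    intro i
    have h1 : F^[g i] x ∈ Ioo (L n).t₁ (L n).t₂ := ((L n).phase_t_iff h (W.reach h n)
      ((L n).phase_map h hxj _)).2 (by rw [hgj]; exact Nat.mul_mod_right _ _)
    by_contra! hlt
    rw [abs_lt] at hlt
    exact hno _ (hgm i) ⟨by linarith [h1.1, hlt.1], by linarith [h1.2, hlt.2]⟩
  have hfin : ((Icc (0:ℤ) ⌊1 / δ⌋) ×ˢ (univ : Set Bool)).Finite :=
    (finite_Icc _ _).prod finite_univ
  obtain ⟨i, -, i', -, hne, heq⟩ := (infinite_univ (α := ℕ)).exists_ne_map_eq_of_mapsTo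
    (f := fun i => (⌊F^[g i] x / δ⌋, decide (F^[g i] x ≤ F^[g i] z)))
    (t := (Icc (0:ℤ) ⌊1 / δ⌋) ×ˢ (univ : Set Bool)) (fun i _ => by
      have h1 := h.maps_iter hx01 (g i)
      exact ⟨⟨Int.floor_nonneg.2 (div_nonneg h1.1 hδ0.le),
        Int.floor_le_floor (div_le_div_of_nonneg_right h1.2 hδ0.le)⟩, mem_univ _⟩) hfin
  simp only [Prod.mk.injEq, decide_eq_decide] at heq
  obtain ⟨hfl, hside⟩ := heq
  have hclose : |F^[g i] x - F^[g i'] x| < δ := by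
    have := Int.abs_sub_lt_one_of_floor_eq_floor hfl
    rw [← sub_div, abs_div, abs_of_pos hδ0, div_lt_one hδ0] at this
    exact this
  rw [abs_lt] at hclose
  have hoc : ∀ m, (F^[m] '' Icc α β).OrdConnected := fun m =>
    (isPreconnected_Icc.image _ (h.iter_cont m).continuousOn).ordConnected
  have hx_in : ∀ m, F^[m] x ∈ F^[m] '' Icc α β := fun m => ⟨x, hxJ, rfl⟩
  have hz_in : ∀ m, F^[m] z ∈ F^[m] '' Icc α β := fun m => ⟨z, hz, rfl⟩
  have hmeet : ¬Disjoint (F^[g i] '' Icc α β) (F^[g i'] '' Icc α β) := by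
    have f1 := hfar i
    have f2 := hfar i'
    rw [not_disjoint_iff]
    by_cases hs : F^[g i] x ≤ F^[g i] z
    · have hs' := hside.1 hs
      rw [abs_of_nonneg (by linarith)] at f1 f2
      refine ⟨max (F^[g i] x) (F^[g i'] x), (hoc _).out (hx_in _) (hz_in _) ⟨le_max_left _ _,
        max_le hs (by linarith)⟩, (hoc _).out (hx_in _) (hz_in _) ⟨le_max_right _ _,
        max_le (by linarith) hs'⟩⟩
    · have hs' : ¬F^[g i'] x ≤ F^[g i'] z := fun h => hs (hside.2 h)
      rw [not_le] at hs hs'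
      rw [abs_of_neg (by linarith)] at f1 f2
      refine ⟨min (F^[g i] x) (F^[g i'] x), (hoc _).out (hz_in _) (hx_in _) ⟨
        le_min hs.le (by linarith), min_le_left _ _⟩, (hoc _).out (hz_in _) (hx_in _) ⟨
        le_min (by linarith) hs'.le, min_le_right _ _⟩⟩
  rcases lt_or_gt_of_ne (hginj.ne hne) with hlt | hlt
  · refine hmeet ?_
    have := W.disjoint_images h hav hxX hx01 hxJ (g i) (d := g i' - g i) (by omega)
    rwa [Nat.add_sub_cancel' hlt.le] at this
  · refine hmeet (Disjoint.symm ?_)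
    have := W.disjoint_images h hav hxX hx01 hxJ (g i') (d := g i - g i') (by omega)
    rwa [Nat.add_sub_cancel' hlt.le] at this

omit W in
lemma orbitClosure_sub {x : ℝ} (hx : x ∈ orbitClosure F c) : x ∈ Icc (0:ℝ) 1 := by
  refine closure_minimal (t := Icc (0:ℝ) 1) ?_ isClosed_Icc hx
  rintro _ ⟨n, rfl⟩
  exact h.maps_iter (Ioo_subset_Icc_self h.c_mem) n

lemma not_lt_of_phase {C q A₁ A₂ : ℝ} (D : Distortion F c C q A₁ A₂) {x y : ℝ}
    (hph : ∀ n, ∃ j, x ∈ (L n).phase j ∧ y ∈ (L n).phase j) : ¬x < y := by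
  intro hxy
  have hxX : x ∈ orbitClosure F c := by obtain ⟨j, hx, -⟩ := hph 0; exact (L 0).phase_sub j hx
  have hx01 := orbitClosure_sub h hxX
  have hent : ∀ n, ∃ k e₁ e₂, Entry F (L n).a (L n).b k e₁ e₂ ∧ x ∈ Ioo e₁ e₂ ∧ y ∈ Ioo e₁ e₂ := by
    intro n
    obtain ⟨j, hx, hy⟩ := hph n
    obtain ⟨k, e₁, e₂, -, E, hsub⟩ := (L n).phase_entry h (W.reach h n) j
    exact ⟨k, e₁, e₂, E, hsub hx, hsub hy⟩
  obtain ⟨κ, hκ, hexp⟩ := Level.exists_expand h D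
  obtain ⟨S, hS⟩ : ∃ S : Set ℝ, S = {α | α ≤ x ∧ ∀ m, ∀ z ∈ Icc α y, F^[m] z ≠ c} := ⟨_, rfl⟩
  have hxS : x ∈ S := by
    rw [hS]
    refine ⟨le_rfl, fun m z hz => ?_⟩
    obtain ⟨n, hn⟩ := (W.entry_late h hxy (m + 1)).exists
    obtain ⟨k, e₁, e₂, E, hx, hy⟩ := hent n
    exact E.noTurn (L n).nice.mem m (hn k e₁ e₂ E hx hy) z ⟨hx.1.trans_le hz.1, hz.2.trans_lt hy.2⟩
  have htame : ∀ α ∈ S, ∀ n, (L n).Tame α y := by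
    intro α hα n
    rw [hS] at hα
    exact W.tame h (hα.1.trans_lt hxy) hα.2 hxX hx01 ⟨hα.1, hxy.le⟩ n
  have hbd : BddBelow S := ⟨-1, fun α hα => by
    have h1 := htame α hα 0
    exact (h1.bounded h 0 α ⟨le_rfl, h1.lt.le⟩).1.le⟩
  have hpos : 0 < κ / 2 * (y - x) := by have := sub_pos.2 hxy; positivity
  obtain ⟨α, hα, hαlt⟩ := exists_lt_of_csInf_lt ⟨x, hxS⟩ (lt_add_of_pos_right (sInf S) hpos)
  have hαx : α ≤ x := by rw [hS] at hα; exact hα.1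
  have hmem : α - κ / 2 * (y - x) ∈ S := by
    rw [hS]
    refine ⟨by linarith, fun m z hz => ?_⟩
    obtain ⟨n, hn⟩ := (W.entry_late h hxy (m + 1)).exists
    obtain ⟨k, e₁, e₂, E, hx, hy⟩ := hent n
    obtain ⟨m', a, d, hkm, hnt, h1, h2⟩ := hexp (L n) (W.reach h n) α y (htame α hα n) x hxX
      ⟨hαx, hxy.le⟩ k (E.into hx) fun t ht => E.before t ht x hx
    have h3 := hn k e₁ e₂ E hx hy
    have h4 : κ / 2 * (y - x) < κ * (y - α) := by nlinarith
    have h5 : 0 < κ * (y - α) := hpos.trans h4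
    exact hnt m (by omega) z ⟨by linarith [hz.1], by linarith [hz.2]⟩
  have := csInf_le hbd hmem
  linarith

/-- The phases at all levels determine a point of the critical orbit closure. -/
lemma eq_of_phase {C q A₁ A₂ : ℝ} (D : Distortion F c C q A₁ A₂) {x y : ℝ}
    (hph : ∀ n, ∃ j, x ∈ (L n).phase j ∧ y ∈ (L n).phase j) : x = y :=
  le_antisymm (not_lt.1 (W.not_lt_of_phase h D fun n => (hph n).imp fun _ h => h.symm))
    (not_lt.1 (W.not_lt_of_phase h D hph))

end

end Tower

/-- A map whose points are coded injectively and continuously by compatible residues `t n`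
modulo `N n`, on which the map acts by adding one, is conjugate to an adding machine. -/
lemma conjugateToAddingMachine_of_residues {f : ℝ → ℝ} {X : Set ℝ} {N : ℕ → ℕ} {t : ℕ → ℝ → ℕ}
    (hN₀ : 2 ≤ N 0) (hdvd : ∀ n, N n ∣ N (n + 1)) (hgrow : ∀ n, 2 * N n ≤ N (n + 1))
    (hlt : ∀ n x, t n x < N n) (hcompat : ∀ n, ∀ x ∈ X, t (n + 1) x % N n = t n x)
    (hstep : ∀ n, ∀ x ∈ X, t n (f x) = (t n x + 1) % N n)
    (hcont : ∀ n, ContinuousOn (t n) X)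
    (hinj : ∀ x ∈ X, ∀ y ∈ X, (∀ n, t n x = t n y) → x = y)
    (hsurj : ∀ τ : ℕ → ℕ, (∀ n, τ n < N n) → (∀ n, τ (n + 1) % N n = τ n) →
      ∃ x ∈ X, ∀ n, t n x = τ n) : ConjugateToAddingMachine f X := by
  obtain ⟨M, hM0, hMs⟩ : ∃ M : ℕ → ℕ, M 0 = 1 ∧ ∀ n, M (n + 1) = N n :=
    ⟨fun n => Nat.casesOn n 1 N, rfl, fun _ => rfl⟩
  have hNpos : ∀ n, 0 < N n := fun n => (Nat.zero_le _).trans_lt (hlt n 0)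
  have hMpos : ∀ n, 0 < M n := by
    rintro (_ | n)
    · rw [hM0]; exact one_pos
    · rw [hMs]; exact hNpos n
  have hMN : ∀ n, M n ∣ N n := by
    rintro (_ | n)
    · rw [hM0]; exact one_dvd _
    · rw [hMs]; exact hdvd n
  obtain ⟨p, hp⟩ : ∃ p : ℕ → ℕ, ∀ n, N n = M n * p n :=
    ⟨fun n => N n / M n, fun n => (Nat.mul_div_cancel' (hMN n)).symm⟩
  have hp2 : ∀ n, 2 ≤ p n := by
    rintro (_ | n)
    · have := hp 0; rw [hM0, one_mul] at this; omega
    · have h1 := hp (n + 1)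
      have h2 := hgrow n
      rw [h1, hMs, mul_comm] at h2
      exact le_of_mul_le_mul_left h2 (hNpos n)
  have hdig : ∀ n x, t n x / M n < p n := fun n x => by
    rw [Nat.div_lt_iff_lt_mul (hMpos n), mul_comm, ← hp]; exact hlt n x
  obtain ⟨φ, hφ⟩ : ∃ φ : ℝ → ∀ i, Fin (p i), ∀ x i, (φ x i : ℕ) = t i x / M i :=
    ⟨fun x i => ⟨t i x / M i, hdig i x⟩, fun _ _ => rfl⟩
  have hsplit : ∀ n x, t n x % M n + M n * φ x n = t n x := fun n x => by
    rw [hφ]; exact Nat.mod_add_div _ _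
  have hmod : ∀ n, ∀ x ∈ X, t (n + 1) x % M (n + 1) = t n x := fun n x hx => by
    rw [hMs]; exact hcompat n x hx
  refine ⟨p, hp2, φ, ?_, ?_, ?_, ?_⟩
  · refine continuousOn_pi.2 fun i => ?_
    intro x hx
    have h1 : ∀ᶠ y in 𝓝[X] x, t i y = t i x :=
      (hcont i x hx).eventually (p := fun k => k = t i x)
        (by rw [nhds_discrete]; exact eventually_pure.2 rfl)
    refine (continuousWithinAt_const (b := φ x i)).congr_of_eventuallyEq ?_ rfl
    filter_upwards [h1] with y hy
    exact Fin.ext (by rw [hφ, hφ, hy])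
  · intro x hx y hy hxy
    refine hinj x hx y hy fun n => ?_
    induction n with
    | zero =>
      rw [← hsplit 0 x, ← hsplit 0 y, hxy, hM0, Nat.mod_one, Nat.mod_one]
    | succ n ih =>
      rw [← hsplit (n + 1) x, ← hsplit (n + 1) y, hxy, hmod n x hx, hmod n y hy, ih]
  · refine eq_univ_of_forall fun y => ?_
    obtain ⟨τ, hτ0, hτs⟩ : ∃ τ : ℕ → ℕ, τ 0 = y 0 ∧ ∀ n, τ (n + 1) = τ n + N n * y (n + 1) :=
      ⟨fun n => Nat.rec (y 0 : ℕ) (fun n s => s + N n * y (n + 1)) n, rfl, fun _ => rfl⟩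
    have hτlt : ∀ n, τ n < N n := by
      intro n
      induction n with
      | zero => rw [hτ0, hp, hM0, one_mul]; exact (y 0).2
      | succ n ih =>
        have h1 : N n * (y (n + 1) + 1) ≤ N n * p (n + 1) := Nat.mul_le_mul_left _ (y (n + 1)).2
        rw [hτs, hp (n + 1), hMs]
        rw [mul_add] at h1
        omega
    have hτmod : ∀ n, τ (n + 1) % N n = τ n := fun n => by
      rw [hτs, Nat.add_mul_mod_self_left, Nat.mod_eq_of_lt (hτlt n)]
    obtain ⟨x, hx, hxt⟩ := hsurj τ hτlt hτmod
    refine ⟨x, hx, funext fun i => Fin.ext ?_⟩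
    rw [hφ, hxt]
    cases i with
    | zero => rw [hM0, hτ0, Nat.div_one]
    | succ i => rw [hMs, hτs, Nat.add_mul_div_left _ _ (hNpos i), Nat.div_eq_of_lt (hτlt i),
        zero_add]
  · intro x hx
    have hfull : ∀ n, t n x % M n + 1 = M n ↔ ∀ i < n, (φ x i : ℕ) + 1 = p i := by
      intro n
      induction n with
      | zero => simp [hM0, Nat.mod_one]
      | succ n ih =>
        have h1 := hsplit n x
        have h2 := Nat.mod_lt (t n x) (hMpos n)
        have h3 := (φ x n).2
        rw [Nat.forall_lt_succ_right, ← ih, hmod n x hx, hMs, hp n]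
        constructor
        · intro h4
          have h5 : (φ x n : ℕ) + 1 = p n := by
            by_contra hne
            have h6 : M n * (φ x n + 1 + 1) ≤ M n * p n := Nat.mul_le_mul_left _ (by omega)
            rw [mul_add, mul_add] at h6
            omega
          rw [← h5, mul_add] at h4
          exact ⟨by omega, h5⟩
        · rintro ⟨h4, h5⟩
          rw [← h5, mul_add]
          omega
    have hkeep : ∀ i, (∃ l < i, (φ x l : ℕ) + 1 < p l) → (φ (f x) i : ℕ) = φ x i := by
      rintro i ⟨l, hli, hl⟩
      have h1 : t i x % M i + 1 ≠ M i := fun h2 => by have := (hfull i).1 h2 l hli; omega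
      have h2 := Nat.mod_lt (t i x) (hMpos i)
      have h3 := hsplit i x
      have h4 : M i * (φ x i + 1) ≤ M i * p i := Nat.mul_le_mul_left _ (φ x i).2
      rw [mul_add] at h4
      have h5 : t i x + 1 = (t i x % M i + 1) + M i * φ x i := by omega
      rw [hφ (f x), hstep i x hx, Nat.mod_eq_of_lt (by rw [hp]; omega), h5,
        Nat.add_mul_div_left _ _ (hMpos i), Nat.div_eq_of_lt (by omega), zero_add]
    have hcarry : ∀ i, (∀ l < i, (φ x l : ℕ) + 1 = p l) → t i x + 1 = M i * (φ x i + 1) := by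
      intro i hi
      have h1 := (hfull i).2 hi
      have h2 := hsplit i x
      rw [mul_add]; omega
    have hzero : ∀ i, (∀ l < i + 1, (φ x l : ℕ) + 1 = p l) → (φ (f x) i : ℕ) = 0 := by
      intro i hi
      rw [hφ, hstep i x hx, hcarry i fun l hl => hi l (by omega), hi i (Nat.lt_succ_self i), ← hp,
        Nat.mod_self, Nat.zero_div]
    have hnot : ∀ l, ¬(φ x l : ℕ) + 1 < p l → (φ x l : ℕ) + 1 = p l := fun l hl => by
      have := (φ x l).2; omega
    funext i
    apply Fin.ext
    unfold addingMachine
    split_ifs with hex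
    · have hspec := Nat.find_spec hex
      have hmin : ∀ l < Nat.find hex, (φ x l : ℕ) + 1 = p l := fun l hl =>
        hnot l (Nat.find_min hex hl)
      rcases lt_trichotomy i (Nat.find hex) with h1 | h1 | h1
      · simp only [h1, if_true]
        exact hzero i fun l hl => hmin l (by omega)
      · have h2 : ¬i < Nat.find hex := by omega
        simp only [h2, if_false, dif_pos h1]
        have h3 := hcarry i fun l hl => hmin l (by omega)
        have h4 : (φ x i : ℕ) + 1 < p i := by rw [h1]; exact hspec
        have h5 : t i x + 1 < N i := by rw [h3, hp]; exact Nat.mul_lt_mul_of_pos_left h4 (hMpos i)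
        rw [hφ (f x), hstep i x hx, Nat.mod_eq_of_lt h5, h3, Nat.mul_div_cancel_left _ (hMpos i)]
      · have h2 : ¬i < Nat.find hex := by omega
        have h3 : ¬i = Nat.find hex := by omega
        simp only [h2, if_false, dif_neg h3]
        exact hkeep i ⟨_, h1, hspec⟩
    · push Not at hex
      exact hzero i fun l _ => hnot l (hex l).not_gt

namespace Tower

variable {F : ℝ → ℝ} {c : ℝ} {L : ℕ → Level F c}

theorem conjugateToAddingMachine (W : Tower F c L) (h : ProperUnimodal F c)
    {C q A₁ A₂ : ℝ} (D : Distortion F c C q A₁ A₂) :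
    ConjugateToAddingMachine F (orbitClosure F c) := by
  have hex : ∀ n x, ∃ j < (L n).N, x ∈ orbitClosure F c → x ∈ (L n).phase j := by
    intro n x
    by_cases hx : x ∈ orbitClosure F c
    · obtain ⟨j, hj, hxj⟩ := (L n).exists_phase hx
      exact ⟨j, hj, fun _ => hxj⟩
    · exact ⟨0, (L n).N_pos, fun hx' => absurd hx' hx⟩
  choose t ht htx using hex
  have huniq : ∀ n j, j < (L n).N → ∀ x ∈ orbitClosure F c, x ∈ (L n).phase j → t n x = j := by
    intro n j hj x hx hxj
    have := (L n).phase_unique h (W.reach h n) (htx n x hx) hxj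
    rwa [Nat.mod_eq_of_lt hj, Nat.mod_eq_of_lt (ht n x)] at this
  have hphase_mod : ∀ n j, (L n).phase (j % (L n).N) = (L n).phase j := fun n j =>
    (L n).phase_congr (Nat.mod_mod _ _)
  refine conjugateToAddingMachine_of_residues (N := fun n => (L n).N) (t := t) (L 0).two_le_N
    (W.dvd_N h) (W.two_mul_le h) ht ?_ ?_ ?_ ?_ ?_
  · intro n x hx
    refine (huniq n _ (Nat.mod_lt _ (L n).N_pos) x hx ?_).symm
    rw [hphase_mod]
    exact W.phase_succ h n _ (htx (n + 1) x hx)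
  · intro n x hx
    refine huniq n _ (Nat.mod_lt _ (L n).N_pos) _ (Level.map_orbitClosure h hx 1) ?_
    rw [hphase_mod]
    exact (L n).phase_map h (htx n x hx) 1
  · intro n x hx
    have hcl : IsClosed (⋃ j ∈ Iio (L n).N \ {t n x}, (L n).phase j) :=
      ((finite_Iio _).subset sdiff_subset).isClosed_biUnion fun j _ => isClosed_closure
    have hnot : x ∉ ⋃ j ∈ Iio (L n).N \ {t n x}, (L n).phase j := by
      simp only [mem_iUnion, not_exists]
      rintro j ⟨hj, hne⟩ hxj
      exact hne (huniq n j hj x hx hxj).symm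
    refine (continuousWithinAt_const (b := t n x)).congr_of_eventuallyEq ?_ rfl
    filter_upwards [self_mem_nhdsWithin, mem_nhdsWithin_of_mem_nhds (hcl.isOpen_compl.mem_nhds hnot)]
      with y hyX hy
    by_contra hne
    exact hy (mem_biUnion (x := t n y) ⟨ht n y, hne⟩ (htx n y hyX))
  · intro x hx y hy hxy
    exact W.eq_of_phase h D fun n => ⟨t n x, htx n x hx, by rw [hxy]; exact htx n y hy⟩
  · intro τ hτ hmod
    have hnest : ∀ n, (L (n + 1)).phase (τ (n + 1)) ⊆ (L n).phase (τ n) := by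
      intro n
      rw [← hmod n, hphase_mod]
      exact W.phase_succ h n _
    obtain ⟨x, hx⟩ := IsCompact.nonempty_iInter_of_sequence_nonempty_isCompact_isClosed
      (fun n => (L n).phase (τ n)) hnest (fun n => ⟨_, (L n).orbit_mem_phase _⟩)
      (isCompact_Icc.of_isClosed_subset isClosed_closure
        fun x hx => orbitClosure_sub h ((L 0).phase_sub _ hx)) fun n => isClosed_closure
    have hxn := mem_iInter.1 hx
    have hxX := (L 0).phase_sub _ (hxn 0)
    exact ⟨x, hxX, fun n => huniq n _ (hτ n) x hxX (hxn n)⟩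

end Tower

lemma crossRatio_neg (a b e d : ℝ) : crossRatio (-a) (-b) (-e) (-d) = crossRatio a b e d := by
  have h : ∀ x y : ℝ, |-x - -y| = |x - y| := fun x y => by rw [← abs_neg]; congr 1; ring
  simp only [crossRatio, h]

/-- The derivative of `x ↦ x ^ ℓ` measured in the hyperbolic-type coordinates that send `d` to
infinity is monotone. -/
lemma rpow_cauchy_slope_mono {ℓ d x y : ℝ} (hℓ : 1 < ℓ) (hx : 0 < x) (hxy : x ≤ y) (hyd : y < d) :
    (ℓ * x ^ (ℓ - 1)) * (d - x) ^ 2 / (d ^ ℓ - x ^ ℓ) ^ 2 ≤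
      (ℓ * y ^ (ℓ - 1)) * (d - y) ^ 2 / (d ^ ℓ - y ^ ℓ) ^ 2 := by
  set m := (ℓ - 1) / 2 with hm
  have hm0 : 0 < m := by rw [hm]; linarith
  have hd : 0 < d := by linarith
  set K : ℝ → ℝ := fun z => d ^ ℓ * z ^ (-m) - z ^ (m + 1) with hK
  have hder : ∀ z, 0 < z → HasDerivAt K (d ^ ℓ * (-m * z ^ (-m - 1)) - (m + 1) * z ^ m) z := by
    intro z hz
    have h1 := (Real.hasDerivAt_rpow_const (x := z) (p := -m) (Or.inl hz.ne')).const_mul (d ^ ℓ)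
    have h2 := Real.hasDerivAt_rpow_const (x := z) (p := m + 1) (Or.inl hz.ne')
    rw [add_sub_cancel_right] at h2
    exact h1.sub h2
  have hder2 : ∀ z, 0 < z → HasDerivAt (fun z => d ^ ℓ * (-m * z ^ (-m - 1)) - (m + 1) * z ^ m)
      (d ^ ℓ * (-m * ((-m - 1) * z ^ (-m - 1 - 1))) - (m + 1) * (m * z ^ (m - 1))) z := by
    intro z hz
    have h1 := ((Real.hasDerivAt_rpow_const (x := z) (p := -m - 1)
      (Or.inl hz.ne')).const_mul (-m)).const_mul (d ^ ℓ)
    have h2 := (Real.hasDerivAt_rpow_const (x := z) (p := m) (Or.inl hz.ne')).const_mul (m + 1)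
    exact h1.sub h2
  have hconv : ConvexOn ℝ (Ioc 0 d) K := by
    refine convexOn_of_hasDerivWithinAt2_nonneg (convex_Ioc 0 d)
      (fun z hz => (hder z hz.1).continuousAt.continuousWithinAt)
      (fun z hz => (hder z (interior_subset hz).1).hasDerivWithinAt)
      (fun z hz => (hder2 z (interior_subset hz).1).hasDerivWithinAt) ?_
    intro z hz
    rw [interior_Ioc] at hz
    have h1 : z ^ (m - 1) = z ^ ℓ * z ^ (-m - 1 - 1) := by
      rw [← Real.rpow_add hz.1]; congr 1; rw [hm]; ring
    have h2 : z ^ ℓ ≤ d ^ ℓ := Real.rpow_le_rpow hz.1.le hz.2.le (by linarith)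
    have h3 : 0 < z ^ (-m - 1 - 1) := Real.rpow_pos_of_pos hz.1 _
    rw [h1]
    have h4 : 0 ≤ m * (m + 1) * z ^ (-m - 1 - 1) * (d ^ ℓ - z ^ ℓ) :=
      mul_nonneg (by positivity) (by linarith)
    linarith
  have hKd : K d = 0 := by
    simp only [hK]
    rw [← Real.rpow_add hd, sub_eq_zero]; congr 1; rw [hm]; ring
  have hKz : ∀ z, 0 < z → z < d → 0 < d ^ ℓ - z ^ ℓ ∧ K z = z ^ (-m) * (d ^ ℓ - z ^ ℓ) := by
    intro z hz hzd
    refine ⟨sub_pos.2 (Real.rpow_lt_rpow hz.le hzd (by linarith)), ?_⟩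
    simp only [hK]
    rw [mul_sub, ← Real.rpow_add hz, mul_comm]; congr 2; rw [hm]; ring
  have hslope : K y / (d - y) ≤ K x / (d - x) := by
    rcases hxy.eq_or_lt with rfl | hlt
    · exact le_rfl
    have h1 := hconv.secant_mono (a := d) (x := x) (y := y) ⟨hd, le_rfl⟩ ⟨hx, by linarith⟩
      ⟨by linarith, hyd.le⟩ (by linarith) (by linarith) hlt.le
    rw [hKd, sub_zero, sub_zero, ← neg_sub d x, ← neg_sub d y, div_neg, div_neg] at h1
    linarith
  have hform : ∀ z, 0 < z → z < d →
      (ℓ * z ^ (ℓ - 1)) * (d - z) ^ 2 / (d ^ ℓ - z ^ ℓ) ^ 2 = ℓ / (K z / (d - z)) ^ 2 := by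
    intro z hz hzd
    obtain ⟨h1, h2⟩ := hKz z hz hzd
    have h3 : z ^ (ℓ - 1) * (z ^ (-m)) ^ 2 = 1 := by
      rw [← Real.rpow_natCast, ← Real.rpow_mul hz.le, ← Real.rpow_add hz,
        show ℓ - 1 + -m * (2 : ℕ) = 0 by rw [hm]; push_cast; ring, Real.rpow_zero]
    have h4 : 0 < z ^ (-m) := Real.rpow_pos_of_pos hz _
    have h5 : 0 < d - z := by linarith
    rw [h2]
    field_simp
    linear_combination h3
  rw [hform x hx (by linarith), hform y (by linarith) hyd]
  have hpos : 0 < K y / (d - y) := by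
    obtain ⟨h1, h2⟩ := hKz y (by linarith) hyd
    rw [h2]
    have := Real.rpow_pos_of_pos (show 0 < y by linarith) (-m)
    have h5 : 0 < d - y := by linarith
    positivity
  gcongr

/-- Power maps with exponent larger than one expand cross-ratios. -/
lemma crossRatio_le_rpow {ℓ a b e d : ℝ} (hℓ : 1 < ℓ) (ha : 0 ≤ a) (hab : a < b) (hbe : b < e)
    (hed : e < d) : crossRatio a b e d ≤ crossRatio (a ^ ℓ) (b ^ ℓ) (e ^ ℓ) (d ^ ℓ) := by
  have hlt : ∀ x y : ℝ, 0 ≤ x → x < y → x ^ ℓ < y ^ ℓ := fun x y hx hxy =>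
    Real.rpow_lt_rpow hx hxy (by linarith)
  have hG : ∀ x, 0 < x → x < d → HasDerivAt (fun z => (d ^ ℓ - z ^ ℓ)⁻¹)
      (ℓ * x ^ (ℓ - 1) / (d ^ ℓ - x ^ ℓ) ^ 2) x := by
    intro x hx hxd
    have h1 := ((Real.hasDerivAt_rpow_const (x := x) (p := ℓ) (Or.inl hx.ne')).const_sub
      (d ^ ℓ)).inv (sub_pos.2 (hlt x d hx.le hxd)).ne'
    rwa [neg_neg] at h1
  have hu : ∀ x, x < d → HasDerivAt (fun z => (d - z)⁻¹) (1 / (d - x) ^ 2) x := by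
    intro x hxd
    have h1 := ((hasDerivAt_id x).const_sub d).inv (sub_pos.2 hxd).ne'
    rwa [neg_neg] at h1
  have hGc : ∀ x, 0 ≤ x → x < d → ContinuousAt (fun z => (d ^ ℓ - z ^ ℓ)⁻¹) x := by
    intro x hx hxd
    exact (continuousAt_const.sub (Real.continuousAt_rpow_const x ℓ (Or.inr (by linarith)))).inv₀
      (sub_pos.2 (hlt x d hx hxd)).ne'
  have hcauchy : ∀ x y, 0 ≤ x → x < y → y < d → ∃ z ∈ Ioo x y,
      (d ^ ℓ - y ^ ℓ)⁻¹ - (d ^ ℓ - x ^ ℓ)⁻¹ =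
        ((d - y)⁻¹ - (d - x)⁻¹) * ((ℓ * z ^ (ℓ - 1)) * (d - z) ^ 2 / (d ^ ℓ - z ^ ℓ) ^ 2) := by
    intro x y hx hxy hyd
    obtain ⟨z, hz, h⟩ := exists_ratio_hasDerivAt_eq_ratio_slope
      (fun z => (d ^ ℓ - z ^ ℓ)⁻¹) (fun x => ℓ * x ^ (ℓ - 1) / (d ^ ℓ - x ^ ℓ) ^ 2) hxy
      (fun z hz => (hGc z (hx.trans hz.1) (hz.2.trans_lt hyd)).continuousWithinAt)
      (fun z hz => hG z (hx.trans_lt hz.1) (hz.2.trans hyd))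
      (fun z => (d - z)⁻¹) (fun x => 1 / (d - x) ^ 2)
      (fun z hz => (hu z (hz.2.trans_lt hyd)).continuousAt.continuousWithinAt)
      (fun z hz => hu z (hz.2.trans hyd))
    refine ⟨z, hz, ?_⟩
    have h5 : 0 < d - z := by linarith [hz.2]
    have h6 : 0 < d ^ ℓ - z ^ ℓ := sub_pos.2 (hlt z d (by linarith [hz.1]) (by linarith [hz.2]))
    rw [mul_one_div] at h
    rw [eq_div_iff (by positivity)] at h
    rw [← h]
    ring
  obtain ⟨ξ, hξ, h1⟩ := hcauchy a b ha hab (by linarith)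
  obtain ⟨η, hη, h2⟩ := hcauchy b e (by linarith) hbe (by linarith)
  have h3 := rpow_cauchy_slope_mono (d := d) hℓ (show 0 < ξ by linarith [hξ.1])
    (show ξ ≤ η by linarith [hξ.2, hη.1]) (by linarith [hη.2])
  set s₁ := (ℓ * ξ ^ (ℓ - 1)) * (d - ξ) ^ 2 / (d ^ ℓ - ξ ^ ℓ) ^ 2
  set s₂ := (ℓ * η ^ (ℓ - 1)) * (d - η) ^ 2 / (d ^ ℓ - η ^ ℓ) ^ 2
  have hratio : ∀ A B E D : ℝ, A < B → B < E → E < D →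
      crossRatio A B E D = ((D - E)⁻¹ - (D - B)⁻¹) / ((D - B)⁻¹ - (D - A)⁻¹) := by
    intro A B E D hAB hBE hED
    have e1 : 0 < B - A := by linarith
    have e2 : 0 < D - E := by linarith
    have e3 : 0 < D - B := by linarith
    have e4 : 0 < D - A := by linarith
    have e5 : (D - B)⁻¹ - (D - A)⁻¹ = (B - A) / ((D - B) * (D - A)) := by field_simp; ring
    have e6 : (D - E)⁻¹ - (D - B)⁻¹ = (E - B) / ((D - E) * (D - B)) := by field_simp; ring
    rw [crossRatio, abs_of_pos e1, abs_of_pos e2, abs_of_pos e4,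
      abs_of_pos (show 0 < E - B by linarith), e5, e6]
    field_simp
  rw [hratio a b e d hab hbe hed, hratio _ _ _ _ (hlt a b ha hab) (hlt b e (by linarith) hbe)
    (hlt e d (by linarith) hed), h1, h2]
  have p1 : 0 < (d - b)⁻¹ - (d - a)⁻¹ :=
    sub_pos.2 (inv_strictAnti₀ (by linarith) (by linarith))
  have p2 : 0 < (d - e)⁻¹ - (d - b)⁻¹ :=
    sub_pos.2 (inv_strictAnti₀ (by linarith) (by linarith))
  have hs : 0 < s₁ := by
    have p3 : 0 < (d ^ ℓ - b ^ ℓ)⁻¹ - (d ^ ℓ - a ^ ℓ)⁻¹ :=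
      sub_pos.2 (inv_strictAnti₀ (sub_pos.2 (hlt b d (by linarith) (by linarith)))
        (by linarith [hlt a b ha hab]))
    rw [h1] at p3
    exact pos_of_mul_pos_right p3 p1.le
  rw [div_le_div_iff₀ p1 (mul_pos p1 hs)]
  nlinarith [mul_nonneg (mul_nonneg p1.le p2.le) (sub_nonneg.2 h3)]

/-- Power maps expand cross-ratios on either side of the origin. -/
lemma crossRatio_le_abs_rpow {ℓ a b e d : ℝ} (hℓ : 1 < ℓ) (hab : a < b) (hbe : b < e)
    (hed : e < d) (h0 : (0:ℝ) ∉ Ioo a d) :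
    crossRatio a b e d ≤ crossRatio (|a| ^ ℓ) (|b| ^ ℓ) (|e| ^ ℓ) (|d| ^ ℓ) := by
  by_cases ha : 0 ≤ a
  · rw [abs_of_nonneg ha, abs_of_nonneg (by linarith : 0 ≤ b), abs_of_nonneg (by linarith : 0 ≤ e),
      abs_of_nonneg (by linarith : 0 ≤ d)]
    exact crossRatio_le_rpow hℓ ha hab hbe hed
  · have hd : d ≤ 0 := not_lt.1 fun h => h0 ⟨not_le.1 ha, h⟩
    rw [abs_of_nonpos (by linarith : a ≤ 0), abs_of_nonpos (by linarith : b ≤ 0),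
      abs_of_nonpos (by linarith : e ≤ 0), abs_of_nonpos hd, ← crossRatio_neg, ← crossRatio_swap,
      ← crossRatio_swap ((-a) ^ ℓ)]
    exact crossRatio_le_rpow hℓ (by linarith) (by linarith) (by linarith) (by linarith)

/-- `g` has derivative bounded away from zero, and Lipschitz, on `S`. -/
structure SlopeBounds (g : ℝ → ℝ) (S : Set ℝ) (m M K : ℝ) : Prop where
  m_pos : 0 < m
  K_nonneg : 0 ≤ K
  ord : S.OrdConnected
  hasDeriv : ∀ x ∈ S, HasDerivAt g (deriv g x) x
  lower : ∀ x ∈ S, m ≤ |deriv g x|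
  upper : ∀ x ∈ S, |deriv g x| ≤ M
  lip : ∀ x ∈ S, ∀ y ∈ S, |deriv g x - deriv g y| ≤ K * |x - y|

namespace SlopeBounds

variable {g : ℝ → ℝ} {S : Set ℝ} {m M K : ℝ}

lemma mvt (h : SlopeBounds g S m M K) {x y : ℝ} (hx : x ∈ S) (hy : y ∈ S) (hxy : x < y) :
    ∃ z ∈ Icc x y, |g y - g x| = |deriv g z| * |y - x| := by
  have hsub : ∀ z ∈ Icc x y, z ∈ S := fun z hz => h.ord.out hx hy hz
  obtain ⟨z, hz, h1⟩ := exists_hasDerivAt_eq_slope g (deriv g) hxy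
    (fun z hz => (h.hasDeriv z (hsub z hz)).continuousAt.continuousWithinAt)
    (fun z hz => h.hasDeriv z (hsub z (Ioo_subset_Icc_self hz)))
  refine ⟨z, Ioo_subset_Icc_self hz, ?_⟩
  rw [h1, ← abs_mul, div_mul_cancel₀ _ (by linarith : y - x ≠ 0)]

lemma dist (h : SlopeBounds g S m M K) {x y : ℝ} (hx : x ∈ S) (hy : y ∈ S) :
    m * |y - x| ≤ |g y - g x| ∧ |g y - g x| ≤ M * |y - x| := by
  have key : ∀ u ∈ S, ∀ v ∈ S, u < v → m * |v - u| ≤ |g v - g u| ∧ |g v - g u| ≤ M * |v - u| := by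
    intro u hu v hv huv
    obtain ⟨z, hz, h1⟩ := h.mvt hu hv huv
    have hzS := h.ord.out hu hv hz
    rw [h1]
    exact ⟨mul_le_mul_of_nonneg_right (h.lower z hzS) (abs_nonneg _),
      mul_le_mul_of_nonneg_right (h.upper z hzS) (abs_nonneg _)⟩
  rcases lt_trichotomy x y with hlt | rfl | hlt
  · exact key x hx y hy hlt
  · simp
  · rw [abs_sub_comm y x, abs_sub_comm (g y)]
    exact key y hy x hx hlt

/-- The cross ratio is distorted by a factor controlled by the size of the interval. -/
lemma cross (h : SlopeBounds g S m M K) {a b e d : ℝ} (ha : a ∈ S) (hd : d ∈ S) (hab : a < b)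
    (hbe : b < e) (hed : e < d) :
    Real.exp (-(2 * (K / m) * |d - a|)) * crossRatio a b e d ≤
        crossRatio (g a) (g b) (g e) (g d) ∧
      Real.exp (-(2 * (K / m) * |d - a|)) * crossRatio (g a) (g b) (g e) (g d) ≤
        crossRatio a b e d := by
  have hm := h.m_pos
  have hS : ∀ z ∈ Icc a d, z ∈ S := fun z hz => h.ord.out ha hd hz
  have hb : b ∈ Icc a d := ⟨hab.le, by linarith⟩
  have he : e ∈ Icc a d := ⟨by linarith, hed.le⟩
  obtain ⟨z₁, hz₁, e₁⟩ := h.mvt (hS b hb) (hS e he) hbe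
  obtain ⟨z₂, hz₂, e₂⟩ := h.mvt ha hd (by linarith)
  obtain ⟨z₃, hz₃, e₃⟩ := h.mvt ha (hS b hb) hab
  obtain ⟨z₄, hz₄, e₄⟩ := h.mvt (hS e he) hd hed
  have hz₁' : z₁ ∈ Icc a d := ⟨by linarith [hz₁.1], by linarith [hz₁.2]⟩
  have hz₃' : z₃ ∈ Icc a d := ⟨hz₃.1, by linarith [hz₃.2]⟩
  have hz₄' : z₄ ∈ Icc a d := ⟨by linarith [hz₄.1], hz₄.2⟩
  set E := Real.exp (K / m * |d - a|) with hE
  have hcomp : ∀ u ∈ Icc a d, ∀ v ∈ Icc a d, |deriv g v| ≤ |deriv g u| * E := by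
    intro u hu v hv
    have h1 := h.lip v (hS v hv) u (hS u hu)
    have h2 : |v - u| ≤ |d - a| := by
      rw [abs_of_pos (by linarith : 0 < d - a), abs_le]
      constructor <;> linarith [hu.1, hu.2, hv.1, hv.2]
    have h3 : |deriv g v| ≤ |deriv g u| + |deriv g v - deriv g u| := by
      have := abs_add_le (deriv g u) (deriv g v - deriv g u)
      rwa [add_sub_cancel] at this
    have h4 : K * |v - u| ≤ |deriv g u| * (K / m * |d - a|) := by
      calc K * |v - u| ≤ K * |d - a| := mul_le_mul_of_nonneg_left h2 h.K_nonneg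
        _ = m * (K / m * |d - a|) := by field_simp
        _ ≤ _ := mul_le_mul_of_nonneg_right (h.lower u (hS u hu))
          (mul_nonneg (div_nonneg h.K_nonneg hm.le) (abs_nonneg _))
    have h5 := mul_le_mul_of_nonneg_left (Real.add_one_le_exp (K / m * |d - a|))
      (abs_nonneg (deriv g u))
    linarith
  have hEE : Real.exp (-(2 * (K / m) * |d - a|)) = (E * E)⁻¹ := by
    rw [hE, ← Real.exp_add, ← Real.exp_neg]; congr 1; ring
  have hEpos : 0 < E := Real.exp_pos _
  have p : ∀ z ∈ Icc a d, 0 < |deriv g z| := fun z hz => hm.trans_le (h.lower z (hS z hz))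
  have p₁ := p z₁ hz₁'
  have p₂ := p z₂ hz₂
  have p₃ := p z₃ hz₃'
  have p₄ := p z₄ hz₄'
  have l₁ : 0 < |e - b| := abs_pos.2 (by linarith)
  have l₂ : 0 < |d - a| := abs_pos.2 (by linarith)
  have l₃ : 0 < |b - a| := abs_pos.2 (by linarith)
  have l₄ : 0 < |d - e| := abs_pos.2 (by linarith)
  have c1 := mul_le_mul (hcomp z₁ hz₁' z₃ hz₃') (hcomp z₂ hz₂ z₄ hz₄') p₄.le (by positivity)
  have c2 := mul_le_mul (hcomp z₃ hz₃' z₁ hz₁') (hcomp z₄ hz₄' z₂ hz₂) p₂.le (by positivity)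
  rw [hEE]
  unfold crossRatio
  rw [e₁, e₂, e₃, e₄]
  have hsplit : |deriv g z₁| * |e - b| * (|deriv g z₂| * |d - a|) /
      (|deriv g z₃| * |b - a| * (|deriv g z₄| * |d - e|)) =
      (|deriv g z₁| * |deriv g z₂| / (|deriv g z₃| * |deriv g z₄|)) *
        (|e - b| * |d - a| / (|b - a| * |d - e|)) := by field_simp
  rw [hsplit]
  set r := |e - b| * |d - a| / (|b - a| * |d - e|)
  have hr : 0 ≤ r := by positivity
  constructor
  · refine mul_le_mul_of_nonneg_right ?_ hr
    rw [inv_le_iff_one_le_mul₀ (by positivity), div_mul_eq_mul_div, one_le_div (by positivity)]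
    linarith
  · rw [← mul_assoc]
    refine mul_le_of_le_one_left hr ?_
    rw [inv_mul_le_iff₀ (by positivity), div_le_iff₀ (by positivity)]
    linarith

lemma cross' (h : SlopeBounds g S m M K) {a b e d : ℝ} (ha : a ∈ S) (hd : d ∈ S)
    (hord : a < b ∧ b < e ∧ e < d ∨ d < e ∧ e < b ∧ b < a) :
    Real.exp (-(2 * (K / m) * |d - a|)) * crossRatio a b e d ≤
        crossRatio (g a) (g b) (g e) (g d) := by
  rcases hord with ⟨h1, h2, h3⟩ | ⟨h1, h2, h3⟩
  · exact (h.cross ha hd h1 h2 h3).1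
  · rw [abs_sub_comm, ← crossRatio_swap a, ← crossRatio_swap (g a)]
    exact (h.cross hd ha h1 h2 h3).1

end SlopeBounds

lemma exists_slopeBounds {g : ℝ → ℝ} {U : Set ℝ} (hU : U ∈ 𝓝 (0:ℝ)) (hg : ContDiffOn ℝ 3 g U)
    (h0 : deriv g 0 ≠ 0) : ∃ r > 0, ∃ m M K, SlopeBounds g (Icc (-r) r) m M K ∧
      ∀ x ∈ Icc (-r) r, 0 < deriv g x * deriv g 0 := by
  have hat : ContDiffAt ℝ 3 g 0 := hg.contDiffAt hU
  have hd1 : ContDiffAt ℝ 1 (deriv g) 0 := by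
    have h1 : ContDiffAt ℝ 2 (fderiv ℝ g) 0 := hat.fderiv_right (by norm_num)
    have h2 : deriv g = fun x => fderiv ℝ g x 1 := by ext x; exact fderiv_apply_one_eq_deriv.symm
    rw [h2]
    exact (h1.clm_apply contDiffAt_const).of_le (by norm_num)
  obtain ⟨K, t, ht, hK⟩ := hd1.exists_lipschitzOnWith
  have hdiff : ∀ᶠ x in 𝓝 (0:ℝ), DifferentiableAt ℝ g x := by
    filter_upwards [(hat.of_le (show (1:WithTop ℕ∞) ≤ 3 by norm_num)).eventually (by simp)] with x hx
    exact hx.differentiableAt (by norm_num)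
  have hpos : 0 < |deriv g 0| := abs_pos.2 h0
  have hc := hd1.continuousAt
  have hlow : ∀ᶠ x in 𝓝 (0:ℝ), |deriv g 0| / 2 < |deriv g x| :=
    hc.abs.eventually_const_lt (by linarith)
  have hup : ∀ᶠ x in 𝓝 (0:ℝ), |deriv g x| < 2 * |deriv g 0| :=
    hc.abs.eventually_lt_const (by linarith)
  have hsg : ∀ᶠ x in 𝓝 (0:ℝ), 0 < deriv g x * deriv g 0 :=
    (hc.mul_const _).eventually_const_lt (mul_self_pos.2 h0)
  obtain ⟨ρ, hρ, hball⟩ := Metric.eventually_nhds_iff_ball.1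
    (hdiff.and (hlow.and (hup.and (hsg.and ht))))
  have hin : ∀ x ∈ Icc (-(ρ / 2)) (ρ / 2), x ∈ Metric.ball (0:ℝ) ρ := by
    intro x hx
    rw [Metric.mem_ball, dist_zero_right, Real.norm_eq_abs, abs_lt]
    constructor <;> linarith [hx.1, hx.2]
  refine ⟨ρ / 2, by positivity, |deriv g 0| / 2, 2 * |deriv g 0|, K, ⟨by positivity, K.2,
    ordConnected_Icc, fun x hx => (hball x (hin x hx)).1.hasDerivAt,
    fun x hx => (hball x (hin x hx)).2.1.le, fun x hx => (hball x (hin x hx)).2.2.1.le,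
    fun x hx y hy => ?_⟩, fun x hx => (hball x (hin x hx)).2.2.2.1⟩
  have := hK.dist_le_mul x (hball x (hin x hx)).2.2.2.2 y (hball y (hin y hy)).2.2.2.2
  simpa [Real.dist_eq] using this

lemma rpow_sub_rpow_bounds {ℓ u v : ℝ} (hℓ : 1 < ℓ) (hu : 0 ≤ u) (huv : u ≤ v) :
    v ^ (ℓ - 1) * (v - u) ≤ v ^ ℓ - u ^ ℓ ∧ v ^ ℓ - u ^ ℓ ≤ ℓ * (v ^ (ℓ - 1) * (v - u)) := by
  have hsplit : ∀ x : ℝ, 0 ≤ x → x ^ ℓ = x ^ (ℓ - 1) * x := fun x hx => by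
    have := Real.rpow_add_of_nonneg hx (by linarith : 0 ≤ ℓ - 1) zero_le_one
    rwa [sub_add_cancel, Real.rpow_one] at this
  have hv : 0 ≤ v := hu.trans huv
  constructor
  · rw [hsplit v hv, hsplit u hu]
    have := mul_le_mul_of_nonneg_right
      (Real.rpow_le_rpow hu huv (by linarith : 0 ≤ ℓ - 1)) hu
    linarith
  · rcases hv.eq_or_lt with rfl | hv
    · obtain rfl : u = 0 := le_antisymm huv hu
      simp
    have h1 := one_add_mul_self_le_rpow_one_add (s := u / v - 1) (p := ℓ)
      (by have := div_nonneg hu hv.le; linarith) hℓ.le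
    rw [add_sub_cancel, Real.div_rpow hu hv.le, le_div_iff₀ (Real.rpow_pos_of_pos hv ℓ)] at h1
    rw [hsplit v hv.le] at h1 ⊢
    have h2 : (1 + ℓ * (u / v - 1)) * (v ^ (ℓ - 1) * v) =
        v ^ (ℓ - 1) * v - ℓ * (v ^ (ℓ - 1) * (v - u)) := by field_simp; ring
    linarith

lemma abs_rpow_sub_bounds {ℓ u v : ℝ} (hℓ : 1 < ℓ) (h : 0 ≤ u ∧ u ≤ v ∨ v ≤ u ∧ u ≤ 0) :
    |v| ^ (ℓ - 1) * |v - u| ≤ |(|u| ^ ℓ - |v| ^ ℓ)| ∧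
      |(|u| ^ ℓ - |v| ^ ℓ)| ≤ ℓ * (|v| ^ (ℓ - 1) * |v - u|) := by
  have h1 : |u| ≤ |v| ∧ |v - u| = |v| - |u| := by
    rcases h with ⟨h0, h1⟩ | ⟨h1, h0⟩
    · rw [abs_of_nonneg h0, abs_of_nonneg (h0.trans h1), abs_of_nonneg (sub_nonneg.2 h1)]
      exact ⟨h1, rfl⟩
    · rw [abs_of_nonpos h0, abs_of_nonpos (h1.trans h0), abs_of_nonpos (sub_nonpos.2 h1)]
      exact ⟨by linarith, by ring⟩
  have h2 := rpow_sub_rpow_bounds hℓ (abs_nonneg u) h1.1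
  have h3 : |(|u| ^ ℓ - |v| ^ ℓ)| = |v| ^ ℓ - |u| ^ ℓ := by
    rw [abs_sub_comm, abs_of_nonneg
      (sub_nonneg.2 (Real.rpow_le_rpow (abs_nonneg u) h1.1 (by linarith)))]
  rw [h3, h1.2]
  exact h2

/-- Local estimates near a non-flat critical point, in an increasing chart. -/
lemma nearCritical_of_pos {F φ ψ : ℝ → ℝ} {c ℓ s : ℝ} (hℓ : 1 < ℓ) (hφ0 : φ 0 = c)
    {U : Set ℝ} (hU : U ∈ 𝓝 (0:ℝ)) (hφ : ContDiffOn ℝ 3 φ U) (hψ : ContDiffOn ℝ 3 ψ U)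
    (hφ' : 0 < deriv φ 0) (hψ' : deriv ψ 0 ≠ 0) (hs : |s| = 1)
    (hrep : ∀ᶠ x in 𝓝 (0:ℝ), F (φ x) = ψ (s * |x| ^ ℓ)) :
    ∃ δ > 0, ∃ A₁ > 0, ∃ A₂ > 0, ∃ C ≥ 0,
      (∀ x ∈ Icc (c - δ) (c + δ), ∀ y ∈ Icc (c - δ) (c + δ), (c ≤ x ∧ x ≤ y ∨ y ≤ x ∧ x ≤ c) →
        A₁ * |y - c| ^ (ℓ - 1) * |y - x| ≤ |F x - F y| ∧
          |F x - F y| ≤ A₂ * |y - c| ^ (ℓ - 1) * |y - x|) ∧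
      (∀ a b e d, c - δ ≤ a → a < b → b < e → e < d → d ≤ c + δ → c ∉ Ioo a d →
        Real.exp (-(C * |d - a|)) * crossRatio a b e d ≤
          crossRatio (F a) (F b) (F e) (F d)) := by
  obtain ⟨r₁, hr₁, m₁, M₁, K₁, H₁, hpos⟩ := exists_slopeBounds hU hφ hφ'.ne'
  obtain ⟨r₂, hr₂, m₂, M₂, K₂, H₂, -⟩ := exists_slopeBounds hU hψ hψ'
  obtain ⟨r₃, hr₃, hball⟩ := Metric.eventually_nhds_iff_ball.1 hrep
  obtain ⟨r, hr, h1, h2, h3, h4⟩ : ∃ r > 0, r ≤ r₁ ∧ r ≤ r₂ ∧ r < r₃ ∧ r ≤ 1 :=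
    ⟨min (min r₁ r₂) (min (r₃ / 2) 1), by positivity, by simp, by simp,
      (min_le_right _ _).trans (min_le_left _ _) |>.trans_lt (by linarith), by simp⟩
  have hm₁ := H₁.m_pos
  have hm₂ := H₂.m_pos
  have hin : ∀ x ∈ Icc (-r) r, x ∈ Icc (-r₁) r₁ := fun x hx =>
    ⟨by linarith [hx.1], by linarith [hx.2]⟩
  have h0 : (0:ℝ) ∈ Icc (-r) r := ⟨by linarith, hr.le⟩
  have habs : ∀ x ∈ Icc (-r) r, |x| ≤ r := fun x hx => abs_le.2 hx
  have hM₁ : 0 < M₁ := hm₁.trans_le ((H₁.lower 0 (hin 0 h0)).trans (H₁.upper 0 (hin 0 h0)))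
  have hM₂ : 0 < M₂ := by
    have : (0:ℝ) ∈ Icc (-r₂) r₂ := ⟨by linarith, hr₂.le⟩
    exact hm₂.trans_le ((H₂.lower 0 this).trans (H₂.upper 0 this))
  have hF : ∀ x ∈ Icc (-r) r, F (φ x) = ψ (s * |x| ^ ℓ) := fun x hx => hball x (by
    rw [Metric.mem_ball, dist_zero_right, Real.norm_eq_abs]; exact (habs x hx).trans_lt h3)
  have hψin : ∀ x ∈ Icc (-r) r, s * |x| ^ ℓ ∈ Icc (-r₂) r₂ := by
    intro x hx
    rw [Set.mem_Icc, ← abs_le, abs_mul, hs, one_mul, abs_of_nonneg (by positivity)]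
    calc |x| ^ ℓ ≤ |x| ^ (1:ℝ) :=
          Real.rpow_le_rpow_of_exponent_ge' (abs_nonneg x) ((habs x hx).trans h4) zero_le_one hℓ.le
      _ = |x| := Real.rpow_one _
      _ ≤ r₂ := (habs x hx).trans h2
  have hmono : StrictMonoOn φ (Icc (-r) r) := by
    refine strictMonoOn_of_deriv_pos (convex_Icc _ _)
      (fun x hx => (H₁.hasDeriv x (hin x hx)).continuousAt.continuousWithinAt) fun x hx => ?_
    exact pos_of_mul_pos_left (hpos x (hin x (interior_subset hx))) hφ'.le
  have hcont : ContinuousOn φ (Icc (-r) r) := fun x hx =>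
    (H₁.hasDeriv x (hin x hx)).continuousAt.continuousWithinAt
  have hrm : r ∈ Icc (-r) r := ⟨by linarith, le_rfl⟩
  have hrm' : -r ∈ Icc (-r) r := ⟨le_rfl, by linarith⟩
  have hd1 : c < φ r := hφ0 ▸ hmono h0 hrm hr
  have hd2 : φ (-r) < c := hφ0 ▸ hmono hrm' h0 (by linarith)
  obtain ⟨δ, hδ, hδ1, hδ2⟩ : ∃ δ > 0, δ ≤ φ r - c ∧ δ ≤ c - φ (-r) :=
    ⟨min (φ r - c) (c - φ (-r)), lt_min (by linarith) (by linarith), min_le_left _ _,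
      min_le_right _ _⟩
  have hsurj : ∀ x ∈ Icc (c - δ) (c + δ), ∃ u ∈ Icc (-r) r, φ u = x := fun x hx =>
    intermediate_value_Icc (by linarith) hcont ⟨by linarith [hx.1], by linarith [hx.2]⟩
  have hsd : ∀ u v, |s * u - s * v| = |u - v| := fun u v => by
    rw [← mul_sub, abs_mul, hs, one_mul]
  refine ⟨δ, hδ, m₂ / (M₁ ^ (ℓ - 1) * M₁), by positivity, M₂ * ℓ / (m₁ ^ (ℓ - 1) * m₁),
    by positivity, (2 * (K₁ / m₁) + 2 * (K₂ / m₂) * ℓ) / m₁, ?_, ?_, ?_⟩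
  · have := H₁.K_nonneg
    have := H₂.K_nonneg
    positivity
  · intro x hx y hy hxy
    obtain ⟨u, hu, rfl⟩ := hsurj x hx
    obtain ⟨v, hv, rfl⟩ := hsurj y hy
    have huv : 0 ≤ u ∧ u ≤ v ∨ v ≤ u ∧ u ≤ 0 := by
      rwa [← hφ0, hmono.le_iff_le h0 hu, hmono.le_iff_le hu hv, hmono.le_iff_le hv hu,
        hmono.le_iff_le hu h0] at hxy
    obtain ⟨b1, b2⟩ := abs_rpow_sub_bounds hℓ huv
    obtain ⟨b3, b4⟩ := H₂.dist (hψin v hv) (hψin u hu)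
    rw [hsd] at b3 b4
    rw [hF u hu, hF v hv]
    obtain ⟨b5, b6⟩ := H₁.dist (hin u hu) (hin v hv)
    obtain ⟨b7, b8⟩ := H₁.dist (hin 0 h0) (hin v hv)
    rw [hφ0, sub_zero] at b7 b8
    have hℓ0 : 0 ≤ ℓ - 1 := by linarith
    have b9 := Real.rpow_le_rpow (by positivity) b7 hℓ0
    have b10 := Real.rpow_le_rpow (by positivity) b8 hℓ0
    rw [Real.mul_rpow hm₁.le (abs_nonneg _)] at b9
    rw [Real.mul_rpow hM₁.le (abs_nonneg _)] at b10
    have c1 := mul_le_mul b10 b6 (abs_nonneg _) (by positivity)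
    have c2 := mul_le_mul b9 b5 (by positivity) (by positivity)
    constructor
    · rw [div_mul_eq_mul_div, div_mul_eq_mul_div, div_le_iff₀ (by positivity)]
      calc m₂ * |φ v - c| ^ (ℓ - 1) * |φ v - φ u|
          ≤ m₂ * (M₁ ^ (ℓ - 1) * |v| ^ (ℓ - 1) * (M₁ * |v - u|)) := by
            rw [mul_assoc]; exact mul_le_mul_of_nonneg_left c1 hm₂.le
        _ = m₂ * (|v| ^ (ℓ - 1) * |v - u|) * (M₁ ^ (ℓ - 1) * M₁) := by ring
        _ ≤ _ := mul_le_mul_of_nonneg_right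
          ((mul_le_mul_of_nonneg_left b1 hm₂.le).trans b3) (by positivity)
    · rw [div_mul_eq_mul_div, div_mul_eq_mul_div, le_div_iff₀ (by positivity)]
      calc _ ≤ M₂ * (ℓ * (|v| ^ (ℓ - 1) * |v - u|)) * (m₁ ^ (ℓ - 1) * m₁) :=
            mul_le_mul_of_nonneg_right
              (b4.trans (mul_le_mul_of_nonneg_left b2 hM₂.le)) (by positivity)
        _ = M₂ * ℓ * (m₁ ^ (ℓ - 1) * |v| ^ (ℓ - 1) * (m₁ * |v - u|)) := by ring
        _ ≤ _ := by
          rw [mul_assoc (M₂ * ℓ) (|φ v - c| ^ (ℓ - 1))]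
          exact mul_le_mul_of_nonneg_left c2 (by positivity)
  · intro a b e d ha hab hbe hed hd hcad
    obtain ⟨a, ha', rfl⟩ := hsurj a ⟨ha, by linarith⟩
    obtain ⟨b, hb', rfl⟩ := hsurj b ⟨by linarith, by linarith⟩
    obtain ⟨e, he', rfl⟩ := hsurj e ⟨by linarith, by linarith⟩
    obtain ⟨d, hd', rfl⟩ := hsurj d ⟨by linarith, hd⟩
    have hab' := (hmono.lt_iff_lt ha' hb').1 hab
    have hbe' := (hmono.lt_iff_lt hb' he').1 hbe
    have hed' := (hmono.lt_iff_lt he' hd').1 hed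
    have h0ad : (0:ℝ) ∉ Ioo a d := fun h => hcad
      ⟨hφ0 ▸ hmono ha' h0 h.1, hφ0 ▸ hmono h0 hd' h.2⟩
    have k1 := (H₁.cross (hin a ha') (hin d hd') hab' hbe' hed').2
    have k2 := crossRatio_le_abs_rpow hℓ hab' hbe' hed' h0ad
    have hs' : s = 1 ∨ s = -1 := by
      rcases abs_choice s with h | h <;> [left; right] <;> linarith
    have k3 : crossRatio (|a| ^ ℓ) (|b| ^ ℓ) (|e| ^ ℓ) (|d| ^ ℓ) =
        crossRatio (s * |a| ^ ℓ) (s * |b| ^ ℓ) (s * |e| ^ ℓ) (s * |d| ^ ℓ) := by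
      simp only [crossRatio, hsd]
    have hlt : ∀ x y : ℝ, |x| < |y| → |x| ^ ℓ < |y| ^ ℓ := fun x y h =>
      Real.rpow_lt_rpow (abs_nonneg x) h (by linarith)
    have hord : (|a| ^ ℓ < |b| ^ ℓ ∧ |b| ^ ℓ < |e| ^ ℓ ∧ |e| ^ ℓ < |d| ^ ℓ) ∨
        (|d| ^ ℓ < |e| ^ ℓ ∧ |e| ^ ℓ < |b| ^ ℓ ∧ |b| ^ ℓ < |a| ^ ℓ) := by
      by_cases h : 0 ≤ a
      · left
        refine ⟨hlt _ _ ?_, hlt _ _ ?_, hlt _ _ ?_⟩ <;>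
          rw [abs_of_nonneg (by linarith), abs_of_nonneg (by linarith)] <;> assumption
      · right
        have hd0 : d ≤ 0 := not_lt.1 fun hd => h0ad ⟨not_le.1 h, hd⟩
        refine ⟨hlt _ _ ?_, hlt _ _ ?_, hlt _ _ ?_⟩ <;>
          rw [abs_of_nonpos (by linarith), abs_of_nonpos (by linarith)] <;> linarith
    have hord' : (s * |a| ^ ℓ < s * |b| ^ ℓ ∧ s * |b| ^ ℓ < s * |e| ^ ℓ ∧
          s * |e| ^ ℓ < s * |d| ^ ℓ) ∨
        (s * |d| ^ ℓ < s * |e| ^ ℓ ∧ s * |e| ^ ℓ < s * |b| ^ ℓ ∧ s * |b| ^ ℓ < s * |a| ^ ℓ) := by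
      rcases hs' with rfl | rfl
      · simpa only [one_mul] using hord
      · simp only [neg_one_mul, neg_lt_neg_iff]
        tauto
    have k4 := H₂.cross' (hψin a ha') (hψin d hd') hord'
    rw [hsd] at k4
    have k5 : |(|d| ^ ℓ - |a| ^ ℓ)| ≤ ℓ * |d - a| := by
      have hle : ∀ x ∈ Icc (-r) r, |x| ^ (ℓ - 1) ≤ 1 := fun x hx =>
        Real.rpow_le_one (abs_nonneg x) ((habs x hx).trans h4) (by linarith)
      by_cases h : 0 ≤ a
      · have := (abs_rpow_sub_bounds (u := a) (v := d) hℓ (Or.inl ⟨h, by linarith⟩)).2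
        rw [abs_sub_comm]
        refine this.trans (mul_le_mul_of_nonneg_left ?_ (by linarith))
        exact mul_le_of_le_one_left (abs_nonneg _) (hle d hd')
      · have hd0 : d ≤ 0 := not_lt.1 fun hd => h0ad ⟨not_le.1 h, hd⟩
        have := (abs_rpow_sub_bounds (u := d) (v := a) hℓ (Or.inr ⟨by linarith, hd0⟩)).2
        refine this.trans (mul_le_mul_of_nonneg_left ?_ (by linarith))
        rw [abs_sub_comm]
        exact mul_le_of_le_one_left (abs_nonneg _) (hle a ha')
    have k6 := (H₁.dist (hin a ha') (hin d hd')).1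
    rw [hF a ha', hF b hb', hF e he', hF d hd']
    refine le_trans ?_ k4
    rw [← k3]
    refine le_trans ?_ (mul_le_mul_of_nonneg_left (k1.trans k2) (Real.exp_pos _).le)
    rw [← mul_assoc, ← Real.exp_add]
    refine mul_le_mul_of_nonneg_right (Real.exp_le_exp.2 ?_) (by unfold crossRatio; positivity)
    have hK₁ := H₁.K_nonneg
    have hK₂ := H₂.K_nonneg
    have k7 : 2 * (K₂ / m₂) * |(|d| ^ ℓ - |a| ^ ℓ)| ≤ 2 * (K₂ / m₂) * (ℓ * |d - a|) :=
      mul_le_mul_of_nonneg_left k5 (by positivity)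
    have k8 : (2 * (K₁ / m₁) + 2 * (K₂ / m₂) * ℓ) * |d - a| ≤
        (2 * (K₁ / m₁) + 2 * (K₂ / m₂) * ℓ) / m₁ * |φ d - φ a| := by
      rw [div_mul_eq_mul_div, le_div_iff₀ hm₁, mul_assoc, mul_comm |d - a|]
      exact mul_le_mul_of_nonneg_left k6 (by positivity)
    linarith

lemma nearCritical {F φ ψ : ℝ → ℝ} {c ℓ s : ℝ} (hℓ : 1 < ℓ) (hφ0 : φ 0 = c)
    {U : Set ℝ} (hU : U ∈ 𝓝 (0:ℝ)) (hφ : ContDiffOn ℝ 3 φ U) (hψ : ContDiffOn ℝ 3 ψ U)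
    (hφ' : deriv φ 0 ≠ 0) (hψ' : deriv ψ 0 ≠ 0) (hs : |s| = 1)
    (hrep : ∀ᶠ x in 𝓝 (0:ℝ), F (φ x) = ψ (s * |x| ^ ℓ)) :
    ∃ δ > 0, ∃ A₁ > 0, ∃ A₂ > 0, ∃ C ≥ 0,
      (∀ x ∈ Icc (c - δ) (c + δ), ∀ y ∈ Icc (c - δ) (c + δ), (c ≤ x ∧ x ≤ y ∨ y ≤ x ∧ x ≤ c) →
        A₁ * |y - c| ^ (ℓ - 1) * |y - x| ≤ |F x - F y| ∧
          |F x - F y| ≤ A₂ * |y - c| ^ (ℓ - 1) * |y - x|) ∧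
      (∀ a b e d, c - δ ≤ a → a < b → b < e → e < d → d ≤ c + δ → c ∉ Ioo a d →
        Real.exp (-(C * |d - a|)) * crossRatio a b e d ≤
          crossRatio (F a) (F b) (F e) (F d)) := by
  rcases lt_or_gt_of_ne hφ' with h | h
  · have ht : Tendsto (fun x : ℝ => -x) (𝓝 0) (𝓝 0) := by
      simpa using (continuous_neg (G := ℝ)).tendsto 0
    have hU' : U ∩ Neg.neg ⁻¹' U ∈ 𝓝 (0:ℝ) := inter_mem hU (ht hU)
    refine nearCritical_of_pos (φ := fun x => φ (-x)) (ψ := ψ) (s := s) hℓ (by simpa using hφ0) hU'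
      (hφ.comp contDiff_neg.contDiffOn fun x hx => hx.2) (hψ.mono inter_subset_left) ?_ hψ' hs ?_
    · rw [deriv_comp_neg, neg_zero]; linarith
    · filter_upwards [ht.eventually hrep] with x hx
      rw [hx, abs_neg]
  · exact nearCritical_of_pos hℓ hφ0 hU hφ hψ h hψ' hs hrep

lemma SlopeBounds.weaken {g : ℝ → ℝ} {S : Set ℝ} {m M K m' M' K' : ℝ} (h : SlopeBounds g S m M K)
    (hm' : 0 < m') (hm : m' ≤ m) (hM : M ≤ M') (hK : K ≤ K') : SlopeBounds g S m' M' K' :=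
  ⟨hm', h.K_nonneg.trans hK, h.ord, h.hasDeriv, fun x hx => hm.trans (h.lower x hx),
    fun x hx => (h.upper x hx).trans hM, fun x hx y hy => (h.lip x hx y hy).trans
      (mul_le_mul_of_nonneg_right hK (abs_nonneg _))⟩

lemma crossRatio_ge_of_bounds {a b e d a' b' e' d' A₁ A₂ P₁ P₂ : ℝ} (hA₁ : 0 < A₁) (hA₂ : 0 < A₂)
    (hP₁ : 0 < P₁) (hP₂ : 0 < P₂) (hab : a' ≠ b') (hed : e' ≠ d') (hab' : a ≠ b) (hed' : e ≠ d)
    (h1 : A₁ * P₁ * |e - b| ≤ |e' - b'|) (h2 : A₁ * P₂ * |d - a| ≤ |d' - a'|)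
    (h3 : |b' - a'| * |d' - e'| ≤ A₂ ^ 2 * (P₁ * P₂) * (|b - a| * |d - e|)) :
    (A₁ / A₂) ^ 2 * crossRatio a b e d ≤ crossRatio a' b' e' d' := by
  have p1 : 0 < |b' - a'| := abs_pos.2 (sub_ne_zero.2 hab.symm)
  have p2 : 0 < |d' - e'| := abs_pos.2 (sub_ne_zero.2 hed.symm)
  have p3 : 0 < |b - a| := abs_pos.2 (sub_ne_zero.2 hab'.symm)
  have p4 : 0 < |d - e| := abs_pos.2 (sub_ne_zero.2 hed'.symm)
  unfold crossRatio
  rw [le_div_iff₀ (by positivity)]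
  calc (A₁ / A₂) ^ 2 * (|e - b| * |d - a| / (|b - a| * |d - e|)) * (|b' - a'| * |d' - e'|)
      ≤ (A₁ / A₂) ^ 2 * (|e - b| * |d - a| / (|b - a| * |d - e|)) *
          (A₂ ^ 2 * (P₁ * P₂) * (|b - a| * |d - e|)) :=
        mul_le_mul_of_nonneg_left h3 (by positivity)
    _ = (A₁ * P₁ * |e - b|) * (A₁ * P₂ * |d - a|) := by field_simp
    _ ≤ _ := mul_le_mul h1 h2 (by positivity) (abs_nonneg _)

/-- Local estimates near the turning point and slope bounds away from it give the distortion
estimates used for unimodal maps. -/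
lemma ProperUnimodal.distortion {F : ℝ → ℝ} {c ℓ δ₀ B₁ B₂ C₀ : ℝ} (h : ProperUnimodal F c)
    (hℓ : 1 < ℓ) (hδ₀ : 0 < δ₀) (hB₁ : 0 < B₁) (hB₂ : 0 < B₂) (hC₀ : 0 ≤ C₀)
    (hslope : ∀ x ∈ Icc (c - δ₀) (c + δ₀), ∀ y ∈ Icc (c - δ₀) (c + δ₀),
      (c ≤ x ∧ x ≤ y ∨ y ≤ x ∧ x ≤ c) → B₁ * |y - c| ^ (ℓ - 1) * |y - x| ≤ |F x - F y| ∧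
          |F x - F y| ≤ B₂ * |y - c| ^ (ℓ - 1) * |y - x|)
    (hcross : ∀ a b e d, c - δ₀ ≤ a → a < b → b < e → e < d → d ≤ c + δ₀ → c ∉ Ioo a d →
        Real.exp (-(C₀ * |d - a|)) * crossRatio a b e d ≤ crossRatio (F a) (F b) (F e) (F d))
    (hfar : ∀ ε > 0, ε < c → ε < 1 - c → (∃ m M K, SlopeBounds F (Icc (-4) (c - ε)) m M K) ∧
      ∃ m M K, SlopeBounds F (Icc (c + ε) 5) m M K) :
    ∃ C A₁ A₂, Distortion F c C (ℓ - 1) A₁ A₂ := by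
  have hc := h.c_mem
  obtain ⟨δ, hδ, hδ1, hδ2, hδ3⟩ : ∃ δ > 0, δ ≤ δ₀ ∧ δ ≤ c ∧ δ ≤ 1 - c :=
    ⟨min δ₀ (min c (1 - c)), lt_min hδ₀ (lt_min hc.1 (by linarith [hc.2])), by simp, by simp,
      by simp⟩
  obtain ⟨⟨m₁, M₁, K₁, H₁⟩, m₂, M₂, K₂, H₂⟩ :=
    hfar (δ / 2) (by positivity) (by linarith) (by linarith)
  obtain ⟨m, M, K, hm, hM, hL, hR⟩ : ∃ m M K, 0 < m ∧ 0 < M ∧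
      SlopeBounds F (Icc (-4) (c - δ / 2)) m M K ∧ SlopeBounds F (Icc (c + δ / 2) 5) m M K := by
    have hm := lt_min H₁.m_pos H₂.m_pos
    exact ⟨min m₁ m₂, max (max M₁ M₂) 1, max K₁ K₂, hm, lt_max_of_lt_right one_pos,
      H₁.weaken hm (by simp) (by simp) (by simp), H₂.weaken hm (by simp) (by simp) (by simp)⟩
  set q := ℓ - 1 with hq
  have hq0 : 0 < q := by linarith
  have hfar' : ∀ x ∈ Icc (-4:ℝ) 5, ∀ y ∈ Icc (-4:ℝ) 5, (c ≤ x ∧ x ≤ y ∨ y ≤ x ∧ x ≤ c) →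
      δ ≤ |x - c| → m * |y - x| ≤ |F x - F y| ∧ |F x - F y| ≤ M * |y - x| := by
    intro x hx y hy hxy hxδ
    rw [abs_sub_comm (F x)]
    rcases hxy with ⟨h1, h2⟩ | ⟨h1, h2⟩
    · rw [abs_of_nonneg (by linarith)] at hxδ
      exact hR.dist ⟨by linarith, hx.2⟩ ⟨by linarith, hy.2⟩
    · rw [abs_of_nonpos (by linarith)] at hxδ
      exact hL.dist ⟨hx.1, by linarith⟩ ⟨hy.1, by linarith⟩
  have hsign : ∀ x y, (c ≤ x ∧ x ≤ y ∨ y ≤ x ∧ x ≤ c) → |F x - F y| = F x - F y := by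
    intro x y hxy
    refine abs_of_nonneg (sub_nonneg.2 ?_)
    rcases hxy with ⟨h1, h2⟩ | ⟨h1, h2⟩
    · exact h.anti.antitoneOn h1 (h1.trans h2) h2
    · exact h.mono.monotoneOn (h1.trans h2) h2 h1
  set A₁ := min (B₁ * (δ / 9) ^ q) (m / 9 ^ q) with hA₁
  set A₂ := max B₂ (M / δ ^ q) with hA₂
  have hA₁0 : 0 < A₁ := lt_min (by positivity) (by positivity)
  have hA₂0 : 0 < A₂ := lt_max_of_lt_left hB₂
  have hδ9 : (δ / 9) ^ q ≤ 1 := Real.rpow_le_one (by positivity) (by linarith [hc.2]) hq0.le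
  have hA₁B : A₁ ≤ B₁ := (min_le_left _ _).trans (mul_le_of_le_one_right hB₁.le hδ9)
  have hnear : ∀ x y, (c ≤ x ∧ x ≤ y ∨ y ≤ x ∧ x ≤ c) → |y - c| ≤ δ →
      B₁ * |y - c| ^ q * |y - x| ≤ F x - F y ∧ F x - F y ≤ B₂ * |y - c| ^ q * |y - x| := by
    intro x y hxy hy
    have hy' := abs_le.1 hy
    rw [← hsign x y hxy]
    refine hslope x ?_ y ⟨by linarith, by linarith⟩ hxy
    rcases hxy with ⟨h1, h2⟩ | ⟨h1, h2⟩ <;> constructor <;> linarith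
  have h9 : ∀ y ∈ Icc (-4:ℝ) 5, |y - c| ≤ 9 := fun y hy => by
    rw [abs_le]; constructor <;> linarith [hc.1, hc.2, hy.1, hy.2]
  have hfar2 : ∀ x ∈ Icc (-4:ℝ) 5, ∀ y ∈ Icc (-4:ℝ) 5, (c ≤ x ∧ x ≤ y ∨ y ≤ x ∧ x ≤ c) →
      δ ≤ |x - c| → A₁ * |y - c| ^ q * |y - x| ≤ F x - F y ∧
        F x - F y ≤ A₂ * |y - c| ^ q * |y - x| := by
    intro x hx y hy hxy hxδ
    have hyδ : δ ≤ |y - c| := hxδ.trans (by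
      rcases hxy with ⟨h1, h2⟩ | ⟨h1, h2⟩
      · rw [abs_of_nonneg (by linarith), abs_of_nonneg (by linarith)]; linarith
      · rw [abs_of_nonpos (by linarith), abs_of_nonpos (by linarith)]; linarith)
    obtain ⟨b1, b2⟩ := hfar' x hx y hy hxy hxδ
    rw [hsign x y hxy] at b1 b2
    have b3 : |y - c| ^ q ≤ 9 ^ q := Real.rpow_le_rpow (abs_nonneg _) (h9 y hy) hq0.le
    have b4 : δ ^ q ≤ |y - c| ^ q := Real.rpow_le_rpow hδ.le hyδ hq0.le
    constructor
    · refine le_trans (mul_le_mul_of_nonneg_right ?_ (abs_nonneg _)) b1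
      calc A₁ * |y - c| ^ q ≤ m / 9 ^ q * 9 ^ q :=
            mul_le_mul (min_le_right _ _) b3 (by positivity) (by positivity)
        _ = m := by field_simp
    · refine b2.trans (mul_le_mul_of_nonneg_right ?_ (abs_nonneg _))
      calc M = M / δ ^ q * δ ^ q := by field_simp
        _ ≤ _ := mul_le_mul (le_max_right _ _) b4 (by positivity) hA₂0.le
  have hmain : ∀ x y, x ∈ Icc (-4:ℝ) 5 → y ∈ Icc (-4:ℝ) 5 → (c ≤ x ∧ x ≤ y ∨ y ≤ x ∧ x ≤ c) →
      A₁ * |y - c| ^ q * |y - x| ≤ F x - F y ∧ F x - F y ≤ A₂ * |y - c| ^ q * |y - x| := by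
    intro x y hx hy hxy
    by_cases hyδ : |y - c| ≤ δ
    · obtain ⟨b1, b2⟩ := hnear x y hxy hyδ
      have hw : 0 ≤ |y - c| ^ q * |y - x| := by positivity
      have b3 := mul_le_mul_of_nonneg_right hA₁B hw
      have b4 := mul_le_mul_of_nonneg_right (le_max_left B₂ (M / δ ^ q)) hw
      constructor <;> linarith
    by_cases hxδ : δ ≤ |x - c|
    · exact hfar2 x hx y hy hxy hxδ
    push Not at hyδ hxδ
    obtain ⟨z, hz, hxz, hzy, hzc, hlen⟩ : ∃ z ∈ Icc (-4:ℝ) 5, (c ≤ x ∧ x ≤ z ∨ z ≤ x ∧ x ≤ c) ∧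
        (c ≤ z ∧ z ≤ y ∨ y ≤ z ∧ z ≤ c) ∧ |z - c| = δ ∧ |y - x| = |z - x| + |y - z| := by
      rcases hxy with ⟨h1, h2⟩ | ⟨h1, h2⟩
      · rw [abs_of_nonneg (by linarith)] at hyδ hxδ
        refine ⟨c + δ, ⟨by linarith, by linarith⟩, Or.inl ⟨h1, by linarith⟩,
          Or.inl ⟨by linarith, by linarith⟩, by rw [add_sub_cancel_left, abs_of_pos hδ], ?_⟩
        rw [abs_of_nonneg (by linarith), abs_of_nonneg (by linarith), abs_of_nonneg (by linarith)]
        ring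
      · rw [abs_of_nonpos (by linarith)] at hyδ hxδ
        refine ⟨c - δ, ⟨by linarith, by linarith⟩, Or.inr ⟨by linarith, h2⟩,
          Or.inr ⟨by linarith, by linarith⟩, by rw [sub_sub_cancel_left, abs_neg, abs_of_pos hδ], ?_⟩
        rw [abs_of_nonpos (by linarith), abs_of_nonpos (by linarith), abs_of_nonpos (by linarith)]
        ring
    obtain ⟨b1, b2⟩ := hnear x z hxz hzc.le
    obtain ⟨b3, b4⟩ := hfar2 z hz y hy hzy hzc.ge
    rw [hzc] at b1 b2
    rw [hlen]
    have b5 : |y - c| ^ q * (δ / 9) ^ q ≤ δ ^ q := by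
      rw [← Real.mul_rpow (abs_nonneg _) (by positivity)]
      refine Real.rpow_le_rpow (by positivity) ?_ hq0.le
      have := mul_le_mul_of_nonneg_right (h9 y hy) (show 0 ≤ δ / 9 by positivity)
      linarith
    have b6 : δ ^ q ≤ |y - c| ^ q := Real.rpow_le_rpow hδ.le hyδ.le hq0.le
    have b7 : A₁ * |y - c| ^ q ≤ B₁ * δ ^ q := by
      calc A₁ * |y - c| ^ q ≤ B₁ * (δ / 9) ^ q * |y - c| ^ q :=
            mul_le_mul_of_nonneg_right (min_le_left _ _) (by positivity)
        _ = B₁ * (|y - c| ^ q * (δ / 9) ^ q) := by ring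
        _ ≤ _ := mul_le_mul_of_nonneg_left b5 hB₁.le
    have b8 : B₂ * δ ^ q ≤ A₂ * |y - c| ^ q :=
      mul_le_mul (le_max_left _ _) b6 (by positivity) hA₂0.le
    have b9 := mul_le_mul_of_nonneg_right b7 (abs_nonneg (z - x))
    have b10 := mul_le_mul_of_nonneg_right b8 (abs_nonneg (z - x))
    constructor <;> linarith
  have hcoarse : ∀ a b e d, -4 ≤ a → a < b → b < e → e < d → d ≤ 5 → c ∉ Ioo a d →
      (A₁ / A₂) ^ 2 * crossRatio a b e d ≤ crossRatio (F a) (F b) (F e) (F d) := by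
    intro a b e d ha hab hbe hed hd hcad
    have ma : a ∈ Icc (-4:ℝ) 5 := ⟨ha, by linarith⟩
    have mb : b ∈ Icc (-4:ℝ) 5 := ⟨by linarith, by linarith⟩
    have me : e ∈ Icc (-4:ℝ) 5 := ⟨by linarith, by linarith⟩
    have md : d ∈ Icc (-4:ℝ) 5 := ⟨by linarith, hd⟩
    by_cases hca : c ≤ a
    · have hsd : ∀ x y, c ≤ x → x < y → c ≤ x ∧ x ≤ y ∨ y ≤ x ∧ x ≤ c := fun x y h1 h2 =>
        Or.inl ⟨h1, h2.le⟩
      have hlt : ∀ x y, c ≤ x → x < y → F y < F x := fun x y h1 h2 => h.anti h1 (h1.trans h2.le) h2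
      have s1 := hsd b e (by linarith) hbe
      have s2 := hsd a d hca (by linarith)
      have s3 := hsd a b hca hab
      have s4 := hsd e d (by linarith) hed
      have q1 := (hmain b e mb me s1).1
      have q2 := (hmain a d ma md s2).1
      have q3 := (hmain a b ma mb s3).2
      have q4 := (hmain e d me md s4).2
      rw [← hsign _ _ s1, abs_sub_comm (F b)] at q1
      rw [← hsign _ _ s2, abs_sub_comm (F a)] at q2
      rw [← hsign _ _ s3, abs_sub_comm (F a)] at q3
      rw [← hsign _ _ s4, abs_sub_comm (F e)] at q4
      have hbe' : |b - c| ^ q ≤ |e - c| ^ q := by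
        rw [abs_of_nonneg (by linarith : 0 ≤ b - c), abs_of_nonneg (by linarith : 0 ≤ e - c)]
        exact Real.rpow_le_rpow (by linarith) (by linarith) hq0.le
      refine crossRatio_ge_of_bounds hA₁0 hA₂0
        (Real.rpow_pos_of_pos (abs_pos.2 (by linarith : e - c ≠ 0)) q)
        (Real.rpow_pos_of_pos (abs_pos.2 (by linarith : d - c ≠ 0)) q)
        (hlt a b hca hab).ne' (hlt e d (by linarith) hed).ne' hab.ne hed.ne q1 q2 ?_
      calc _ ≤ (A₂ * |b - c| ^ q * |b - a|) * (A₂ * |d - c| ^ q * |d - e|) :=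
            mul_le_mul q3 q4 (abs_nonneg _) (by positivity)
        _ ≤ (A₂ * |e - c| ^ q * |b - a|) * (A₂ * |d - c| ^ q * |d - e|) := by gcongr
        _ = _ := by ring
    · have hdc : d ≤ c := not_lt.1 fun hlt => hcad ⟨not_le.1 hca, hlt⟩
      have hsd : ∀ x y, x ≤ c → y < x → c ≤ x ∧ x ≤ y ∨ y ≤ x ∧ x ≤ c := fun x y h1 h2 =>
        Or.inr ⟨h2.le, h1⟩
      have hlt : ∀ x y, x ≤ c → y < x → F y < F x := fun x y h1 h2 => h.mono (h2.le.trans h1) h1 h2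
      have s1 := hsd e b (by linarith) hbe
      have s2 := hsd d a hdc (by linarith)
      have s3 := hsd b a (by linarith) hab
      have s4 := hsd d e hdc hed
      have q1 := (hmain e b me mb s1).1
      have q2 := (hmain d a md ma s2).1
      have q3 := (hmain b a mb ma s3).2
      have q4 := (hmain d e md me s4).2
      rw [← hsign _ _ s1, abs_sub_comm b e] at q1
      rw [← hsign _ _ s2, abs_sub_comm a d] at q2
      rw [← hsign _ _ s3, abs_sub_comm a b] at q3
      rw [← hsign _ _ s4, abs_sub_comm e d] at q4
      have hbe' : |e - c| ^ q ≤ |b - c| ^ q := by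
        rw [abs_of_nonpos (by linarith : b - c ≤ 0), abs_of_nonpos (by linarith : e - c ≤ 0)]
        exact Real.rpow_le_rpow (by linarith) (by linarith) hq0.le
      refine crossRatio_ge_of_bounds hA₁0 hA₂0
        (Real.rpow_pos_of_pos (abs_pos.2 (by linarith : b - c ≠ 0)) q)
        (Real.rpow_pos_of_pos (abs_pos.2 (by linarith : a - c ≠ 0)) q)
        (hlt b a (by linarith) hab).ne (hlt d e hdc hed).ne hab.ne hed.ne q1 q2 ?_
      calc _ ≤ (A₂ * |a - c| ^ q * |b - a|) * (A₂ * |e - c| ^ q * |d - e|) :=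
            mul_le_mul q3 q4 (abs_nonneg _) (by positivity)
        _ ≤ (A₂ * |a - c| ^ q * |b - a|) * (A₂ * |b - c| ^ q * |d - e|) := by gcongr
        _ = _ := by ring
  set C := max C₀ (max (2 * (K / m)) (|Real.log ((A₁ / A₂) ^ 2)| / (δ / 2))) with hC
  have hreduce : ∀ C' a b e d r, C' ≤ C → Real.exp (-(C' * |d - a|)) * crossRatio a b e d ≤ r →
      Real.exp (-(C * (|d - a| + |F d - F a|))) * crossRatio a b e d ≤ r := by
    intro C' a b e d r hC' hr
    refine le_trans (mul_le_mul_of_nonneg_right (Real.exp_le_exp.2 (neg_le_neg ?_))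
      (by unfold crossRatio; positivity)) hr
    have h1 : 0 ≤ C := hC₀.trans (le_max_left _ _)
    exact mul_le_mul hC' (le_add_of_nonneg_right (abs_nonneg _)) (abs_nonneg _) h1
  refine ⟨C, A₁, A₂, hC₀.trans (le_max_left _ _), hq0, hA₁0, hA₂0, ?_, hmain⟩
  intro a b e d ha hab hbe hed hd hcad
  by_cases hn : c - δ ≤ a ∧ d ≤ c + δ
  · exact hreduce C₀ a b e d _ (le_max_left _ _)
      (hcross a b e d (by linarith) hab hbe hed (by linarith) hcad)
  by_cases hR' : c + δ / 2 ≤ a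
  · exact hreduce _ a b e d _ ((le_max_left _ _).trans (le_max_right _ _))
      (hR.cross ⟨hR', by linarith⟩ ⟨by linarith, hd⟩ hab hbe hed).1
  by_cases hL' : d ≤ c - δ / 2
  · exact hreduce _ a b e d _ ((le_max_left _ _).trans (le_max_right _ _))
      (hL.cross ⟨ha, by linarith⟩ ⟨by linarith, hL'⟩ hab hbe hed).1
  have hlong : δ / 2 ≤ |d - a| := by
    rw [abs_of_pos (by linarith)]
    by_contra hlt
    push Not at hR' hL' hlt
    exact hn ⟨by linarith, by linarith⟩
  refine hreduce (|Real.log ((A₁ / A₂) ^ 2)| / (δ / 2)) a b e d _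
    ((le_max_right _ _).trans (le_max_right _ _)) (le_trans (mul_le_mul_of_nonneg_right ?_
      (by unfold crossRatio; positivity)) (hcoarse a b e d ha hab hbe hed hd hcad))
  rw [← Real.le_log_iff_exp_le (by positivity)]
  have h1 : |Real.log ((A₁ / A₂) ^ 2)| ≤ |Real.log ((A₁ / A₂) ^ 2)| / (δ / 2) * |d - a| := by
    rw [div_mul_eq_mul_div, le_div_iff₀ (by positivity)]
    exact mul_le_mul_of_nonneg_left hlong (abs_nonneg _)
  have h2 := neg_abs_le (Real.log ((A₁ / A₂) ^ 2))
  linarith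

lemma exists_slopeBounds_Icc {g : ℝ → ℝ} {u v : ℝ} (huv : u < v)
    (hg : ContDiffOn ℝ 3 g (Icc u v)) (hne : ∀ x ∈ Icc u v, deriv g x ≠ 0) :
    ∃ m M K, SlopeBounds g (Icc u v) m M K := by
  have hdiff : ∀ x ∈ Icc u v, HasDerivAt g (deriv g x) x := fun x hx =>
    (differentiableAt_of_deriv_ne_zero (hne x hx)).hasDerivAt
  have hd : ContDiffOn ℝ 2 (deriv g) (Icc u v) :=
    (hg.derivWithin (uniqueDiffOn_Icc huv) (by norm_num)).congr fun x hx =>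
      ((hdiff x hx).differentiableAt.derivWithin (uniqueDiffOn_Icc huv x hx)).symm
  obtain ⟨K, hK⟩ := hd.exists_lipschitzOnWith (by norm_num) (convex_Icc u v) isCompact_Icc
  have hcont : ContinuousOn (fun x => |deriv g x|) (Icc u v) := hd.continuousOn.abs
  have hnon : (Icc u v).Nonempty := nonempty_Icc.2 huv.le
  obtain ⟨x₀, hx₀, hmin⟩ := isCompact_Icc.exists_isMinOn hnon hcont
  obtain ⟨x₁, hx₁, hmax⟩ := isCompact_Icc.exists_isMaxOn hnon hcont
  refine ⟨|deriv g x₀|, |deriv g x₁|, K, abs_pos.2 (hne x₀ hx₀), K.2, ordConnected_Icc, hdiff,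
    fun x hx => hmin hx, fun x hx => hmax hx, fun x hx y hy => ?_⟩
  simpa [Real.dist_eq] using hK.dist_le_mul x hx y hy

lemma SlopeBounds.glue {g : ℝ → ℝ} {u v w m₁ M₁ K₁ m₂ M₂ K₂ : ℝ} (huv : u ≤ v) (hvw : v ≤ w)
    (h₁ : SlopeBounds g (Icc u v) m₁ M₁ K₁) (h₂ : SlopeBounds g (Icc v w) m₂ M₂ K₂) :
    ∃ m M K, SlopeBounds g (Icc u w) m M K := by
  have hm := lt_min h₁.m_pos h₂.m_pos
  have h₁' := h₁.weaken hm (min_le_left _ _) (le_max_left M₁ M₂) (le_max_left K₁ K₂)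
  have h₂' := h₂.weaken hm (min_le_right _ _) (le_max_right M₁ M₂) (le_max_right K₁ K₂)
  have hsub : ∀ x ∈ Icc u w, x ∈ Icc u v ∨ x ∈ Icc v w := fun x hx =>
    (le_total x v).imp (fun h => ⟨hx.1, h⟩) fun h => ⟨h, hx.2⟩
  have key : ∀ x ∈ Icc u v, ∀ y ∈ Icc v w, |deriv g x - deriv g y| ≤ max K₁ K₂ * |x - y| := by
    intro x hx y hy
    have e : |x - y| = |x - v| + |v - y| := by
      rw [abs_of_nonpos (by linarith [hx.2, hy.1]), abs_of_nonpos (by linarith [hx.2]),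
        abs_of_nonpos (by linarith [hy.1])]
      ring
    rw [e, mul_add]
    exact (abs_sub_le _ (deriv g v) _).trans
      (add_le_add (h₁'.lip x hx v ⟨huv, le_rfl⟩) (h₂'.lip v ⟨le_rfl, hvw⟩ y hy))
  refine ⟨_, _, _, hm, h₁'.K_nonneg, ordConnected_Icc,
    fun x hx => (hsub x hx).elim (h₁'.hasDeriv x) (h₂'.hasDeriv x),
    fun x hx => (hsub x hx).elim (h₁'.lower x) (h₂'.lower x),
    fun x hx => (hsub x hx).elim (h₁'.upper x) (h₂'.upper x), fun x hx y hy => ?_⟩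
  rcases hsub x hx with hx | hx <;> rcases hsub y hy with hy | hy
  · exact h₁'.lip x hx y hy
  · exact key x hx y hy
  · rw [abs_sub_comm, abs_sub_comm x]
    exact key y hy x hx
  · exact h₂'.lip x hx y hy

/-- Extension of a map of `[0,1]` to the line by quadratic polynomials matching its one-jets at
the endpoints. -/
def quadExtend (f : ℝ → ℝ) (x : ℝ) : ℝ :=
  if x ≤ 0 then f 0 + deriv f 0 * x - 2 * x ^ 2
  else if x ≤ 1 then f x
  else f 1 + deriv f 1 * (x - 1) - 2 * (x - 1) ^ 2

lemma quadExtend_of_mem (f : ℝ → ℝ) {x : ℝ} (hx : x ∈ Icc (0:ℝ) 1) : quadExtend f x = f x := by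
  unfold quadExtend
  split_ifs with h1 h2
  · rw [le_antisymm h1 hx.1]; ring
  · rfl
  · exact absurd hx.2 h2

lemma quadExtend_of_nonpos (f : ℝ → ℝ) {x : ℝ} (hx : x ≤ 0) :
    quadExtend f x = f 0 + deriv f 0 * x - 2 * x ^ 2 := if_pos hx

lemma quadExtend_of_one_le (f : ℝ → ℝ) {x : ℝ} (hx : 1 ≤ x) :
    quadExtend f x = f 1 + deriv f 1 * (x - 1) - 2 * (x - 1) ^ 2 := by
  rcases hx.eq_or_lt with rfl | hx
  · rw [quadExtend_of_mem f ⟨zero_le_one, le_rfl⟩]; ring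
  · unfold quadExtend
    rw [if_neg (by linarith), if_neg (by linarith)]

lemma hasDerivAt_of_sides {g : ℝ → ℝ} {d x : ℝ} (h₁ : HasDerivWithinAt g d (Iic x) x)
    (h₂ : HasDerivWithinAt g d (Ici x) x) : HasDerivAt g d x := by
  rw [← hasDerivWithinAt_univ, ← Iic_union_Ici (a := x)]
  exact h₁.union h₂

lemma hasDerivAt_quadratic (p d x₀ x : ℝ) :
    HasDerivAt (fun y => p + d * (y - x₀) - 2 * (y - x₀) ^ 2) (d - 4 * (x - x₀)) x := by
  have h := (hasDerivAt_id x).sub_const x₀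
  refine (((h.const_mul d).const_add p).sub ((h.pow 2).const_mul 2)).congr_deriv ?_
  simp; ring

namespace UnimodalA

variable {f : ℝ → ℝ} {c ℓ : ℝ}

section
variable (h : UnimodalA f c ℓ)
include h

lemma hasDerivAt {x : ℝ} (hx : x ∈ Icc (0:ℝ) 1) (hxc : x ≠ c) : HasDerivAt f (deriv f x) x :=
  (differentiableAt_of_deriv_ne_zero (h.deriv_ne x ⟨hx, hxc⟩)).hasDerivAt

lemma deriv_zero_pos : 0 < deriv f 0 := by
  have hc := h.c_mem
  have h0 := h.hasDerivAt (x := 0) (by simp) hc.1.ne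
  have h1 := h.mono.monotoneOn.derivWithin_nonneg (x := 0)
  rw [h0.differentiableAt.derivWithin (uniqueDiffOn_Icc hc.1 0 ⟨le_rfl, hc.1.le⟩)] at h1
  exact h1.lt_of_ne' (h.deriv_ne 0 ⟨by simp, hc.1.ne⟩)

lemma deriv_one_neg : deriv f 1 < 0 := by
  have hc := h.c_mem
  have h0 := h.hasDerivAt (x := 1) (by simp) hc.2.ne'
  have h1 := h.anti.antitoneOn.derivWithin_nonpos (x := 1)
  rw [h0.differentiableAt.derivWithin (uniqueDiffOn_Icc hc.2 1 ⟨hc.2.le, le_rfl⟩)] at h1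
  exact h1.lt_of_ne (h.deriv_ne 1 ⟨by simp, hc.2.ne'⟩)

lemma quadExtend_hasDerivAt_of_nonpos {x : ℝ} (hx : x ≤ 0) :
    HasDerivAt (quadExtend f) (deriv f 0 - 4 * x) x := by
  have hq := hasDerivAt_quadratic (f 0) (deriv f 0) 0 x
  simp only [sub_zero] at hq
  rcases hx.eq_or_lt with rfl | hx
  · refine hasDerivAt_of_sides (hq.hasDerivWithinAt.congr (fun y hy => quadExtend_of_nonpos f hy)
      (quadExtend_of_nonpos f le_rfl)) ?_
    have h0 := (h.hasDerivAt (x := 0) (by simp) h.c_mem.1.ne).hasDerivWithinAt (s := Ici 0)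
    rw [mul_zero, sub_zero]
    exact h0.congr_of_eventuallyEq
      (mem_of_superset (Icc_mem_nhdsGE zero_lt_one) fun y hy => quadExtend_of_mem f hy)
      (quadExtend_of_mem f (by simp))
  · exact hq.congr_of_eventuallyEq
      (mem_of_superset (Iio_mem_nhds hx) fun y hy => quadExtend_of_nonpos f (le_of_lt hy))

lemma quadExtend_hasDerivAt_of_one_le {x : ℝ} (hx : 1 ≤ x) :
    HasDerivAt (quadExtend f) (deriv f 1 - 4 * (x - 1)) x := by
  have hq := hasDerivAt_quadratic (f 1) (deriv f 1) 1 x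
  rcases hx.eq_or_lt with rfl | hx
  · refine hasDerivAt_of_sides ?_ (hq.hasDerivWithinAt.congr
      (fun y hy => quadExtend_of_one_le f hy) (quadExtend_of_one_le f le_rfl))
    have h0 := (h.hasDerivAt (x := 1) (by simp) h.c_mem.2.ne').hasDerivWithinAt (s := Iic 1)
    rw [sub_self, mul_zero, sub_zero]
    exact h0.congr_of_eventuallyEq
      (mem_of_superset (Icc_mem_nhdsLE zero_lt_one) fun y hy => quadExtend_of_mem f hy)
      (quadExtend_of_mem f (by simp))
  · exact hq.congr_of_eventuallyEq
      (mem_of_superset (Ioi_mem_nhds hx) fun y hy => quadExtend_of_one_le f (le_of_lt hy))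

lemma quadExtend_hasDerivAt_of_mem {x : ℝ} (hx : x ∈ Icc (0:ℝ) 1) (hxc : x ≠ c) :
    HasDerivAt (quadExtend f) (deriv f x) x := by
  rcases hx.1.eq_or_lt with rfl | h0
  · simpa using h.quadExtend_hasDerivAt_of_nonpos le_rfl
  rcases hx.2.eq_or_lt with rfl | h1
  · simpa using h.quadExtend_hasDerivAt_of_one_le le_rfl
  exact (h.hasDerivAt hx hxc).congr_of_eventuallyEq
    (mem_of_superset (Icc_mem_nhds h0 h1) fun y hy => quadExtend_of_mem f hy)

lemma quadExtend_deriv_ne {x : ℝ} (hxc : x ≠ c) : deriv (quadExtend f) x ≠ 0 := by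
  rcases le_total x 0 with h0 | h0
  · rw [(h.quadExtend_hasDerivAt_of_nonpos h0).deriv]
    have := h.deriv_zero_pos
    exact (by linarith : 0 < deriv f 0 - 4 * x).ne'
  rcases le_total x 1 with h1 | h1
  · rw [(h.quadExtend_hasDerivAt_of_mem ⟨h0, h1⟩ hxc).deriv]
    exact h.deriv_ne x ⟨⟨h0, h1⟩, hxc⟩
  · rw [(h.quadExtend_hasDerivAt_of_one_le h1).deriv]
    have := h.deriv_one_neg
    exact (by linarith : deriv f 1 - 4 * (x - 1) < 0).ne

lemma quadExtend_continuous : Continuous (quadExtend f) := by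
  refine continuous_iff_continuousAt.2 fun x => ?_
  by_cases hxc : x = c
  · have hnhds : Icc (0:ℝ) 1 ∈ 𝓝 x := by rw [hxc]; exact Icc_mem_nhds h.c_mem.1 h.c_mem.2
    exact (h.cont.continuousAt hnhds).congr
      (mem_of_superset hnhds fun y hy => (quadExtend_of_mem f hy).symm)
  · exact (differentiableAt_of_deriv_ne_zero (h.quadExtend_deriv_ne hxc)).continuousAt

lemma quadExtend_properUnimodal : ProperUnimodal (quadExtend f) c := by
  have hc := h.c_mem
  have hcont := h.quadExtend_continuous
  have h0 := h.deriv_zero_pos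
  have h1 := h.deriv_one_neg
  refine ⟨hcont, ?_, ?_, hc, fun x hx => by rw [quadExtend_of_mem f hx]; exact h.maps hx, ?_⟩
  · rw [← Iic_union_Icc_eq_Iic hc.1.le]
    refine StrictMonoOn.union (c := 0) ?_ ?_ isGreatest_Iic (isLeast_Icc hc.1.le)
    · refine strictMonoOn_of_deriv_pos (convex_Iic _) hcont.continuousOn fun x hx => ?_
      rw [interior_Iic] at hx
      rw [(h.quadExtend_hasDerivAt_of_nonpos (le_of_lt hx)).deriv]
      have : x < 0 := hx
      linarith
    · exact h.mono.congr fun x hx => (quadExtend_of_mem f ⟨hx.1, hx.2.trans hc.2.le⟩).symm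
  · rw [← Icc_union_Ici_eq_Ici hc.2.le]
    refine StrictAntiOn.union (c := 1) ?_ ?_ (isGreatest_Icc hc.2.le) isLeast_Ici
    · exact h.anti.congr fun x hx => (quadExtend_of_mem f ⟨hc.1.le.trans hx.1, hx.2⟩).symm
    · refine strictAntiOn_of_deriv_neg (convex_Ici _) hcont.continuousOn fun x hx => ?_
      rw [interior_Ici] at hx
      rw [(h.quadExtend_hasDerivAt_of_one_le (le_of_lt hx)).deriv]
      have : 1 < x := hx
      linarith
  · rintro B hB x (hx | hx)
    · rw [quadExtend_of_nonpos f (by linarith)]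
      have h2 := (h.maps (show (0:ℝ) ∈ Icc (0:ℝ) 1 by simp)).2
      nlinarith
    · rw [quadExtend_of_one_le f (by linarith)]
      have h2 := (h.maps (show (1:ℝ) ∈ Icc (0:ℝ) 1 by simp)).2
      nlinarith

lemma quadExtend_slopeBounds {ε : ℝ} (hε : 0 < ε) (h₀ : ε < c) (h₁ : ε < 1 - c) :
    (∃ m M K, SlopeBounds (quadExtend f) (Icc (-4) (c - ε)) m M K) ∧
      ∃ m M K, SlopeBounds (quadExtend f) (Icc (c + ε) 5) m M K := by
  have hc := h.c_mem
  have hquad : ∀ p d x₀ : ℝ, ∀ S : Set ℝ,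
      ContDiffOn ℝ 3 (fun y => p + d * (y - x₀) - 2 * (y - x₀) ^ 2) S :=
    fun p d x₀ S => ContDiff.contDiffOn (by fun_prop)
  constructor
  · obtain ⟨m₁, M₁, K₁, H₁⟩ := exists_slopeBounds_Icc (g := quadExtend f)
      (show (-4:ℝ) < 0 by norm_num) ((hquad (f 0) (deriv f 0) 0 _).congr fun x hx => by
        rw [quadExtend_of_nonpos f hx.2, sub_zero])
      fun x hx => h.quadExtend_deriv_ne (by linarith [hx.2, hc.1])
    obtain ⟨m₂, M₂, K₂, H₂⟩ := exists_slopeBounds_Icc (g := quadExtend f) (sub_pos.2 h₀)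
      ((h.smooth.mono fun x hx => ⟨⟨hx.1, by linarith [hx.2, hc.2]⟩, fun hxc : x = c => by
        linarith [hx.2]⟩).congr fun x hx =>
        quadExtend_of_mem f ⟨hx.1, by linarith [hx.2, hc.2]⟩)
      fun x hx => h.quadExtend_deriv_ne (by linarith [hx.2] : x < c).ne
    exact H₁.glue (by norm_num) (by linarith) H₂
  · obtain ⟨m₁, M₁, K₁, H₁⟩ := exists_slopeBounds_Icc (g := quadExtend f)
      (show c + ε < 1 by linarith)
      ((h.smooth.mono fun x hx => ⟨⟨by linarith [hx.1, hc.1], hx.2⟩, fun hxc : x = c => by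
        linarith [hx.1]⟩).congr fun x hx =>
        quadExtend_of_mem f ⟨by linarith [hx.1, hc.1], hx.2⟩)
      fun x hx => h.quadExtend_deriv_ne (by linarith [hx.1] : c < x).ne'
    obtain ⟨m₂, M₂, K₂, H₂⟩ := exists_slopeBounds_Icc (g := quadExtend f)
      (show (1:ℝ) < 5 by norm_num) ((hquad (f 1) (deriv f 1) 1 _).congr fun x hx =>
        quadExtend_of_one_le f hx.1)
      fun x hx => h.quadExtend_deriv_ne (by linarith [hx.1, hc.2] : c < x).ne'
    exact H₁.glue (by linarith) (by norm_num) H₂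

lemma quadExtend_distortion : ∃ C A₁ A₂, Distortion (quadExtend f) c C (ℓ - 1) A₁ A₂ := by
  obtain ⟨φ, ψ, hφ0, -, ⟨U, hU, hφ, hψ⟩, hφ', hψ', s, hs, hrep⟩ := h.nonflat
  have hφc : ContinuousAt φ 0 := (hφ.contDiffAt hU).continuousAt
  have hrep' : ∀ᶠ x in 𝓝 (0:ℝ), quadExtend f (φ x) = ψ (s * |x| ^ ℓ) := by
    have hin : ∀ᶠ x in 𝓝 (0:ℝ), φ x ∈ Icc (0:ℝ) 1 :=
      hφc (by rw [hφ0]; exact Icc_mem_nhds h.c_mem.1 h.c_mem.2)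
    filter_upwards [hrep, hin] with x hx hx'
    rw [quadExtend_of_mem f hx', hx]
  obtain ⟨δ, hδ, A₁, hA₁, A₂, hA₂, C, hC, h1, h2⟩ :=
    nearCritical h.ell_gt_one hφ0 hU hφ hψ hφ' hψ' hs hrep'
  exact h.quadExtend_properUnimodal.distortion h.ell_gt_one hδ hA₁ hA₂ hC h1 h2
    fun ε hε h₀ h₁ => h.quadExtend_slopeBounds hε h₀ h₁

end

end UnimodalA

section Transfer

variable {f F : ℝ → ℝ} {c : ℝ}

lemma iterate_eq_of_eqOn {S : Set ℝ} (hS : MapsTo f S S) (hfF : EqOn F f S) (n : ℕ) {x : ℝ}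
    (hx : x ∈ S) : F^[n] x = f^[n] x := by
  induction n with
  | zero => rfl
  | succ n ih => rw [iterate_succ_apply', iterate_succ_apply', ih, hfF (hS.iterate n hx)]

lemma isReturnDomain_congr {T U : Set ℝ} (hit : ∀ n, ∀ x ∈ T, F^[n] x = f^[n] x)
    (h : IsReturnDomain f T U) : IsReturnDomain F T U := by
  have hset : entryDomain f T ∩ T = entryDomain F T ∩ T := by
    ext x
    refine and_congr_left fun hx => ?_
    show (∃ k, 1 ≤ k ∧ f^[k] x ∈ T) ↔ ∃ k, 1 ≤ k ∧ F^[k] x ∈ T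
    simp only [hit _ x hx]
  unfold IsReturnDomain returnDomain at *
  rwa [← hset]

lemma isFirstReturnTime_congr {T : Set ℝ} {x : ℝ} {k : ℕ} (hit : ∀ n, F^[n] x = f^[n] x)
    (h : IsFirstReturnTime f T x k) : IsFirstReturnTime F T x k := by
  unfold IsFirstReturnTime at *
  simpa only [hit] using h

lemma iterate_mem_omegaLimitSet (hF : Continuous F) (hit : ∀ n, F^[n] c = f^[n] c)
    (hrec : c ∈ omegaLimitSet f c) (n : ℕ) : F^[n] c ∈ omegaLimitSet f c := by
  refine mem_iInter.2 fun N => ?_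
  refine map_mem_closure (hF.iterate n) (mem_iInter.1 hrec N) ?_
  rintro _ ⟨m, hm, rfl⟩
  refine ⟨n + m, hm.trans (Nat.le_add_left m n), ?_⟩
  simp only [← hit, iterate_add_apply]

lemma omegaLimitSet_eq_orbitClosure (hF : Continuous F) (hit : ∀ n, F^[n] c = f^[n] c)
    (hrec : c ∈ omegaLimitSet f c) : omegaLimitSet f c = orbitClosure F c := by
  apply Subset.antisymm
  · refine (iInter_subset _ 0).trans (closure_mono ?_)
    rintro _ ⟨m, -, rfl⟩
    exact ⟨m, hit m⟩
  · refine closure_minimal ?_ (isClosed_iInter fun N => isClosed_closure)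
    rintro _ ⟨n, rfl⟩
    exact iterate_mem_omegaLimitSet hF hit hrec n

end Transfer

lemma exists_tower {F : ℝ → ℝ} {c : ℝ} (L : ℕ → Level F c)
    (hlen : Tendsto (fun n => (L n).b - (L n).a) atTop (𝓝 0)) :
    ∃ g : ℕ → ℕ, Tower F c (L ∘ g) := by
  have hnext : ∀ n, ∃ m, n < m ∧ Icc (L m).a (L m).b ⊆ Ioo (L n).t₁ (L n).t₂ := by
    intro n
    have h1 := hlen.eventually_lt_const (sub_pos.2 (L n).t_lt)
    have h2 := hlen.eventually_lt_const (sub_pos.2 (L n).lt_t)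
    obtain ⟨m, h1, h2, hm⟩ := (h1.and (h2.and (eventually_gt_atTop n))).exists
    have hc := (L m).nice.mem
    exact ⟨m, hm, fun x hx => ⟨by linarith [hx.1, hc.2], by linarith [hx.2, hc.1]⟩⟩
  choose next hlt hsub using hnext
  have hmono : StrictMono fun k => next^[k] 0 := strictMono_nat_of_lt_succ fun k => by
    rw [iterate_succ_apply']
    exact hlt _
  refine ⟨fun k => next^[k] 0, fun k => ?_, hlen.comp hmono.tendsto_atTop⟩
  simp only [comp_apply, iterate_succ_apply']
  exact hsub _

lemma UnimodalA.conjugateToAddingMachine {f : ℝ → ℝ} {c ℓ : ℝ} (hf : UnimodalA f c ℓ)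
    (hrec : c ∈ omegaLimitSet f c) (T T' Q Qh : ℕ → Set ℝ)
    (hTnice : ∀ n, IsNiceInterval f (T n) ∧ c ∈ T n)
    (hret : ∀ n, IsReturnDomain f (T n) (T' n) ∧ IsReturnDomain f (T n) (Q n) ∧
      IsReturnDomain f (T n) (Qh n))
    (hdist : ∀ n, T' n ≠ Q n ∧ T' n ≠ Qh n ∧ Q n ≠ Qh n)
    (hlen : Tendsto (fun n => len (T n)) atTop (𝓝 0))
    (hc : ∀ n, c ∈ T' n) (hQ : ∀ n, f '' Q n = f '' Qh n)
    (hiii : ∀ n, ∀ x ∈ T' n ∩ omegaLimitSet f c,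
      ∃ k, IsFirstReturnTime f (T n) x k ∧ f^[k] x ∈ Q n ∪ Qh n)
    (hiv : ∀ n, ∀ x ∈ (Q n ∪ Qh n) ∩ omegaLimitSet f c,
      ∃ k, IsFirstReturnTime f (T n) x k ∧ f^[k] x ∈ T' n) :
    ConjugateToAddingMachine f (omegaLimitSet f c) := by
  set F := quadExtend f
  have hF : ProperUnimodal F c := hf.quadExtend_properUnimodal
  have hit : ∀ n, ∀ x ∈ Icc (0:ℝ) 1, F^[n] x = f^[n] x := fun n x hx =>
    iterate_eq_of_eqOn hf.maps (fun y hy => quadExtend_of_mem f hy) n hx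
  have hc01 : c ∈ Icc (0:ℝ) 1 := Ioo_subset_Icc_self hf.c_mem
  have hitc : ∀ n, F^[n] c = f^[n] c := fun n => hit n c hc01
  have hω := omegaLimitSet_eq_orbitClosure hF.cont hitc hrec
  have horb : ∀ n, F^[n] c ∈ omegaLimitSet f c := iterate_mem_omegaLimitSet hF.cont hitc hrec
  have hrun : ∀ x, x ∈ Icc (0:ℝ) 1 → ∀ (A B : Set ℝ), A ⊆ Icc 0 1 →
      (∃ k, IsFirstReturnTime f A x k ∧ f^[k] x ∈ B) →
      ∃ k, IsFirstReturnTime F A x k ∧ F^[k] x ∈ B := by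
    rintro x hx A B hA ⟨k, h1, h2⟩
    exact ⟨k, isFirstReturnTime_congr (fun n => hit n x hx) h1, by rwa [hit k x hx]⟩
  have hlevel : ∀ n, ∃ L : Level F c, L.b - L.a = len (T n) := by
    intro n
    obtain ⟨⟨⟨a, b, hab, hT⟩, hT01, hfr, -⟩, hcT⟩ := hTnice n
    obtain ⟨r1, r2, r3⟩ := hret n
    obtain ⟨d1, d2, d3⟩ := hdist n
    have hdom : ∀ {U}, IsReturnDomain f (T n) U → U ⊆ T n := by
      rintro _ ⟨x, -, rfl⟩
      exact (connectedComponentIn_subset _ _).trans inter_subset_right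
    have hclos : Icc a b ⊆ Icc (0:ℝ) 1 := by
      rw [← closure_Ioo hab.ne, ← hT]
      exact closure_minimal hT01 isClosed_Icc
    have ha := hclos (left_mem_Icc.2 hab.le)
    have hb := hclos (right_mem_Icc.2 hab.le)
    rw [hT, frontier_Ioo hab] at hfr
    have hN : NiceEnds F c a b := by
      refine ⟨hT ▸ hcT, fun n => ?_, fun n => ?_⟩
      · rw [hit n a ha]; exact hfr n a (by simp)
      · rw [hit n b hb]; exact hfr n b (by simp)
    have himg : ∀ {U}, IsReturnDomain f (T n) U → F '' U = f '' U := fun hU =>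
      image_congr fun x hx => quadExtend_of_mem f (hT01 (hdom hU hx))
    have hret' : ∀ {U}, IsReturnDomain f (T n) U → IsReturnDomain F (Ioo a b) U := fun hU =>
      hT ▸ isReturnDomain_congr (fun k x hx => hit k x (hT01 hx)) hU
    obtain ⟨L, hLa, hLb⟩ := hF.exists_level hN ha.1 hb.2 (hret' r1) (hret' r2) (hret' r3) d1 d2 d3
      (hc n) (by rw [himg r2, himg r3, hQ n])
      (fun m hm => by
        rw [← hT]
        exact hrun _ (hT01 (hdom r1 hm)) _ _ hT01 (hiii n _ ⟨hm, horb m⟩))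
      (fun m hm => by
        rw [← hT]
        exact hrun _ (hT01 (hm.elim (fun h => hdom r2 h) fun h => hdom r3 h)) _ _ hT01
          (hiv n _ ⟨hm, horb m⟩))
    refine ⟨L, ?_⟩
    rw [hLa, hLb, hT, len, Real.volume_Ioo, ENNReal.toReal_ofReal (sub_nonneg.2 hab.le)]
  choose L hL using hlevel
  obtain ⟨g, W⟩ := exists_tower L (by simpa only [hL] using hlen)
  obtain ⟨C, A₁, A₂, D⟩ := hf.quadExtend_distortion
  obtain ⟨p, hp, φ, h1, h2, h3, h4⟩ := W.conjugateToAddingMachine hF D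
  rw [hω]
  refine ⟨p, hp, φ, h1, h2, h3, fun x hx => ?_⟩
  have hx01 : x ∈ Icc (0:ℝ) 1 := by
    refine closure_minimal ?_ isClosed_Icc hx
    rintro _ ⟨n, rfl⟩
    exact hF.maps.iterate n hc01
  rw [← quadExtend_of_mem f hx01]
  exact h4 x hx

/-- Lemma 6.2: if for each `n` there is a nice interval `Tₙ ∋ c` with three distinct
return domains `T'ₙ ∋ c`, `Qₙ`, `Q̂ₙ` such that `|Tₙ| → 0`, `f(Qₙ) = f(Q̂ₙ)`, points of
`T'ₙ ∩ ω(c)` first return to `Tₙ` inside `Qₙ ∪ Q̂ₙ`, and points of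
`(Qₙ ∪ Q̂ₙ) ∩ ω(c)` first return to `Tₙ` inside `T'ₙ`, then `f|ω(c)` is topologically
conjugate to an adding machine. -/
theorem adding_machine_criterion (f : ℝ → ℝ) (c ℓ : ℝ) (hf : UnimodalAStar f c ℓ)
    (hrec : c ∈ omegaLimitSet f c)
    (T T' Q Qh : ℕ → Set ℝ)
    (hTnice : ∀ n, IsNiceInterval f (T n) ∧ c ∈ T n)
    (hret : ∀ n, IsReturnDomain f (T n) (T' n) ∧ IsReturnDomain f (T n) (Q n) ∧
      IsReturnDomain f (T n) (Qh n))
    (hdist : ∀ n, T' n ≠ Q n ∧ T' n ≠ Qh n ∧ Q n ≠ Qh n)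
    (hlen : Tendsto (fun n => len (T n)) atTop (𝓝 0))
    (hc : ∀ n, c ∈ T' n)
    (hQ : ∀ n, f '' Q n = f '' Qh n)
    (hiii : ∀ n, ∀ x ∈ T' n ∩ omegaLimitSet f c,
      ∃ k, IsFirstReturnTime f (T n) x k ∧ f^[k] x ∈ Q n ∪ Qh n)
    (hiv : ∀ n, ∀ x ∈ (Q n ∪ Qh n) ∩ omegaLimitSet f c,
      ∃ k, IsFirstReturnTime f (T n) x k ∧ f^[k] x ∈ T' n) :
    ConjugateToAddingMachine f (omegaLimitSet f c) :=
  hf.1.conjugateToAddingMachine hrec T T' Q Qh hTnice hret hdist hlen hc hQ hiii hiv
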